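/- arXiv:math/0303199 — 3 statements merged into one kernel-verified Lean document; each statement's English description precedes it below -/
import Mathlib

section
/- Let a > 0 and let S = (0,∞) × (0,a) ⊂ ℝ² be an open half-strip. Let u be a C² solution of the minimal surfaces equation on S such that u → +∞ on the boundary side (0,∞) × {0} and u → −∞ on the boundary side (0,∞) × {a}. Then at every point (x,y) ∈ S with x ≥ 4a one has |q|/W (x,y) ≥ 1 − a²/x² and |p|/W (x,y) ≤ √2 · a/x. -/
open Real Filter Set Topology MeasureTheory

/-- Partial derivative in the first (x) variable. -/
noncomputable def pd1 (u : ℝ × ℝ → ℝ) (z : ℝ × ℝ) : ℝ := deriv (fun t => u (t, z.2)) z.1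

/-- Partial derivative in the second (y) variable. -/
noncomputable def pd2 (u : ℝ × ℝ → ℝ) (z : ℝ × ℝ) : ℝ := deriv (fun t => u (z.1, t)) z.2

/-- `W = √(1 + p² + q²)` for the function `u`. -/
noncomputable def Wg (u : ℝ × ℝ → ℝ) (z : ℝ × ℝ) : ℝ :=
  Real.sqrt (1 + pd1 u z ^ 2 + pd2 u z ^ 2)

/-- `u` is a C² solution of the minimal surfaces equation
`(1+q²)r − 2pq·s + (1+p²)t = 0` on `Ω`. -/
def IsMSE (u : ℝ × ℝ → ℝ) (Ω : Set (ℝ × ℝ)) : Prop :=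
  ContDiffOn ℝ 2 u Ω ∧ ∀ z ∈ Ω,
    (1 + pd2 u z ^ 2) * pd1 (pd1 u) z
      - 2 * pd1 u z * pd2 u z * pd2 (pd1 u) z
      + (1 + pd1 u z ^ 2) * pd2 (pd2 u) z = 0

/-- Euclidean length of a planar vector. -/
noncomputable def len (v : ℝ × ℝ) : ℝ := Real.sqrt (v.1 ^ 2 + v.2 ^ 2)

/-- Euclidean open disk in the plane. -/
def eball (P : ℝ × ℝ) (ρ : ℝ) : Set (ℝ × ℝ) := {z | len (z - P) < ρ}


theorem alg_closed (p q r s t W : ℝ) (hW : W^2 = 1+p^2+q^2) (h0 : 0 < W)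
   (M : (1+q^2)*r - 2*p*q*s + (1+p^2)*t = 0) :
   ((2*p*s)*W - (1+p^2)*((p*s+q*t)/W))/W^2 = ((r*q+p*s)*W - p*q*((p*r+q*s)/W))/W^2 := by
  have h0' := h0.ne'
  field_simp
  rw [hW]
  linear_combination (-q)*M

theorem alg_c1 (p q r s t W : ℝ) (hW : W^2 = 1+p^2+q^2) (h0 : 0 < W)
   (M : (1+q^2)*r - 2*p*q*s + (1+p^2)*t = 0) :
   (1+p^2)/W * (((p*s+q*t)/W*(1+p^2) - W*(2*p*s))/(1+p^2)^2)
    = (((p*r+q*s)/W*(1+p^2) - W*(2*p*r))/(1+p^2)^2) * (p*q/W) - ((r*q+p*s)*(1+p^2)-p*q*(2*p*r))/(1+p^2)^2 := by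
  have h0' := h0.ne'
  have : 1+p^2 ≠ 0 := by positivity
  field_simp
  rw [hW]
  linear_combination (q*(1+p^2))*M

theorem alg_c2 (p q r s t W : ℝ) (hW : W^2 = 1+p^2+q^2) (h0 : 0 < W)
   (M : (1+q^2)*r - 2*p*q*s + (1+p^2)*t = 0) :
   (1+p^2)/W * (((s*q+p*t)*(1+p^2)-p*q*(2*p*s))/(1+p^2)^2)
    = (((p*r+q*s)/W*(1+p^2) - W*(2*p*r))/(1+p^2)^2) + ((r*q+p*s)*(1+p^2)-p*q*(2*p*r))/(1+p^2)^2 * (p*q/W) := by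
  have h0' := h0.ne'
  have : 1+p^2 ≠ 0 := by positivity
  field_simp
  rw [hW]
  linear_combination (p*(1+p^2))*M

theorem alg_d1 (p q r s t W : ℝ) (hW : W^2 = 1+p^2+q^2) (h0 : 0 < W)
   (M : (1+q^2)*r - 2*p*q*s + (1+p^2)*t = 0) :
   (1+p^2)/W * (((s*W+p*((p*s+q*t)/W))*(1+p^2) - p*W*(2*p*s))/(1+p^2)^2)
    = (((r*W+p*((p*r+q*s)/W))*(1+p^2) - p*W*(2*p*r))/(1+p^2)^2) * (p*q/W) - ((-s)*(1+p^2)-(-q)*(2*p*r))/(1+p^2)^2 := by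
  have h0' := h0.ne'
  have : 1+p^2 ≠ 0 := by positivity
  field_simp
  rw [hW]
  linear_combination (p*q*(1+p^2))*M

theorem alg_d2 (p q r s t W : ℝ) (hW : W^2 = 1+p^2+q^2) (h0 : 0 < W)
   (M : (1+q^2)*r - 2*p*q*s + (1+p^2)*t = 0) :
   (1+p^2)/W * (((-t)*(1+p^2)-(-q)*(2*p*s))/(1+p^2)^2)
    = (((r*W+p*((p*r+q*s)/W))*(1+p^2) - p*W*(2*p*r))/(1+p^2)^2) + ((-s)*(1+p^2)-(-q)*(2*p*r))/(1+p^2)^2 * (p*q/W) := by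
  have h0' := h0.ne'
  have : 1+p^2 ≠ 0 := by positivity
  field_simp
  rw [hW]
  linear_combination (-(1+p^2))*M

noncomputable def dl (a b : ℝ) : ℝ × ℝ →L[ℝ] ℝ :=
  a • ContinuousLinearMap.fst ℝ ℝ ℝ + b • ContinuousLinearMap.snd ℝ ℝ ℝ

theorem dl_apply (a b : ℝ) (h : ℝ × ℝ) : dl a b h = a * h.1 + b * h.2 := by simp [dl]

theorem dl_mul {f g : ℝ × ℝ → ℝ} {a b c d : ℝ} {z : ℝ × ℝ} (hf : HasFDerivAt f (dl a b) z)
    (hg : HasFDerivAt g (dl c d) z) :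
    HasFDerivAt (fun z => f z * g z) (dl (a * g z + f z * c) (b * g z + f z * d)) z := by
  refine (hf.mul hg).congr_fderiv ?_
  ext <;> simp [dl] <;> ring

theorem dl_div {f g : ℝ × ℝ → ℝ} {a b c d : ℝ} {z : ℝ × ℝ} (hf : HasFDerivAt f (dl a b) z)
    (hg : HasFDerivAt g (dl c d) z) (h0 : g z ≠ 0) :
    HasFDerivAt (fun z => f z / g z)
      (dl ((a * g z - f z * c) / g z ^ 2) ((b * g z - f z * d) / g z ^ 2)) z := by
  have h1 : HasFDerivAt (fun z => (g z)⁻¹) (dl (-c / g z ^ 2) (-d / g z ^ 2)) z := by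
    refine ((hasDerivAt_inv h0).comp_hasFDerivAt z hg).congr_fderiv ?_
    ext <;> simp [dl] <;> ring
  have h2 := dl_mul hf h1
  simp only [← div_eq_mul_inv] at h2
  refine h2.congr_fderiv ?_
  congr 1 <;> field_simp <;> ring

theorem dl_neg {f : ℝ × ℝ → ℝ} {a b : ℝ} {z : ℝ × ℝ} (hf : HasFDerivAt f (dl a b) z) :
    HasFDerivAt (fun z => - f z) (dl (-a) (-b)) z := by
  refine hf.neg.congr_fderiv ?_
  ext <;> simp [dl]

theorem dl_A {f : ℝ × ℝ → ℝ} {a b : ℝ} {z : ℝ × ℝ} (hf : HasFDerivAt f (dl a b) z) :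
    HasFDerivAt (fun z => 1 + f z ^ 2) (dl (2 * f z * a) (2 * f z * b)) z := by
  refine ((hf.pow 2).const_add 1).congr_fderiv ?_
  ext <;> simp [dl] <;> ring

theorem dl_W {f g : ℝ × ℝ → ℝ} {a b c d : ℝ} {z : ℝ × ℝ} (hf : HasFDerivAt f (dl a b) z)
    (hg : HasFDerivAt g (dl c d) z) :
    HasFDerivAt (fun z => √(1 + f z ^ 2 + g z ^ 2))
      (dl ((f z * a + g z * c) / √(1 + f z ^ 2 + g z ^ 2))
        ((f z * b + g z * d) / √(1 + f z ^ 2 + g z ^ 2))) z := by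
  have h1 := ((hf.pow 2).const_add 1).add (hg.pow 2)
  have h2 : (1 + f z ^ 2 + g z ^ 2) ≠ 0 := by positivity
  refine (h1.sqrt h2).congr_fderiv ?_
  have h3 : √(1 + f z ^ 2 + g z ^ 2) ≠ 0 := by positivity
  ext <;> simp [dl] <;> field_simp <;> ring

/-- the complex one-form `(α + 0) dx + (β + i) dy`. -/
noncomputable def om (α β : ℝ) : ℝ × ℝ →L[ℝ] ℂ :=
  α • (Complex.ofRealCLM.comp (ContinuousLinearMap.fst ℝ ℝ ℝ))
   + β • (Complex.ofRealCLM.comp (ContinuousLinearMap.snd ℝ ℝ ℝ))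
   + Complex.I • (Complex.ofRealCLM.comp (ContinuousLinearMap.snd ℝ ℝ ℝ))

theorem om_apply (α β : ℝ) (h : ℝ × ℝ) : om α β h = ⟨α * h.1 + β * h.2, h.2⟩ := by
  apply Complex.ext <;> simp [om]

theorem om_equiv (α β : ℝ) (h : α ≠ 0) : ∃ e : (ℝ × ℝ) ≃L[ℝ] ℂ, (e : ℝ × ℝ →L[ℝ] ℂ) = om α β := by
  let inv : ℂ →L[ℝ] ℝ × ℝ :=
    (α⁻¹ • (Complex.reCLM - β • Complex.imCLM)).prod Complex.imCLM
  refine ⟨ContinuousLinearEquiv.equivOfInverse (om α β) inv ?_ ?_, ?_⟩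
  · intro x
    simp [inv, om_apply, h]
  · intro x
    apply Complex.ext <;> simp [inv, om_apply, h]
  · ext <;> simp

theorem cplx_fderiv {f g : ℝ × ℝ → ℝ} {a b c d α β : ℝ} {z : ℝ × ℝ} (hα : α ≠ 0)
    (hf : HasFDerivAt f (dl a b) z)
    (hg : HasFDerivAt g (dl c d) z) (h1 : α * b = a * β - c) (h2 : α * d = a + c * β) :
    HasFDerivAt (fun z => (⟨f z, g z⟩ : ℂ)) (((⟨a, c⟩ : ℂ) / α) • om α β) z := by
  have h3 : HasFDerivAt (fun z => (⟨f z, g z⟩ : ℂ)) 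
     (Complex.ofRealCLM.comp (dl a b) + Complex.I • Complex.ofRealCLM.comp (dl c d)) z := by
    have := (Complex.ofRealCLM.hasFDerivAt.comp z hf).add ((Complex.ofRealCLM.hasFDerivAt.comp z hg).const_smul Complex.I)
    refine this.congr_of_eventuallyEq (Filter.Eventually.of_forall fun z => ?_)
    apply Complex.ext <;> simp
  refine h3.congr_fderiv ?_
  have hb : b = (a * β - c) / α := by field_simp; linarith
  have hd : d = (a + c * β) / α := by field_simp; linarith
  ext
  all_goals apply Complex.ext <;> simp [om_apply, dl_apply, hb, hd, Complex.div_re, Complex.div_im, Complex.normSq_apply] <;> field_simp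


theorem second_deriv_le {f f' : ℝ → ℝ} {c : ℝ} (h1 : ∀ᶠ t in 𝓝 (0:ℝ), HasDerivAt f (f' t) t)
    (h2 : HasDerivAt f' c 0) (hm : IsLocalMax f 0) : c ≤ 0 := by
  by_contra hc
  push Not at hc
  have hd : deriv f =ᶠ[𝓝 0] f' := h1.mono fun t ht => ht.deriv
  have hdd : deriv (deriv f) 0 = c := by rw [hd.deriv_eq, h2.deriv]
  have hmin : IsLocalMin f 0 := isLocalMin_of_deriv_deriv_pos (by rw [hdd]; exact hc)
    hm.deriv_eq_zero h1.self_of_nhds.continuousAt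
  have hconst : f =ᶠ[𝓝 0] fun _ => f 0 := by
    filter_upwards [hm, hmin] with t a b using le_antisymm a b
  have h3 : deriv f =ᶠ[𝓝 0] fun _ => 0 := by
    have := hconst.deriv
    simpa using this
  rw [h3.deriv_eq] at hdd
  simp at hdd
  linarith

/-- `f` is locally the real part of a primitive of `κ`. -/
def HarmAt (f : ℂ → ℝ) (κ : ℂ → ℂ) (κ' : ℂ) (w : ℂ) : Prop :=
  (∀ᶠ ζ in 𝓝 w, HasFDerivAt f (Complex.reCLM.comp (κ ζ • (1 : ℂ →L[ℝ] ℂ))) ζ) ∧ HasDerivAt κ κ' w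

theorem HarmAt.line {f : ℂ → ℝ} {κ : ℂ → ℂ} {κ' w : ℂ} (h : HarmAt f κ κ' w) (e : ℂ) :
    (∀ᶠ t : ℝ in 𝓝 0, HasDerivAt (fun t : ℝ => f (w + t * e)) (κ (w + t * e) * e).re t) ∧
    HasDerivAt (fun t : ℝ => (κ (w + t * e) * e).re) (κ' * e * e).re 0 := by
  have hl : ∀ t : ℝ, HasDerivAt (fun t : ℝ => w + t * e) e t := fun t => by
    simpa using ((Complex.ofRealCLM.hasDerivAt (x := t)).mul_const e).const_add w
  have ht : Tendsto (fun t : ℝ => w + t * e) (𝓝 0) (𝓝 w) := by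
    have := (hl 0).continuousAt.tendsto
    simpa using this
  constructor
  · filter_upwards [ht.eventually h.1] with t h1
    have := h1.comp_hasDerivAt t (hl t)
    exact this.congr_deriv (by simp)
  · have h2 : HasDerivAt κ κ' (w + (0:ℝ) * e) := by simpa using h.2
    have h3 := (h2.comp (0:ℝ) (hl 0)).mul_const e
    exact (Complex.reCLM.hasFDerivAt.comp_hasDerivAt (0:ℝ) h3)

theorem line_max {x y z l x1 y1 z1 l1 : ℝ → ℝ} {x2 y2 z2 l2 δ b τ z0 k m : ℝ}
   (hx : ∀ᶠ t in 𝓝 (0:ℝ), HasDerivAt x (x1 t) t) (hx2 : HasDerivAt x1 x2 0)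
   (hy : ∀ᶠ t in 𝓝 (0:ℝ), HasDerivAt y (y1 t) t) (hy2 : HasDerivAt y1 y2 0)
   (hz : ∀ᶠ t in 𝓝 (0:ℝ), HasDerivAt z (z1 t) t) (hz2 : HasDerivAt z1 z2 0)
   (hl : ∀ᶠ t in 𝓝 (0:ℝ), HasDerivAt l (l1 t) t) (hl2 : HasDerivAt l1 l2 0)
   (hη : 0 < (x 0 - δ) * (b - x 0) - τ * (z 0 - z0)^2)
   (hm : IsLocalMax (fun t => Real.log ((x t - δ) * (b - x t) - τ * (z t - z0)^2) + k * (y t - m)^2 - l t) 0) :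
   ((x2 * (b + δ - 2 * x 0) - 2 * x1 0 ^ 2 - 2 * τ * z1 0 ^2 - 2 * τ * (z 0 - z0) * z2) *
      ((x 0 - δ) * (b - x 0) - τ * (z 0 - z0)^2)
    - (x1 0 * (b + δ - 2 * x 0) - 2 * τ * (z 0 - z0) * z1 0)^2) 
      / ((x 0 - δ) * (b - x 0) - τ * (z 0 - z0)^2)^2
    + 2 * k * y1 0 ^ 2 + 2 * k * (y 0 - m) * y2 - l2 ≤ 0 := by
  have hηd : ∀ t, HasDerivAt x (x1 t) t → HasDerivAt z (z1 t) t → 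
     HasDerivAt (fun t => (x t - δ) * (b - x t) - τ * (z t - z0)^2) 
      (x1 t * (b + δ - 2 * x t) - 2 * τ * (z t - z0) * z1 t) t := by
    intro t hx hz
    have := ((hx.sub_const δ).mul (hx.const_sub b)).sub (((hz.sub_const z0).pow 2).const_mul τ)
    refine this.congr_deriv ?_
    simp
    ring
  have hη0 := hηd 0 hx.self_of_nhds hz.self_of_nhds
  have hpos : ∀ᶠ t in 𝓝 (0:ℝ), 0 < (x t - δ) * (b - x t) - τ * (z t - z0)^2 :=
    hη0.continuousAt.eventually (lt_mem_nhds hη)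
  refine second_deriv_le (f' := fun t => (x1 t * (b + δ - 2 * x t) - 2 * τ * (z t - z0) * z1 t) / 
    ((x t - δ) * (b - x t) - τ * (z t - z0)^2) + 2 * k * (y t - m) * y1 t - l1 t) ?_ ?_ hm
  · filter_upwards [hx, hy, hz, hl, hpos] with t hx hy hz hl hp
    refine ((((hηd t hx hz).log hp.ne').add (((hy.sub_const m).pow 2).const_mul k)).sub hl).congr_deriv ?_
    simp
    ring
  · have hx' := hx.self_of_nhds
    have hy' := hy.self_of_nhds
    have hz' := hz.self_of_nhds
    have hn : HasDerivAt (fun t => x1 t * (b + δ - 2 * x t) - 2 * τ * (z t - z0) * z1 t) 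
       (x2 * (b + δ - 2 * x 0) - 2 * x1 0 ^ 2 - 2 * τ * z1 0 ^2 - 2 * τ * (z 0 - z0) * z2) 0 := by
      refine ((hx2.mul ((hx'.const_mul 2).const_sub (b + δ))).sub 
        (((hz'.sub_const z0).const_mul (2 * τ)).mul hz2)).congr_deriv ?_
      ring
    refine (((hn.div hη0 hη.ne').add (((hy'.sub_const m).const_mul (2 * k)).mul hy2)).sub hl2).congr_deriv ?_
    ring

theorem plane_max {X Y Z Λ : ℂ → ℝ} {cx cy cz cl : ℂ → ℂ} {cx' cy' cz' cl' w : ℂ} {δ b τ z0 k m : ℝ}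
   (hx : HarmAt X cx cx' w) (hy : HarmAt Y cy cy' w) (hz : HarmAt Z cz cz' w) (hl : HarmAt Λ cl cl' w)
   (hη : 0 < (X w - δ) * (b - X w) - τ * (Z w - z0)^2)
   (hm : IsLocalMax (fun t => Real.log ((X t - δ) * (b - X t) - τ * (Z t - z0)^2) + k * (Y t - m)^2 - Λ t) w) :
   2 * k * ‖cy w‖^2 * ((X w - δ) * (b - X w) - τ * (Z w - z0)^2)^2 ≤ 
    (2 * ‖cx w‖^2 + 2 * τ * ‖cz w‖^2) * ((X w - δ) * (b - X w) - τ * (Z w - z0)^2)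
     + ‖(b + δ - 2 * X w : ℝ) * cx w - (2 * τ * (Z w - z0) : ℝ) * cz w‖^2 := by
  have key : ∀ e : ℂ, _ := fun e => by
    have hm' : IsLocalMax (fun t : ℝ => Real.log ((X (w + t * e) - δ) * (b - X (w + t * e)) - τ * (Z (w + t * e) - z0)^2) + k * (Y (w + t * e) - m)^2 - Λ (w + t * e)) 0 := by
      have hc : ContinuousAt (fun t : ℝ => w + t * e) 0 := by fun_prop
      have ht : Tendsto (fun t : ℝ => w + t * e) (𝓝 0) (𝓝 w) := by
        have := hc.tendsto
        simpa using this
      have := ht.eventually hm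
      simpa [IsLocalMax, IsMaxFilter] using this
    exact line_max (x := fun t : ℝ => X (w + t * e)) (z := fun t : ℝ => Z (w + t * e))
      (y := fun t : ℝ => Y (w + t * e)) (l := fun t : ℝ => Λ (w + t * e))
      (hx.line e).1 (hx.line e).2 (hy.line e).1 (hy.line e).2 (hz.line e).1 (hz.line e).2 
      (hl.line e).1 (hl.line e).2 (by simpa using hη) hm'
  have k1 := key 1
  have k2 := key Complex.I
  simp only [Complex.ofReal_zero, zero_mul, add_zero] at k1 k2
  set η := (X w - δ) * (b - X w) - τ * (Z w - z0)^2 with hηd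
  simp only [Complex.sq_norm, Complex.normSq_apply]
  simp at k1 k2 ⊢
  have h3 := add_le_add k1 k2
  have h4 := mul_le_mul_of_nonneg_right h3 (sq_nonneg η)
  have hη' := hη.ne'
  field_simp at h4
  nlinarith [h4]

theorem chart {S : Set (ℝ × ℝ)} (hS : IsOpen S) {w : ℝ × ℝ → ℂ} {α β : ℝ × ℝ → ℝ} {Q : ℝ × ℝ}
    (hw : ∀ z ∈ S, HasFDerivAt w (om (α z) (β z)) z) (hα : ∀ z ∈ S, α z ≠ 0)
    (hQ : Q ∈ S) (hc : ContinuousAt (fun z => om (α z) (β z)) Q) :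
    ∃ ψ : ℂ → ℝ × ℝ, ψ (w Q) = Q ∧ Tendsto ψ (𝓝 (w Q)) (𝓝 Q) ∧
      ∀ᶠ ζ in 𝓝 (w Q), ψ ζ ∈ S ∧ ∃ e : (ℝ × ℝ) ≃L[ℝ] ℂ,
        (e : ℝ × ℝ →L[ℝ] ℂ) = om (α (ψ ζ)) (β (ψ ζ)) ∧
        HasFDerivAt ψ (e.symm : ℂ →L[ℝ] ℝ × ℝ) ζ := by
  have hst : HasStrictFDerivAt w (om (α Q) (β Q)) Q :=
    hasStrictFDerivAt_of_hasFDerivAt_of_continuousAt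
      (by filter_upwards [hS.mem_nhds hQ] with z hz using hw z hz) hc
  obtain ⟨e, he⟩ := om_equiv (α Q) (β Q) (hα Q hQ)
  rw [← he] at hst
  set Φ := hst.toOpenPartialHomeomorph w with hΦ
  have hQs : Q ∈ Φ.source := hst.mem_toOpenPartialHomeomorph_source
  have hcoe : ∀ z, Φ z = w z := fun z => rfl
  have hQt : w Q ∈ Φ.target := by rw [← hcoe]; exact Φ.map_source hQs
  have hinv : Φ.symm (w Q) = Q := by rw [← hcoe]; exact Φ.left_inv hQs
  have ht : Tendsto Φ.symm (𝓝 (w Q)) (𝓝 Q) := by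
    have := (Φ.continuousAt_symm hQt).tendsto
    rwa [hinv] at this
  refine ⟨Φ.symm, hinv, ht, ?_⟩
  filter_upwards [Φ.open_target.mem_nhds hQt, ht.eventually (hS.mem_nhds hQ)] with ζ h1 h2
  refine ⟨h2, ?_⟩
  obtain ⟨e', he'⟩ := om_equiv _ (β (Φ.symm ζ)) (hα _ h2)
  refine ⟨e', he', Φ.hasFDerivAt_symm h1 ?_⟩
  rw [he']
  exact hw _ h2

theorem holo_comp {f : ℝ × ℝ → ℂ} {ψ : ℂ → ℝ × ℝ} {e : (ℝ × ℝ) ≃L[ℝ] ℂ} {lam ζ : ℂ} {α β : ℝ}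
    (he : (e : ℝ × ℝ →L[ℝ] ℂ) = om α β) (hf : HasFDerivAt f (lam • om α β) (ψ ζ))
    (hψ : HasFDerivAt ψ (e.symm : ℂ →L[ℝ] ℝ × ℝ) ζ) :
    HasDerivAt (fun ζ => f (ψ ζ)) lam ζ := by
  have h1 := hf.comp ζ hψ
  rw [hasDerivAt_iff_hasFDerivAt]
  refine hasFDerivAt_of_restrictScalars ℝ h1 ?_
  rw [← he]
  ext <;> simp [mul_comm]

theorem real_comp {f : ℝ × ℝ → ℝ} {ψ : ℂ → ℝ × ℝ} {e : (ℝ × ℝ) ≃L[ℝ] ℂ} {lam ζ : ℂ} {α β : ℝ}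
    (he : (e : ℝ × ℝ →L[ℝ] ℂ) = om α β)
    (hf : HasFDerivAt f (Complex.reCLM.comp (lam • om α β)) (ψ ζ))
    (hψ : HasFDerivAt ψ (e.symm : ℂ →L[ℝ] ℝ × ℝ) ζ) :
    HasFDerivAt (fun ζ => f (ψ ζ)) (Complex.reCLM.comp (lam • (1 : ℂ →L[ℝ] ℂ))) ζ := by
  refine (hf.comp ζ hψ).congr_fderiv ?_
  rw [← he]
  ext <;> simp

theorem harm_log {G : ℂ → ℂ} {w : ℂ} (hG : ∀ᶠ ζ in 𝓝 w, DifferentiableAt ℂ G ζ)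
    (hs : ∀ᶠ ζ in 𝓝 w, G ζ ∈ Complex.slitPlane) :
    ∃ κ κ', HarmAt (fun ζ => Real.log ‖G ζ‖) κ κ' w := by
  have han : AnalyticAt ℂ G w := Complex.analyticAt_iff_eventually_differentiableAt.mpr hG
  have h0 : G w ≠ 0 := Complex.slitPlane_ne_zero hs.self_of_nhds
  have hd : DifferentiableAt ℂ (fun ζ => deriv G ζ / G ζ) w :=
    han.deriv.differentiableAt.div han.differentiableAt h0
  refine ⟨fun ζ => deriv G ζ / G ζ, _, ?_, hd.hasDerivAt⟩
  filter_upwards [hG, hs] with ζ h1 h2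
  have h3 : HasDerivAt (fun ζ => Complex.log (G ζ)) (deriv G ζ / G ζ) ζ := h1.hasDerivAt.clog h2
  have h4 := Complex.reCLM.hasFDerivAt.comp ζ (h3.hasFDerivAt.restrictScalars ℝ)
  refine (h4.congr_of_eventuallyEq (Filter.Eventually.of_forall fun z => ?_)).congr_fderiv ?_
  · simp [Complex.log_re]
  · ext <;> simp [mul_comm]

theorem fd_of_diff {f : ℝ × ℝ → ℝ} {z : ℝ × ℝ} (h : DifferentiableAt ℝ f z) :
    pd1 f z = fderiv ℝ f z (1, 0) ∧ pd2 f z = fderiv ℝ f z (0, 1) := by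
  have h0 : HasFDerivAt f (fderiv ℝ f z) (z.1, z.2) := h.hasFDerivAt
  constructor
  · exact (h0.comp_hasDerivAt z.1 ((hasDerivAt_id z.1).prodMk (hasDerivAt_const z.1 z.2))).deriv
  · exact (h0.comp_hasDerivAt z.2 ((hasDerivAt_const z.2 z.1).prodMk (hasDerivAt_id z.2))).deriv

theorem hasFD_dl {f : ℝ × ℝ → ℝ} {z : ℝ × ℝ} (h : DifferentiableAt ℝ f z) :
    HasFDerivAt f (dl (pd1 f z) (pd2 f z)) z := by
  refine h.hasFDerivAt.congr_fderiv ?_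
  obtain ⟨h1, h2⟩ := fd_of_diff h
  rw [h1, h2]
  ext <;> simp [dl]

theorem partials {S : Set (ℝ × ℝ)} (hS : IsOpen S) {u : ℝ × ℝ → ℝ} (hu : ContDiffOn ℝ 2 u S) :
    ContDiffOn ℝ 1 (pd1 u) S ∧ ContDiffOn ℝ 1 (pd2 u) S ∧
    ∀ z ∈ S, HasFDerivAt u (dl (pd1 u z) (pd2 u z)) z ∧
      HasFDerivAt (pd1 u) (dl (pd1 (pd1 u) z) (pd2 (pd1 u) z)) z ∧
      HasFDerivAt (pd2 u) (dl (pd2 (pd1 u) z) (pd2 (pd2 u) z)) z := by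
  have hd : ∀ z ∈ S, DifferentiableAt ℝ u z := fun z hz =>
    (hu.differentiableOn (by norm_num)).differentiableAt (hS.mem_nhds hz)
  have hf : ContDiffOn ℝ 1 (fderiv ℝ u) S := hu.fderiv_of_isOpen hS (by norm_num)
  have e1 : ∀ z ∈ S, pd1 u z = fderiv ℝ u z (1, 0) := fun z hz => (fd_of_diff (hd z hz)).1
  have e2 : ∀ z ∈ S, pd2 u z = fderiv ℝ u z (0, 1) := fun z hz => (fd_of_diff (hd z hz)).2
  have h1 : ContDiffOn ℝ 1 (pd1 u) S := (hf.clm_apply contDiffOn_const).congr e1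
  have h2 : ContDiffOn ℝ 1 (pd2 u) S := (hf.clm_apply contDiffOn_const).congr e2
  refine ⟨h1, h2, fun z hz => ?_⟩
  have hn := hS.mem_nhds hz
  have d1 := (h1.differentiableOn (by norm_num)).differentiableAt hn
  have d2 := (h2.differentiableOn (by norm_num)).differentiableAt hn
  have df := (hf.differentiableOn (by norm_num)).differentiableAt hn
  refine ⟨hasFD_dl (hd z hz), hasFD_dl d1, ?_⟩
  have hsym : pd2 (pd1 u) z = pd1 (pd2 u) z := by
    rw [(fd_of_diff d1).2, (fd_of_diff d2).1]
    have E1 : pd1 u =ᶠ[𝓝 z] fun z => fderiv ℝ u z (1, 0) := by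
      filter_upwards [hn] with y hy using e1 y hy
    have E2 : pd2 u =ᶠ[𝓝 z] fun z => fderiv ℝ u z (0, 1) := by
      filter_upwards [hn] with y hy using e2 y hy
    rw [E1.fderiv_eq, E2.fderiv_eq]
    have := (hu.contDiffAt hn).isSymmSndFDerivAt (by simp)
    rw [fderiv_clm_apply df (by fun_prop), fderiv_clm_apply df (by fun_prop)]
    simpa using this (0, 1) (1, 0)
  rw [hsym]
  exact hasFD_dl d2

noncomputable def al (u : ℝ × ℝ → ℝ) (z : ℝ × ℝ) : ℝ := (1 + pd1 u z ^ 2) / Wg u z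
noncomputable def be (u : ℝ × ℝ → ℝ) (z : ℝ × ℝ) : ℝ := pd1 u z * pd2 u z / Wg u z
noncomputable def cc (u : ℝ × ℝ → ℝ) (z : ℝ × ℝ) : ℂ :=
  ⟨Wg u z / (1 + pd1 u z ^ 2), pd1 u z * pd2 u z / (1 + pd1 u z ^ 2)⟩
noncomputable def dd (u : ℝ × ℝ → ℝ) (z : ℝ × ℝ) : ℂ :=
  ⟨pd1 u z * Wg u z / (1 + pd1 u z ^ 2), - pd2 u z / (1 + pd1 u z ^ 2)⟩

theorem Wg_pos (u : ℝ × ℝ → ℝ) (z : ℝ × ℝ) : 0 < Wg u z := by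
  unfold Wg; positivity

theorem Wg_sq (u : ℝ × ℝ → ℝ) (z : ℝ × ℝ) : Wg u z ^ 2 = 1 + pd1 u z ^ 2 + pd2 u z ^ 2 := by
  unfold Wg; exact Real.sq_sqrt (by positivity)

theorem al_ne (u : ℝ × ℝ → ℝ) (z : ℝ × ℝ) : al u z ≠ 0 := by
  have := Wg_pos u z
  unfold al; positivity

theorem W_deriv {u : ℝ × ℝ → ℝ} {z : ℝ × ℝ} {r s t : ℝ} (hp : HasFDerivAt (pd1 u) (dl r s) z)
    (hq : HasFDerivAt (pd2 u) (dl s t) z) :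
    HasFDerivAt (Wg u) (dl ((pd1 u z * r + pd2 u z * s) / Wg u z)
      ((pd1 u z * s + pd2 u z * t) / Wg u z)) z := dl_W hp hq

theorem exists_w {S : Set (ℝ × ℝ)} (hS : IsOpen S) (hconv : Convex ℝ S) {u : ℝ × ℝ → ℝ}
    (hu : IsMSE u S) :
    (∀ z ∈ S, ContinuousAt (fun z => om (al u z) (be u z)) z) ∧
    ∃ w : ℝ × ℝ → ℂ, ∀ z ∈ S, HasFDerivAt w (om (al u z) (be u z)) z := by
  obtain ⟨-, -, hP⟩ := partials hS hu.1
  have key : ∀ z ∈ S, ∃ a b c : ℝ, HasFDerivAt (al u) (dl a b) z ∧ HasFDerivAt (be u) (dl b c) z := by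
    intro z hz
    obtain ⟨-, hp, hq⟩ := hP z hz
    have hW := W_deriv hp hq
    have h0 := (Wg_pos u z)
    have ha := dl_div (dl_A hp) hW h0.ne'
    have hb := dl_div (dl_mul hp hq) hW h0.ne'
    have hc := alg_closed _ _ _ _ _ _ (Wg_sq u z) h0 (hu.2 z hz)
    rw [← hc] at hb
    exact ⟨_, _, _, ha, hb⟩
  have key2 : ∀ z ∈ S, ∃ a b c : ℝ, HasFDerivAt (fun z => om (al u z) (be u z))
     ((dl a b).smulRight (Complex.ofRealCLM.comp (ContinuousLinearMap.fst ℝ ℝ ℝ))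
      + (dl b c).smulRight (Complex.ofRealCLM.comp (ContinuousLinearMap.snd ℝ ℝ ℝ))) z := by
    intro z hz
    obtain ⟨a, b, c, h1, h2⟩ := key z hz
    exact ⟨a, b, c, ((h1.smul_const _).add (h2.smul_const _)).add_const _⟩
  refine ⟨fun z hz => ?_, ?_⟩
  · obtain ⟨a, b, c, h⟩ := key2 z hz
    exact h.continuousAt
  · refine hconv.exists_forall_hasFDerivAt_of_fderiv_symmetric hS
      (ω := fun z => om (al u z) (be u z)) ?_ ?_
    · intro z hz
      obtain ⟨a, b, c, h⟩ := key2 z hz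
      exact h.differentiableAt.differentiableWithinAt
    · intro z hz x y
      obtain ⟨a, b, c, h⟩ := key2 z hz
      rw [h.fderiv]
      apply Complex.ext <;> simp [dl_apply]
      ring

theorem cd_deriv {S : Set (ℝ × ℝ)} (hS : IsOpen S) {u : ℝ × ℝ → ℝ} (hu : IsMSE u S)
    {z : ℝ × ℝ} (hz : z ∈ S) :
    (∃ l : ℂ, HasFDerivAt (cc u) (l • om (al u z) (be u z)) z) ∧
    (∃ l : ℂ, HasFDerivAt (dd u) (l • om (al u z) (be u z)) z) := by
  obtain ⟨-, -, hP⟩ := partials hS hu.1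
  obtain ⟨-, hp, hq⟩ := hP z hz
  have hW := W_deriv hp hq
  have h0 := (Wg_pos u z)
  have hA : 1 + pd1 u z ^ 2 ≠ 0 := by positivity
  constructor
  · refine ⟨_, cplx_fderiv (al_ne u z) (dl_div hW (dl_A hp) hA) (dl_div (dl_mul hp hq) (dl_A hp) hA) ?_ ?_⟩
    · exact alg_c1 _ _ _ _ _ _ (Wg_sq u z) h0 (hu.2 z hz)
    · exact alg_c2 _ _ _ _ _ _ (Wg_sq u z) h0 (hu.2 z hz)
  · refine ⟨_, cplx_fderiv (al_ne u z) (dl_div (dl_mul hp hW) (dl_A hp) hA) (dl_div (dl_neg hq) (dl_A hp) hA) ?_ ?_⟩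
    · exact alg_d1 _ _ _ _ _ _ (Wg_sq u z) h0 (hu.2 z hz)
    · exact alg_d2 _ _ _ _ _ _ (Wg_sq u z) h0 (hu.2 z hz)

theorem x_deriv (u : ℝ × ℝ → ℝ) (z : ℝ × ℝ) :
    HasFDerivAt (fun z : ℝ × ℝ => z.1) (Complex.reCLM.comp (cc u z • om (al u z) (be u z))) z := by
  refine (ContinuousLinearMap.fst ℝ ℝ ℝ).hasFDerivAt.congr_fderiv ?_
  have h0 := (Wg_pos u z).ne'
  have hA : 1 + pd1 u z ^ 2 ≠ 0 := by positivity
  ext <;> simp [om_apply, cc, al, be] <;> field_simp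
  ring

theorem y_deriv (u : ℝ × ℝ → ℝ) (z : ℝ × ℝ) :
    HasFDerivAt (fun z : ℝ × ℝ => z.2)
      (Complex.reCLM.comp ((-Complex.I) • om (al u z) (be u z))) z := by
  refine (ContinuousLinearMap.snd ℝ ℝ ℝ).hasFDerivAt.congr_fderiv ?_
  ext <;> simp [om_apply]

theorem u_deriv {u : ℝ × ℝ → ℝ} {z : ℝ × ℝ} (h : HasFDerivAt u (dl (pd1 u z) (pd2 u z)) z) :
    HasFDerivAt u (Complex.reCLM.comp (dd u z • om (al u z) (be u z))) z := by
  refine h.congr_fderiv ?_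
  have h0 := (Wg_pos u z).ne'
  have hA : 1 + pd1 u z ^ 2 ≠ 0 := by positivity
  ext <;> simp [om_apply, dd, al, be, dl_apply] <;> field_simp
  ring

theorem norm_G (u : ℝ × ℝ → ℝ) (z : ℝ × ℝ) :
    ‖1 + cc u z‖ ^ 2 = (1 + Wg u z) ^ 2 / (1 + pd1 u z ^ 2) := by
  have hA : 1 + pd1 u z ^ 2 ≠ 0 := by positivity
  have hW := Wg_sq u z
  rw [Complex.sq_norm, Complex.normSq_apply]
  simp [cc]
  field_simp
  linear_combination (- pd1 u z ^ 2) * hW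

theorem norm_c (u : ℝ × ℝ → ℝ) (z : ℝ × ℝ) : ‖cc u z‖ ≤ ‖1 + cc u z‖ := by
  have h0 := (Wg_pos u z)
  have h1 : 0 ≤ (cc u z).re := by simp only [cc]; positivity
  refine le_of_sq_le_sq ?_ (norm_nonneg _)
  rw [Complex.sq_norm, Complex.normSq_apply, Complex.sq_norm, Complex.normSq_apply]
  simp
  nlinarith

theorem norm_d (u : ℝ × ℝ → ℝ) (z : ℝ × ℝ) : ‖dd u z‖ ≤ ‖1 + cc u z‖ := by
  have h0 := (Wg_pos u z)
  have hA : 1 + pd1 u z ^ 2 ≠ 0 := by positivity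
  have hW := Wg_sq u z
  refine le_of_sq_le_sq ?_ (norm_nonneg _)
  rw [norm_G]
  have : ‖dd u z‖ ^ 2 = (Wg u z ^ 2 - 1) / (1 + pd1 u z ^ 2) := by
    rw [Complex.sq_norm, Complex.normSq_apply]
    simp [dd]
    field_simp
    linear_combination (-1) * hW
  rw [this]
  gcongr
  nlinarith

theorem local_max_bound {S : Set (ℝ × ℝ)} (hS : IsOpen S) (hconv : Convex ℝ S) {u : ℝ × ℝ → ℝ}
    (hu : IsMSE u S) {Q : ℝ × ℝ} (hQ : Q ∈ S) {δ b τ z0 k m : ℝ} (hτ : 0 ≤ τ)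
    (hη : 0 < (Q.1 - δ) * (b - Q.1) - τ * (u Q - z0) ^ 2)
    (hm : IsLocalMax (fun z : ℝ × ℝ => Real.log ((z.1 - δ) * (b - z.1) - τ * (u z - z0) ^ 2)
      + k * (z.2 - m) ^ 2 - Real.log ‖1 + cc u z‖) Q) :
    2 * k * ((Q.1 - δ) * (b - Q.1) - τ * (u Q - z0) ^ 2) ^ 2 ≤
      (1 + τ) * (b - δ) ^ 2 * ‖1 + cc u Q‖ ^ 2 := by
  obtain ⟨hcont, w, hw⟩ := exists_w hS hconv hu
  obtain ⟨-, -, hP⟩ := partials hS hu.1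
  obtain ⟨ψ, hψQ, hψt, hψ⟩ := chart hS hw (fun z _ => al_ne u z) hQ (hcont Q hQ)
  have hcd : ∀ᶠ ζ in 𝓝 (w Q), DifferentiableAt ℂ (fun ζ => cc u (ψ ζ)) ζ := by
    filter_upwards [hψ] with ζ ⟨h1, e, he, h2⟩
    obtain ⟨l, hl⟩ := (cd_deriv hS hu h1).1
    exact (holo_comp he hl h2).differentiableAt
  have hdd : ∀ᶠ ζ in 𝓝 (w Q), DifferentiableAt ℂ (fun ζ => dd u (ψ ζ)) ζ := by
    filter_upwards [hψ] with ζ ⟨h1, e, he, h2⟩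
    obtain ⟨l, hl⟩ := (cd_deriv hS hu h1).2
    exact (holo_comp he hl h2).differentiableAt
  have HX : HarmAt (fun ζ => (ψ ζ).1) (fun ζ => cc u (ψ ζ)) (deriv (fun ζ => cc u (ψ ζ)) (w Q)) (w Q) := by
    refine ⟨?_, hcd.self_of_nhds.hasDerivAt⟩
    filter_upwards [hψ] with ζ ⟨h1, e, he, h2⟩
    exact real_comp he (x_deriv u _) h2
  have HZ : HarmAt (fun ζ => u (ψ ζ)) (fun ζ => dd u (ψ ζ)) (deriv (fun ζ => dd u (ψ ζ)) (w Q)) (w Q) := by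
    refine ⟨?_, hdd.self_of_nhds.hasDerivAt⟩
    filter_upwards [hψ] with ζ ⟨h1, e, he, h2⟩
    exact real_comp he (u_deriv (hP _ h1).1) h2
  have HY : HarmAt (fun ζ => (ψ ζ).2) (fun _ => -Complex.I) 0 (w Q) := by
    refine ⟨?_, hasDerivAt_const _ _⟩
    filter_upwards [hψ] with ζ ⟨h1, e, he, h2⟩
    exact real_comp he (y_deriv u _) h2
  obtain ⟨κ, κ', HL⟩ := harm_log (G := fun ζ => 1 + cc u (ψ ζ)) (w := w Q)
    (by filter_upwards [hcd] with ζ h using h.const_add 1)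
    (Filter.Eventually.of_forall fun ζ => by
      left
      have := Wg_pos u (ψ ζ)
      simp only [cc, Complex.add_re, Complex.one_re]
      positivity)
  have hm' := hψt.eventually hm
  have hmain := plane_max (δ := δ) (b := b) (τ := τ) (z0 := z0) (k := k) (m := m) HX HY HZ HL
    (by simpa only [hψQ] using hη) (by
      filter_upwards [hm'] with ζ h
      simpa only [hψQ] using h)
  simp only [hψQ] at hmain
  set η := (Q.1 - δ) * (b - Q.1) - τ * (u Q - z0) ^ 2 with hηd
  set g := ‖1 + cc u Q‖ with hg
  have h1 : ‖cc u Q‖ ≤ g := norm_c u Q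
  have h2 : ‖dd u Q‖ ≤ g := norm_d u Q
  have g0 : 0 ≤ g := norm_nonneg _
  have h3 : ‖((b + δ - 2 * Q.1 : ℝ) : ℂ) * cc u Q - ((2 * τ * (u Q - z0) : ℝ) : ℂ) * dd u Q‖ ≤
      (|b + δ - 2 * Q.1| + 2 * τ * |u Q - z0|) * g := by
    refine (norm_sub_le _ _).trans ?_
    rw [norm_mul, norm_mul, Complex.norm_real, Complex.norm_real, Real.norm_eq_abs, Real.norm_eq_abs,
      abs_mul, abs_of_nonneg (show 0 ≤ 2 * τ by positivity), add_mul]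
    gcongr
  have h4 := pow_le_pow_left₀ (norm_nonneg _) h3 2
  have h5 : ‖cc u Q‖ ^ 2 ≤ g ^ 2 := by gcongr
  have h6 : ‖dd u Q‖ ^ 2 ≤ g ^ 2 := by gcongr
  simp only [norm_neg, Complex.norm_I, one_pow, mul_one] at hmain
  set M := |b + δ - 2 * Q.1| with hM
  set N := |u Q - z0| with hN
  have hM2 : M ^ 2 = (b + δ - 2 * Q.1) ^ 2 := sq_abs _
  have hN2 : N ^ 2 = (u Q - z0) ^ 2 := sq_abs _
  have h7 : (M + 2 * τ * N) ^ 2 ≤ (1 + τ) * (M ^ 2 + 4 * τ * N ^ 2) := by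
    nlinarith [mul_nonneg hτ (sq_nonneg (M - 2 * N))]
  have h8 : (2 + 2 * τ) * η + (M + 2 * τ * N) ^ 2 ≤ (1 + τ) * (b - δ) ^ 2 := by
    have : M ^ 2 + 4 * τ * N ^ 2 = (b - δ) ^ 2 - 4 * η := by
      rw [hM2, hN2, hηd]; ring
    rw [this] at h7
    nlinarith [mul_nonneg hτ hη.le]
  calc 2 * k * η ^ 2 ≤ _ := hmain
    _ ≤ (2 * g ^ 2 + 2 * τ * g ^ 2) * η + ((M + 2 * τ * N) * g) ^ 2 := by gcongr
    _ = ((2 + 2 * τ) * η + (M + 2 * τ * N) ^ 2) * g ^ 2 := by ring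
    _ ≤ _ := by gcongr

theorem final_alg {a x p q W : ℝ} (ha : 0 < a) (hx : 4 * a ≤ x) (hW0 : 0 < W)
    (hW : W ^ 2 = 1 + p ^ 2 + q ^ 2)
    (h : 1.39 * x ^ 2 * (1 + p ^ 2) ≤ a ^ 2 * (1 + W) ^ 2) :
    1 - a ^ 2 / x ^ 2 ≤ |q| / W ∧ |p| / W ≤ √2 * a / x := by
  have hx0 : 0 < x := by linarith
  obtain ⟨A, hA⟩ : ∃ A, A = 1 + p ^ 2 := ⟨_, rfl⟩
  have hA1 : 1 ≤ A := by nlinarith [sq_nonneg p]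
  obtain ⟨R, hR⟩ : ∃ R, R = √A := ⟨_, rfl⟩
  have hR2 : R ^ 2 = A := by rw [hR]; exact Real.sq_sqrt (by linarith)
  have hR1 : 1 ≤ R := by rw [hR]; exact Real.one_le_sqrt.mpr hA1
  have hB : 0.92 * (x * R) ≤ a * W := by
    by_contra hlt
    push Not at hlt
    have h1 : a ≤ x * R / 4 := by nlinarith
    have h2 : a * (1 + W) ≤ 1.17 * (x * R) := by nlinarith
    have h3 : (a * (1 + W)) ^ 2 ≤ (1.17 * (x * R)) ^ 2 := by
      apply pow_le_pow_left₀ (by positivity) h2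
    have h4 : 0 < (x * R) ^ 2 := by positivity
    rw [← hA, ← hR2] at h
    nlinarith
  have hAW : x ^ 2 * A ≤ 1.19 * (a ^ 2 * W ^ 2) := by
    have h3 : (0.92 * (x * R)) ^ 2 ≤ (a * W) ^ 2 := pow_le_pow_left₀ (by positivity) hB 2
    rw [← hR2]
    nlinarith [sq_nonneg (x * R)]
  have hq : q ^ 2 = W ^ 2 - A := by rw [hW, hA]; ring
  constructor
  · rw [le_div_iff₀ hW0]
    obtain ⟨ε, hε⟩ : ∃ ε, ε = a ^ 2 / x ^ 2 := ⟨_, rfl⟩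
    have hε0 : 0 ≤ ε := by rw [hε]; positivity
    have hε1 : ε ≤ 1 / 16 := by
      rw [hε, div_le_iff₀ (by positivity)]; nlinarith
    have hAe : A ≤ 1.19 * ε * W ^ 2 := by
      rw [hε]
      have : 1.19 * (a ^ 2 / x ^ 2) * W ^ 2 = 1.19 * (a ^ 2 * W ^ 2) / x ^ 2 := by ring
      rw [this, le_div_iff₀ (by positivity)]
      linarith
    rw [← hε]
    refine le_of_sq_le_sq ?_ (abs_nonneg _)
    rw [sq_abs, hq]
    have : 0 ≤ W ^ 2 * ε * (1 / 16 - ε) := by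
      apply mul_nonneg (by positivity); linarith
    nlinarith [mul_nonneg (sq_nonneg W) hε0]
  · rw [div_le_div_iff₀ hW0 hx0]
    refine le_of_sq_le_sq ?_ (by positivity)
    have h2 : (√2) ^ 2 = 2 := Real.sq_sqrt (by norm_num)
    have : (√2 * a * W) ^ 2 = 2 * (a ^ 2 * W ^ 2) := by rw [mul_pow, mul_pow, h2]; ring
    rw [this, mul_pow, sq_abs]
    have : p ^ 2 * x ^ 2 ≤ x ^ 2 * A := by rw [hA]; nlinarith [sq_nonneg x]
    nlinarith [mul_pos (sq_pos_of_pos ha) (sq_pos_of_pos hW0)]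

theorem compactK {a : ℝ} (ha : 0 < a)
    {S : Set (ℝ × ℝ)} (hS : S = Ioi (0:ℝ) ×ˢ Ioo (0:ℝ) a)
    {u : ℝ × ℝ → ℝ} (huc : ContinuousOn u S)
    (hplus : ∀ x > (0:ℝ), Tendsto u (𝓝[S] (x, 0)) atTop)
    (hminus : ∀ x > (0:ℝ), Tendsto u (𝓝[S] (x, a)) atBot) {δ b τ z0 : ℝ} (hδ : 0 < δ) (hb : δ < b)
    (hτ : 0 < τ) :
    IsCompact {z : ℝ × ℝ | z ∈ S ∧ 0 ≤ (z.1 - δ) * (b - z.1) - τ * (u z - z0) ^ 2} := by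
  set K := {z : ℝ × ℝ | z ∈ S ∧ 0 ≤ (z.1 - δ) * (b - z.1) - τ * (u z - z0) ^ 2} with hK
  have hSo : IsOpen S := by rw [hS]; exact isOpen_Ioi.prod isOpen_Ioo
  have hx : ∀ z ∈ K, δ ≤ z.1 ∧ z.1 ≤ b := by
    rintro z ⟨-, h2⟩
    have h3 : 0 ≤ (z.1 - δ) * (b - z.1) := by nlinarith [mul_nonneg hτ.le (sq_nonneg (u z - z0))]
    constructor
    · by_contra h; push Not at h; nlinarith
    · by_contra h; push Not at h; nlinarith
  have hsub : K ⊆ Icc (δ, 0) (b, a) := by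
    intro z hz
    have h1 := hx z hz
    have h2 := hz.1
    rw [hS] at h2
    exact ⟨⟨h1.1, h2.2.1.le⟩, ⟨h1.2, h2.2.2.le⟩⟩
  obtain ⟨C, hC⟩ : ∃ C : ℝ, ∀ z ∈ K, |u z - z0| ≤ C := by
    refine ⟨√((b - δ) ^ 2 / τ), fun z hz => ?_⟩
    apply Real.abs_le_sqrt
    rw [le_div_iff₀ hτ]
    have h1 := hx z hz
    have h2 := hz.2
    nlinarith [mul_nonneg (sub_nonneg.2 h1.1) (sub_nonneg.2 h1.1), mul_nonneg (sub_nonneg.2 h1.1) (sub_nonneg.2 h1.2), mul_nonneg (sub_nonneg.2 h1.2) (sub_nonneg.2 h1.2)]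
  have hKS : K ⊆ S := fun z hz => hz.1
  refine isCompact_Icc.of_isClosed_subset (isClosed_of_closure_subset ?_) hsub
  intro z hz
  have hzI : z ∈ Icc ((δ, 0) : ℝ × ℝ) (b, a) := closure_minimal hsub isClosed_Icc hz
  have hne : (𝓝[K] z).NeBot := mem_closure_iff_nhdsWithin_neBot.mp hz
  have hle : 𝓝[K] z ≤ 𝓝[S] z := nhdsWithin_mono z hKS
  obtain ⟨⟨hz1, hz2⟩, hz3, hz4⟩ := hzI
  simp only at hz1 hz2 hz3 hz4
  have hpos : 0 < z.1 := lt_of_lt_of_le hδ hz1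
  have hself : ∀ᶠ y in 𝓝[K] z, y ∈ K := self_mem_nhdsWithin
  rcases hz2.eq_or_lt with h0 | h0
  · exfalso
    have ht := hplus z.1 hpos
    have e : ((z.1, 0) : ℝ × ℝ) = z := Prod.ext rfl h0
    rw [e] at ht
    obtain ⟨y, hy1, hy2⟩ := (((ht.mono_left hle).eventually (eventually_gt_atTop (z0 + C))).and hself).exists
    have := (abs_le.mp (hC y hy2)).2
    linarith
  rcases hz4.eq_or_lt with h1 | h1
  · exfalso
    have ht := hminus z.1 hpos
    have e : ((z.1, a) : ℝ × ℝ) = z := Prod.ext rfl h1.symm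
    rw [e] at ht
    obtain ⟨y, hy1, hy2⟩ := (((ht.mono_left hle).eventually (eventually_lt_atBot (z0 - C))).and hself).exists
    have := (abs_le.mp (hC y hy2)).1
    linarith
  have hzS : z ∈ S := by rw [hS]; exact ⟨hpos, h0, h1⟩
  refine ⟨hzS, ?_⟩
  have huz : ContinuousAt u z := huc.continuousAt (hSo.mem_nhds hzS)
  have hc : ContinuousAt (fun z : ℝ × ℝ => (z.1 - δ) * (b - z.1) - τ * (u z - z0) ^ 2) z := by
    fun_prop
  refine ge_of_tendsto (hc.tendsto.mono_left (nhdsWithin_le_nhds (s := K))) ?_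
  filter_upwards [hself] with y hy using hy.2

lemma num_tail {a x g k p e : ℝ} (ha : 0 < a) (hx : 0 < x) (k0 : 0 < k)
    (hp : p = 98.01 * x ^ 2) (h3 : p ^ 2 * k ^ 2 ≤ e ^ 2 * g ^ 2 * Real.exp 1)
    (hb : 2 * (2 / a ^ 2) * e ^ 2 ≤ (1 + 1 / 100) * (100 * x - x / 100) ^ 2 * k ^ 2) :
    1.39 * x ^ 2 ≤ a ^ 2 * g ^ 2 := by
  have he1 := Real.exp_one_lt_d9
  have e0 := Real.exp_pos 1
  generalize Real.exp 1 = E at *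
  have hE : E ≤ 2.7183 := by norm_num at he1 ⊢; linarith
  have e1 : 2 * (2 / a ^ 2) * e ^ 2 = 4 * e ^ 2 / a ^ 2 := by ring
  rw [e1, div_le_iff₀ (by positivity)] at hb
  have hm := mul_le_mul_of_nonneg_right hb (show 0 ≤ g ^ 2 * E by positivity)
  subst hp
  have h4 : (4 * 98.01 ^ 2 * x ^ 2) * (x ^ 2 * k ^ 2) ≤
      (1.01 * 99.99 ^ 2 * (a ^ 2 * g ^ 2) * E) * (x ^ 2 * k ^ 2) := by
    linarith
  have h5 := le_of_mul_le_mul_right h4 (by positivity)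
  have h6 : (a ^ 2 * g ^ 2) * E ≤ (a ^ 2 * g ^ 2) * 2.7183 :=
    mul_le_mul_of_nonneg_left hE (by positivity)
  have h7 : 0 ≤ a ^ 2 * g ^ 2 := by positivity
  generalize a ^ 2 * g ^ 2 = m at *
  generalize x ^ 2 = y at *
  linarith

set_option maxHeartbeats 1000000 in
/-- Gradient estimates in a half-strip (Jenkins–Serrin, Lemma 1): if `u` solves the
minimal surfaces equation on `S = (0,∞) × (0,a)` with boundary values `+∞` on
`(0,∞) × {0}` and `−∞` on `(0,∞) × {a}`, then for `x ≥ 4a`,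
`|q|/W ≥ 1 − a²/x²` and `|p|/W ≤ √2·a/x`. -/
theorem halfstrip_gradient_estimates
    (a : ℝ) (ha : 0 < a)
    (S : Set (ℝ × ℝ)) (hS : S = Ioi (0:ℝ) ×ˢ Ioo (0:ℝ) a)
    (u : ℝ × ℝ → ℝ) (hu : IsMSE u S)
    (hplus : ∀ x > (0:ℝ), Tendsto u (𝓝[S] (x, 0)) atTop)
    (hminus : ∀ x > (0:ℝ), Tendsto u (𝓝[S] (x, a)) atBot) :
    ∀ z ∈ S, 4 * a ≤ z.1 →
      1 - a ^ 2 / z.1 ^ 2 ≤ |pd2 u z| / Wg u z ∧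
      |pd1 u z| / Wg u z ≤ Real.sqrt 2 * a / z.1 := by
  intro P hP hPx
  refine final_alg ha hPx (Wg_pos u P) (Wg_sq u P) ?_
  have hSo : IsOpen S := by rw [hS]; exact isOpen_Ioi.prod isOpen_Ioo
  have hSc : Convex ℝ S := by rw [hS]; exact (convex_Ioi 0).prod (convex_Ioo 0 a)
  have hx0 : 0 < P.1 := by linarith
  have huc : ContinuousOn u S := hu.1.continuousOn
  have hcc : ContinuousOn (cc u) S := fun z hz => by
    obtain ⟨l, hl⟩ := (cd_deriv hSo hu hz).1
    exact hl.continuousAt.continuousWithinAt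
  obtain ⟨η, hη⟩ : ∃ η : ℝ × ℝ → ℝ, ∀ z, η z = (z.1 - P.1 / 100) * (100 * P.1 - z.1) - 1 / 100 * (u z - u P) ^ 2 :=
    ⟨_, fun z => rfl⟩
  have hηc : ContinuousOn η S := by
    have : η = fun z => (z.1 - P.1 / 100) * (100 * P.1 - z.1) - 1 / 100 * (u z - u P) ^ 2 := funext hη
    rw [this]; fun_prop
  have hKc := compactK ha hS huc hplus hminus (δ := P.1 / 100) (b := 100 * P.1) (τ := 1 / 100) (z0 := u P)
    (by positivity) (by linarith) (by norm_num)
  simp only [← hη] at hKc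
  have hg0 : ∀ z, 0 < ‖1 + cc u z‖ := fun z => by
    rw [norm_pos_iff]
    apply Complex.slitPlane_ne_zero
    left
    have := Wg_pos u z
    simp only [cc, Complex.add_re, Complex.one_re]
    positivity
  obtain ⟨F, hF⟩ : ∃ F : ℝ × ℝ → ℝ, ∀ z, F z = η z * Real.exp (2 / a ^ 2 * (z.2 - a / 2) ^ 2) / ‖1 + cc u z‖ :=
    ⟨_, fun z => rfl⟩
  have hFc : ContinuousOn F {z | z ∈ S ∧ 0 ≤ η z} := by
    have : F = fun z => η z * Real.exp (2 / a ^ 2 * (z.2 - a / 2) ^ 2) / ‖1 + cc u z‖ := funext hF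
    rw [this]
    refine ContinuousOn.mono (s := S) ?_ (fun z hz => hz.1)
    refine ContinuousOn.div (hηc.mul (by fun_prop)) (by fun_prop) (fun z _ => (hg0 z).ne')
  have hηP : η P = 98.01 * P.1 ^ 2 := by rw [hη]; ring
  have hηP0 : 0 < η P := by rw [hηP]; positivity
  obtain ⟨Q, ⟨hQS, hQη⟩, hQmax⟩ := hKc.exists_isMaxOn ⟨P, hP, hηP0.le⟩ hFc
  have hPQ : F P ≤ F Q := hQmax ⟨hP, hηP0.le⟩
  have hFP : 0 < F P := by
    rw [hF]; have := hg0 P; positivity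
  have hQη0 : 0 < η Q := by
    rcases hQη.eq_or_lt with h | h
    · exfalso
      rw [hF Q, ← h] at hPQ
      simp at hPQ
      linarith
    · exact h
  have hlog : ∀ z, 0 < η z → Real.log (F z) = Real.log (η z) + 2 / a ^ 2 * (z.2 - a / 2) ^ 2 - Real.log ‖1 + cc u z‖ := by
    intro z hz
    rw [hF, Real.log_div (by positivity) (hg0 z).ne', Real.log_mul hz.ne' (Real.exp_pos _).ne', Real.log_exp]
  have hev : ∀ᶠ z in 𝓝 Q, z ∈ S ∧ 0 < η z :=
    Filter.Eventually.and (show ∀ᶠ z in 𝓝 Q, z ∈ S from hSo.mem_nhds hQS)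
      ((hηc.continuousAt (hSo.mem_nhds hQS)).eventually (lt_mem_nhds hQη0))
  have hloc : IsLocalMax (fun z : ℝ × ℝ => Real.log ((z.1 - P.1 / 100) * (100 * P.1 - z.1) - 1 / 100 * (u z - u P) ^ 2)
      + 2 / a ^ 2 * (z.2 - a / 2) ^ 2 - Real.log ‖1 + cc u z‖) Q := by
    filter_upwards [hev] with z hz
    simp only [← hη]
    rw [← hlog z hz.2, ← hlog Q hQη0]
    apply Real.log_le_log
    · rw [hF]; have := hg0 z; have := hz.2; positivity
    · exact hQmax ⟨hz.1, hz.2.le⟩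
  have hbound := local_max_bound hSo hSc hu hQS (by norm_num) (by rw [← hη]; exact hQη0) hloc
  rw [← hη] at hbound
  have hgP := norm_G u P
  obtain ⟨g, hg⟩ : ∃ g, g = ‖1 + cc u P‖ := ⟨_, rfl⟩
  obtain ⟨g', hg'⟩ : ∃ g', g' = ‖1 + cc u Q‖ := ⟨_, rfl⟩
  have g0 : 0 < g := hg ▸ hg0 P
  have g0' : 0 < g' := hg' ▸ hg0 Q
  rw [hF, hF, ← hg, ← hg'] at hPQ
  rw [← hg] at hgP
  rw [← hg'] at hbound
  have hexp : Real.exp (2 / a ^ 2 * (Q.2 - a / 2) ^ 2) ≤ Real.exp (1 / 2) := by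
    apply Real.exp_le_exp.mpr
    have h2 : 0 < Q.2 ∧ Q.2 < a := by rw [hS] at hQS; exact hQS.2
    rw [div_mul_eq_mul_div, div_le_iff₀ (by positivity)]
    nlinarith [mul_pos h2.1 (sub_pos.2 h2.2)]
  have h1 : η P / g ≤ η Q * Real.exp (1 / 2) / g' := by
    calc η P / g = η P * 1 / g := by rw [mul_one]
      _ ≤ η P * Real.exp (2 / a ^ 2 * (P.2 - a / 2) ^ 2) / g := by
        gcongr
        exact Real.one_le_exp (by positivity)
      _ ≤ _ := hPQ
      _ ≤ _ := by gcongr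
  rw [div_le_div_iff₀ g0 g0'] at h1
  have h2 := pow_le_pow_left₀ (by positivity) h1 2
  have he : Real.exp (1 / 2) ^ 2 = Real.exp 1 := by
    rw [← Real.exp_nat_mul]; norm_num
  have h3 : η P ^ 2 * g' ^ 2 ≤ η Q ^ 2 * g ^ 2 * Real.exp 1 := by
    rw [← he]; rw [mul_pow, mul_pow, mul_pow] at h2; linarith
  have h6 : 1.39 * P.1 ^ 2 ≤ a ^ 2 * g ^ 2 :=
    num_tail ha hx0 g0' hηP h3 hbound
  rw [hgP] at h6
  have hA : 0 < 1 + pd1 u P ^ 2 := by positivity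
  calc 1.39 * P.1 ^ 2 * (1 + pd1 u P ^ 2) ≤
      a ^ 2 * ((1 + Wg u P) ^ 2 / (1 + pd1 u P ^ 2)) * (1 + pd1 u P ^ 2) := by gcongr
    _ = a ^ 2 * (1 + Wg u P) ^ 2 := by field_simp
end

section
/- Let a > 0 and let S = (0,∞) × (0,a) ⊂ ℝ² be an open half-strip. Let u be a C² solution of the minimal surfaces equation on S such that u → +∞ on the boundary side (0,∞) × {0} and u → −∞ on the boundary side (0,∞) × {a}. Then there is a universal constant c > 0 such that for every x₀ > 0 the total Gauss curvature of the graph of u over S′ = {(x,y) ∈ S : x ≥ x₀} is finite and bounded by ca/x₀; explicitly, ∫∫_{S′} |rt − s²| / W³ dx dy ≤ ca/x₀ < ∞, the integrand being the absolute Gauss curvature of the graph times the area element W dx dy. -/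
open Real Filter Set Topology MeasureTheory

namespace HS

lemma line1 (z : ℝ × ℝ) (t : ℝ) : HasDerivAt (fun t : ℝ => ((t, z.2) : ℝ × ℝ)) (1, 0) t :=
  (hasDerivAt_id t).prodMk (hasDerivAt_const t z.2)

lemma line2 (z : ℝ × ℝ) (t : ℝ) : HasDerivAt (fun t : ℝ => ((z.1, t) : ℝ × ℝ)) (0, 1) t :=
  (hasDerivAt_const t z.1).prodMk (hasDerivAt_id t)

lemma pd1_slice {f : ℝ × ℝ → ℝ} {z : ℝ × ℝ} (h : DifferentiableAt ℝ f z) :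
    HasDerivAt (fun t => f (t, z.2)) (fderiv ℝ f z (1, 0)) z.1 :=
  HasFDerivAt.comp_hasDerivAt (f := fun t : ℝ => ((t, z.2) : ℝ × ℝ)) z.1 h.hasFDerivAt (line1 z z.1)

lemma pd2_slice {f : ℝ × ℝ → ℝ} {z : ℝ × ℝ} (h : DifferentiableAt ℝ f z) :
    HasDerivAt (fun t => f (z.1, t)) (fderiv ℝ f z (0, 1)) z.2 :=
  HasFDerivAt.comp_hasDerivAt (f := fun t : ℝ => ((z.1, t) : ℝ × ℝ)) z.2 h.hasFDerivAt (line2 z z.2)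

lemma pd1_eq {f : ℝ × ℝ → ℝ} {z : ℝ × ℝ} (h : DifferentiableAt ℝ f z) :
    pd1 f z = fderiv ℝ f z (1, 0) := (pd1_slice h).deriv

lemma pd2_eq {f : ℝ × ℝ → ℝ} {z : ℝ × ℝ} (h : DifferentiableAt ℝ f z) :
    pd2 f z = fderiv ℝ f z (0, 1) := (pd2_slice h).deriv

lemma hd1 {f : ℝ × ℝ → ℝ} {z : ℝ × ℝ} (h : DifferentiableAt ℝ f z) :
    HasDerivAt (fun t => f (t, z.2)) (pd1 f z) z.1 := by
  rw [pd1_eq h]; exact pd1_slice h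

lemma hd2 {f : ℝ × ℝ → ℝ} {z : ℝ × ℝ} (h : DifferentiableAt ℝ f z) :
    HasDerivAt (fun t => f (z.1, t)) (pd2 f z) z.2 := by
  rw [pd2_eq h]; exact pd2_slice h

lemma pd1_ev {f : ℝ × ℝ → ℝ} {z : ℝ × ℝ} (h : ContDiffAt ℝ 1 f z) :
    pd1 f =ᶠ[𝓝 z] fun w => fderiv ℝ f w (1, 0) := by
  filter_upwards [h.eventually (by simp)] with w hw
  exact pd1_eq (hw.differentiableAt (by simp))

lemma pd2_ev {f : ℝ × ℝ → ℝ} {z : ℝ × ℝ} (h : ContDiffAt ℝ 1 f z) :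
    pd2 f =ᶠ[𝓝 z] fun w => fderiv ℝ f w (0, 1) := by
  filter_upwards [h.eventually (by simp)] with w hw
  exact pd2_eq (hw.differentiableAt (by simp))

lemma pd1_cd {f : ℝ × ℝ → ℝ} {z : ℝ × ℝ} (h : ContDiffAt ℝ 2 f z) :
    ContDiffAt ℝ 1 (pd1 f) z := by
  refine ContDiffAt.congr_of_eventuallyEq ?_ (pd1_ev (h.of_le (by norm_num)))
  exact (h.fderiv_right (m := 1) (by norm_num)).clm_apply contDiffAt_const

lemma pd2_cd {f : ℝ × ℝ → ℝ} {z : ℝ × ℝ} (h : ContDiffAt ℝ 2 f z) :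
    ContDiffAt ℝ 1 (pd2 f) z := by
  refine ContDiffAt.congr_of_eventuallyEq ?_ (pd2_ev (h.of_le (by norm_num)))
  exact (h.fderiv_right (m := 1) (by norm_num)).clm_apply contDiffAt_const

lemma pd1_ct {f : ℝ × ℝ → ℝ} {z : ℝ × ℝ} (h : ContDiffAt ℝ 1 f z) :
    ContinuousAt (pd1 f) z := by
  refine ContinuousAt.congr ?_ (pd1_ev h).symm
  exact ((h.fderiv_right (m := 0) (by norm_num)).clm_apply contDiffAt_const).continuousAt

lemma pd2_ct {f : ℝ × ℝ → ℝ} {z : ℝ × ℝ} (h : ContDiffAt ℝ 1 f z) :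
    ContinuousAt (pd2 f) z := by
  refine ContinuousAt.congr ?_ (pd2_ev h).symm
  exact ((h.fderiv_right (m := 0) (by norm_num)).clm_apply contDiffAt_const).continuousAt

lemma pd_symm {f : ℝ × ℝ → ℝ} {z : ℝ × ℝ} (h : ContDiffAt ℝ 2 f z) :
    pd1 (pd2 f) z = pd2 (pd1 f) z := by
  have h1 : ContDiffAt ℝ 1 f z := h.of_le (by norm_num)
  have hD : DifferentiableAt ℝ (fderiv ℝ f) z :=
    (h.fderiv_right (m := 1) (by norm_num)).differentiableAt (by simp)
  rw [pd1_eq ((pd2_cd h).differentiableAt (by simp)),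
    pd2_eq ((pd1_cd h).differentiableAt (by simp)),
    (pd2_ev h1).fderiv_eq, (pd1_ev h1).fderiv_eq]
  rw [fderiv_clm_apply hD (differentiableAt_const _), fderiv_clm_apply hD (differentiableAt_const _)]
  have := h.isSymmSndFDerivAt (by simp)
  simpa using this.eq (1, 0) (0, 1)

lemma pd1_congr {f g : ℝ × ℝ → ℝ} {z : ℝ × ℝ} (h : f =ᶠ[𝓝 z] g) : pd1 f z = pd1 g z := by
  have hc : Tendsto (fun t : ℝ => ((t, z.2) : ℝ × ℝ)) (𝓝 z.1) (𝓝 z) :=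
    (line1 z z.1).continuousAt
  exact Filter.EventuallyEq.deriv_eq (hc.eventually h)

lemma pd2_congr {f g : ℝ × ℝ → ℝ} {z : ℝ × ℝ} (h : f =ᶠ[𝓝 z] g) : pd2 f z = pd2 g z := by
  have hc : Tendsto (fun t : ℝ => ((z.1, t) : ℝ × ℝ)) (𝓝 z.2) (𝓝 z) :=
    (line2 z z.2).continuousAt
  exact Filter.EventuallyEq.deriv_eq (hc.eventually h)

lemma pd1_congr_ev {f g : ℝ × ℝ → ℝ} {z : ℝ × ℝ} (h : f =ᶠ[𝓝 z] g) : pd1 f =ᶠ[𝓝 z] pd1 g := by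
  filter_upwards [h.eventuallyEq_nhds] with w hw using pd1_congr hw

lemma pd2_congr_ev {f g : ℝ × ℝ → ℝ} {z : ℝ × ℝ} (h : f =ᶠ[𝓝 z] g) : pd2 f =ᶠ[𝓝 z] pd2 g := by
  filter_upwards [h.eventuallyEq_nhds] with w hw using pd2_congr hw

lemma pd1_zero (z : ℝ × ℝ) : pd1 (fun _ => 0) z = 0 := by simp [pd1]
lemma pd2_zero (z : ℝ × ℝ) : pd2 (fun _ => 0) z = 0 := by simp [pd2]

lemma ev_zero {f : ℝ × ℝ → ℝ} {z : ℝ × ℝ} (h : z ∉ tsupport f) : f =ᶠ[𝓝 z] fun _ => 0 :=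
  notMem_tsupport_iff_eventuallyEq.1 h

lemma pd1_off {f : ℝ × ℝ → ℝ} {z : ℝ × ℝ} (h : z ∉ tsupport f) : pd1 f z = 0 := by
  rw [pd1_congr (ev_zero h), pd1_zero]
lemma pd2_off {f : ℝ × ℝ → ℝ} {z : ℝ × ℝ} (h : z ∉ tsupport f) : pd2 f z = 0 := by
  rw [pd2_congr (ev_zero h), pd2_zero]

lemma tsupport_pd1 (f : ℝ × ℝ → ℝ) : tsupport (pd1 f) ⊆ tsupport f :=
  closure_minimal (fun z hz => by_contra fun h => hz (pd1_off h)) isClosed_closure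
lemma tsupport_pd2 (f : ℝ × ℝ → ℝ) : tsupport (pd2 f) ⊆ tsupport f :=
  closure_minimal (fun z hz => by_contra fun h => hz (pd2_off h)) isClosed_closure

/-- smoothness from smoothness on the support -/
lemma cd_of_tsupport {n : WithTop ℕ∞} {f : ℝ × ℝ → ℝ} (h : ∀ z ∈ tsupport f, ContDiffAt ℝ n f z) :
    ContDiff ℝ n f := by
  rw [contDiff_iff_contDiffAt]
  intro z
  by_cases hz : z ∈ tsupport f
  · exact h z hz
  · exact contDiffAt_const.congr_of_eventuallyEq (ev_zero hz)

lemma ct_of_tsupport {f : ℝ × ℝ → ℝ} (h : ∀ z ∈ tsupport f, ContinuousAt f z) :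
    Continuous f := by
  rw [continuous_iff_continuousAt]
  intro z
  by_cases hz : z ∈ tsupport f
  · exact h z hz
  · exact continuousAt_const.congr (ev_zero hz).symm

lemma cs_of {f : ℝ × ℝ → ℝ} {K : Set (ℝ × ℝ)} (hK : IsCompact K) (h : ∀ z ∉ K, f z = 0) :
    HasCompactSupport f := HasCompactSupport.intro hK h

lemma int_pd1 {f : ℝ × ℝ → ℝ} (hf : ContDiff ℝ 1 f) (hc : HasCompactSupport f) :
    Integrable (pd1 f) ∧ ∫ z, pd1 f z = 0 := by
  have hI : Integrable (pd1 f) :=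
    (continuous_iff_continuousAt.2 fun z => pd1_ct hf.contDiffAt).integrable_of_hasCompactSupport
      (hc.of_isClosed_subset isClosed_closure (tsupport_pd1 f))
  refine ⟨hI, ?_⟩
  have e : pd1 f = fun z => fderiv ℝ f z (1, 0) := by
    ext z; exact pd1_eq (hf.differentiable (by simp) z)
  have := integral_mul_fderiv_eq_neg_fderiv_mul_of_integrable (μ := (volume : Measure (ℝ × ℝ)))
    (f := fun _ => (1:ℝ)) (g := f) (v := (1, 0)) (by simp) (by simpa [← e] using hI)
    (by simpa using hf.continuous.integrable_of_hasCompactSupport hc)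
    (by intros; simp) (by intros; exact hf.differentiable (by simp) _)
  rw [e]; simpa using this

lemma int_pd2 {f : ℝ × ℝ → ℝ} (hf : ContDiff ℝ 1 f) (hc : HasCompactSupport f) :
    Integrable (pd2 f) ∧ ∫ z, pd2 f z = 0 := by
  have hI : Integrable (pd2 f) :=
    (continuous_iff_continuousAt.2 fun z => pd2_ct hf.contDiffAt).integrable_of_hasCompactSupport
      (hc.of_isClosed_subset isClosed_closure (tsupport_pd2 f))
  refine ⟨hI, ?_⟩
  have e : pd2 f = fun z => fderiv ℝ f z (0, 1) := by
    ext z; exact pd2_eq (hf.differentiable (by simp) z)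
  have := integral_mul_fderiv_eq_neg_fderiv_mul_of_integrable (μ := (volume : Measure (ℝ × ℝ)))
    (f := fun _ => (1:ℝ)) (g := f) (v := (0, 1)) (by simp) (by simpa [← e] using hI)
    (by simpa using hf.continuous.integrable_of_hasCompactSupport hc)
    (by intros; simp) (by intros; exact hf.differentiable (by simp) _)
  rw [e]; simpa using this

lemma cs_pd1 {f : ℝ × ℝ → ℝ} (hc : HasCompactSupport f) : HasCompactSupport (pd1 f) :=
  hc.of_isClosed_subset isClosed_closure (tsupport_pd1 f)
lemma cs_pd2 {f : ℝ × ℝ → ℝ} (hc : HasCompactSupport f) : HasCompactSupport (pd2 f) :=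
  hc.of_isClosed_subset isClosed_closure (tsupport_pd2 f)

lemma shift_deriv {f k : ℝ × ℝ → ℝ} (hf : ContDiff ℝ 1 f) (hc : HasCompactSupport f)
    (hk : Continuous k) (hkc : HasCompactSupport k) (σ : ℝ) :
    HasDerivAt (fun t : ℝ => ∫ z : ℝ × ℝ, f (z.1 + σ * t, z.2) * k z)
      (∫ z : ℝ × ℝ, σ * pd1 f z * k z) 0 := by
  have hpc : Continuous (pd1 f) := continuous_iff_continuousAt.2 fun z => pd1_ct hf.contDiffAt
  obtain ⟨C, hC⟩ := (cs_pd1 hc).exists_bound_of_continuous hpc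
  have hfc := hf.continuous
  have key := hasDerivAt_integral_of_dominated_loc_of_deriv_le (μ := (volume : Measure (ℝ × ℝ)))
    (F := fun (t : ℝ) (z : ℝ × ℝ) => f (z.1 + σ * t, z.2) * k z)
    (F' := fun (t : ℝ) (z : ℝ × ℝ) => σ * pd1 f (z.1 + σ * t, z.2) * k z)
    (x₀ := 0) (s := univ) (bound := fun z => |σ| * C * |k z|) univ_mem
    (Eventually.of_forall fun t => by
      apply Continuous.aestronglyMeasurable
      fun_prop)
    (by
      apply Continuous.integrable_of_hasCompactSupport
      · fun_prop
      · exact hkc.mul_left)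
    (by apply Continuous.aestronglyMeasurable; fun_prop)
    (Eventually.of_forall fun z t _ => by
      rw [norm_mul, norm_mul, Real.norm_eq_abs σ, Real.norm_eq_abs (k z)]
      gcongr
      exact hC _)
    ((hk.integrable_of_hasCompactSupport hkc).abs.const_mul _)
    (Eventually.of_forall fun z t _ => by
      have h1 := hd1 (hf.differentiable (by simp) (z.1 + σ * t, z.2))
      have h2 : HasDerivAt (fun t : ℝ => z.1 + σ * t) σ t := by
        simpa using ((hasDerivAt_id t).const_mul σ).const_add z.1
      have h3 := HasDerivAt.comp t (h := fun t : ℝ => z.1 + σ * t) h1 h2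
      have h4 := h3.mul_const (k z)
      exact h4.congr_deriv (by ring))
  simpa using key.2

lemma shift_int (F : ℝ × ℝ → ℝ) (t : ℝ) : ∫ z : ℝ × ℝ, F (z.1 + t, z.2) = ∫ z, F z := by
  have := integral_add_right_eq_self (μ := (volume : Measure (ℝ × ℝ))) F (t, 0)
  rw [← this]
  congr 1; ext z
  congr 1
  ext <;> simp

lemma mixed0 {f g : ℝ × ℝ → ℝ} (hf : ContDiff ℝ 1 f) (hfc : HasCompactSupport f)
    (hg : ContDiff ℝ 1 g) (hgc : HasCompactSupport g) :
    ∫ z, pd1 f z * pd2 g z = ∫ z, pd2 f z * pd1 g z := by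
  have cg2 : Continuous (pd2 g) := continuous_iff_continuousAt.2 fun z => pd2_ct hg.contDiffAt
  have cf2 : Continuous (pd2 f) := continuous_iff_continuousAt.2 fun z => pd2_ct hf.contDiffAt
  have sg2 := cs_pd2 hgc
  have sf2 := cs_pd2 hfc
  have h1 := shift_deriv hf hfc cg2 sg2 1
  have h2 := (shift_deriv hg hgc cf2 sf2 (-1)).neg
  have e : (fun t : ℝ => ∫ z : ℝ × ℝ, f (z.1 + 1 * t, z.2) * pd2 g z) =
      -(fun t : ℝ => ∫ z : ℝ × ℝ, g (z.1 + (-1) * t, z.2) * pd2 f z) := by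
    ext t
    simp only [Pi.neg_apply]
    have hS : ContDiff ℝ 1 (fun z : ℝ × ℝ => f (z.1 + 1 * t, z.2)) := by
      apply hf.comp; fun_prop
    have hcomp : ContDiff ℝ 1 (fun z : ℝ × ℝ => f (z.1 + 1 * t, z.2) * g z) := hS.mul hg
    have h0 := (int_pd2 hcomp hgc.mul_left).2
    have hpt : ∀ z : ℝ × ℝ, pd2 (fun z : ℝ × ℝ => f (z.1 + 1 * t, z.2) * g z) z =
        pd2 f (z.1 + 1 * t, z.2) * g z + f (z.1 + 1 * t, z.2) * pd2 g z := by
      intro z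
      have a1 : HasDerivAt (fun y => f (z.1 + 1 * t, y)) (pd2 f (z.1 + 1 * t, z.2)) z.2 :=
        hd2 (hf.differentiable (by simp) (z.1 + 1 * t, z.2))
      have a2 : HasDerivAt (fun y => g (z.1, y)) (pd2 g z) z.2 :=
        hd2 (hg.differentiable (by simp) z)
      exact (a1.mul a2).deriv
    simp_rw [hpt] at h0
    have hfcn := hf.continuous
    have hgcn := hg.continuous
    rw [integral_add] at h0
    · have h3 := shift_int (fun z => pd2 f z * g (z.1 + (-1) * t, z.2)) t
      simp only [add_assoc] at h3
      have h4 : ∫ z : ℝ × ℝ, pd2 f (z.1 + 1 * t, z.2) * g z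
          = ∫ z : ℝ × ℝ, g (z.1 + (-1) * t, z.2) * pd2 f z := by
        rw [integral_congr_ae (Eventually.of_forall fun z => mul_comm _ _), 
          ← shift_int (fun z => g (z.1 + (-1) * t, z.2) * pd2 f z) t]
        congr 1; ext z
        simp
      linarith
    · apply Continuous.integrable_of_hasCompactSupport
      · fun_prop
      · exact hgc.mul_left
    · apply Continuous.integrable_of_hasCompactSupport
      · fun_prop
      · exact sg2.mul_left
  rw [e] at h1
  have := h1.unique h2
  simp only [one_mul, neg_mul, integral_neg, neg_neg] at this
  rw [this]
  congr 1; ext z; ring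

lemma mixed {f g : ℝ × ℝ → ℝ} {Ω : Set (ℝ × ℝ)} (hΩ : IsOpen Ω) (hf : ContDiff ℝ 1 f)
    (hfc : HasCompactSupport f) (hs : tsupport f ⊆ Ω) (hg : ∀ z ∈ Ω, ContDiffAt ℝ 1 g z) :
    Integrable (fun z => pd1 f z * pd2 g z - pd2 f z * pd1 g z) ∧
    ∫ z, (pd1 f z * pd2 g z - pd2 f z * pd1 g z) = 0 := by
  obtain ⟨L, hL, hL1, hL2⟩ := exists_compact_between hfc hΩ hs
  obtain ⟨θ, h1, h0, -⟩ := exists_contMDiffMap_one_nhds_of_subset_interior (n := 1)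
    (modelWithCornersSelf ℝ (ℝ × ℝ)) (isClosed_tsupport f) hL1
  have hθ : ContDiff ℝ 1 (θ : ℝ × ℝ → ℝ) := θ.contMDiff.contDiff
  have hθL : tsupport (θ : ℝ × ℝ → ℝ) ⊆ L :=
    closure_minimal (fun z hz => by_contra fun h => hz (h0 z h)) hL.isClosed
  set G : ℝ × ℝ → ℝ := fun z => θ z * g z with hG
  have hGs : tsupport G ⊆ L := (tsupport_mul_subset_left).trans hθL
  have hGc : HasCompactSupport G := hL.of_isClosed_subset isClosed_closure hGs
  have hGd : ContDiff ℝ 1 G := cd_of_tsupport fun z hz =>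
    hθ.contDiffAt.mul (hg z (hL2 (hGs hz)))
  have hev : ∀ z ∈ tsupport f, G =ᶠ[𝓝 z] g := by
    intro z hz
    filter_upwards [(eventually_nhdsSet_iff_forall.1 h1) z hz] with w hw
    simp [hG, hw]
  have e1 : (fun z => pd1 f z * pd2 g z) = fun z => pd1 f z * pd2 G z := by
    ext z
    by_cases hz : z ∈ tsupport f
    · rw [pd2_congr (hev z hz)]
    · simp [pd1_off hz]
  have e2 : (fun z => pd2 f z * pd1 g z) = fun z => pd2 f z * pd1 G z := by
    ext z
    by_cases hz : z ∈ tsupport f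
    · rw [pd1_congr (hev z hz)]
    · simp [pd2_off hz]
  have cG1 : Continuous (pd1 G) := continuous_iff_continuousAt.2 fun z => pd1_ct hGd.contDiffAt
  have cG2 : Continuous (pd2 G) := continuous_iff_continuousAt.2 fun z => pd2_ct hGd.contDiffAt
  have cf1 : Continuous (pd1 f) := continuous_iff_continuousAt.2 fun z => pd1_ct hf.contDiffAt
  have cf2 : Continuous (pd2 f) := continuous_iff_continuousAt.2 fun z => pd2_ct hf.contDiffAt
  have i1 : Integrable (fun z => pd1 f z * pd2 g z) := by
    rw [e1]
    exact (cf1.mul cG2).integrable_of_hasCompactSupport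
      (cs_pd1 hfc).mul_right
  have i2 : Integrable (fun z => pd2 f z * pd1 g z) := by
    rw [e2]
    exact (cf2.mul cG1).integrable_of_hasCompactSupport
      (cs_pd2 hfc).mul_right
  refine ⟨i1.sub i2, ?_⟩
  rw [integral_sub i1 i2, e1, e2, mixed0 hf hfc hGd hGc, sub_self]

lemma alg1 {p q r s t W : ℝ} (hW : 0 < W) (h2 : W ^ 2 = 1 + p ^ 2 + q ^ 2) :
    (r / (W * (W + 1)) - p * (((p * r + q * s) / W) * (2 * W + 1)) / (W * (W + 1)) ^ 2) * t
    - (s / (W * (W + 1)) - p * (((p * s + q * t) / W) * (2 * W + 1)) / (W * (W + 1)) ^ 2) * s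
    - (s / (W * (W + 1)) - q * (((p * r + q * s) / W) * (2 * W + 1)) / (W * (W + 1)) ^ 2) * s
    + (t / (W * (W + 1)) - q * (((p * s + q * t) / W) * (2 * W + 1)) / (W * (W + 1)) ^ 2) * r
    = (r * t - s ^ 2) / W ^ 3 := by
  have h3 : p ^ 2 + q ^ 2 = W ^ 2 - 1 := by linarith
  have hW1 : W + 1 ≠ 0 := by positivity
  have : (r / (W * (W + 1)) - p * (((p * r + q * s) / W) * (2 * W + 1)) / (W * (W + 1)) ^ 2) * t
    - (s / (W * (W + 1)) - p * (((p * s + q * t) / W) * (2 * W + 1)) / (W * (W + 1)) ^ 2) * s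
    - (s / (W * (W + 1)) - q * (((p * r + q * s) / W) * (2 * W + 1)) / (W * (W + 1)) ^ 2) * s
    + (t / (W * (W + 1)) - q * (((p * s + q * t) / W) * (2 * W + 1)) / (W * (W + 1)) ^ 2) * r
    = (r * t - s ^ 2) * (2 / (W * (W + 1))
      - (p ^ 2 + q ^ 2) * (2 * W + 1) / (W * (W * (W + 1)) ^ 2)) := by
    field_simp; ring
  rw [this, h3]
  field_simp; ring

lemma alg2 {p q r s t W x y : ℝ} (hW : 0 < W) (h2 : W ^ 2 = 1 + p ^ 2 + q ^ 2)
    (hm : (1 + q ^ 2) * r - 2 * p * q * s + (1 + p ^ 2) * t = 0) :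
    x * (p / (W * (W + 1)) * t - q / (W * (W + 1)) * s)
      + y * (q / (W * (W + 1)) * r - p / (W * (W + 1)) * s)
    = -((p * r + q * s) / W) / (W * (W + 1)) * (((1 + q ^ 2) * x - p * q * y) / W)
      + -((p * s + q * t) / W) / (W * (W + 1)) * ((-(p * q * x) + (1 + p ^ 2) * y) / W) := by
  have hW1 : W + 1 ≠ 0 := by positivity
  field_simp
  rw [h2]
  linear_combination (p * x + q * y) * hm

lemma alg3 {p q r s t W x y xx xy yy : ℝ} (hW : 0 < W) (h2 : W ^ 2 = 1 + p ^ 2 + q ^ 2)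
    (hm : (1 + q ^ 2) * r - 2 * p * q * s + (1 + p ^ 2) * t = 0) :
    (((2 * q * s) * x + (1 + q ^ 2) * xx - ((r * q + p * s) * y + p * q * xy)) * W
      - ((1 + q ^ 2) * x - p * q * y) * ((p * r + q * s) / W)) / W ^ 2
    + ((-((s * q + p * t) * x + p * q * xy) + ((2 * p * s) * y + (1 + p ^ 2) * yy)) * W
      - (-(p * q * x) + (1 + p ^ 2) * y) * ((p * s + q * t) / W)) / W ^ 2
    = ((1 + q ^ 2) * xx - 2 * p * q * xy + (1 + p ^ 2) * yy) / W := by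
  field_simp
  rw [h2]
  linear_combination (-(p * x + q * y)) * hm

noncomputable def aF (u : ℝ × ℝ → ℝ) (z : ℝ × ℝ) : ℝ := pd1 u z / (Wg u z * (Wg u z + 1))
noncomputable def bF (u : ℝ × ℝ → ℝ) (z : ℝ × ℝ) : ℝ := pd2 u z / (Wg u z * (Wg u z + 1))
noncomputable def gF (u : ℝ × ℝ → ℝ) (z : ℝ × ℝ) : ℝ := Real.log (1 + (Wg u z)⁻¹)
noncomputable def v1 (u Φ : ℝ × ℝ → ℝ) (z : ℝ × ℝ) : ℝ :=
  ((1 + pd2 u z ^ 2) * pd1 Φ z - pd1 u z * pd2 u z * pd2 Φ z) / Wg u z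
noncomputable def v2 (u Φ : ℝ × ℝ → ℝ) (z : ℝ × ℝ) : ℝ :=
  (-(pd1 u z * pd2 u z * pd1 Φ z) + (1 + pd1 u z ^ 2) * pd2 Φ z) / Wg u z
noncomputable def LF (u Φ : ℝ × ℝ → ℝ) (z : ℝ × ℝ) : ℝ :=
  ((1 + pd2 u z ^ 2) * pd1 (pd1 Φ) z - 2 * pd1 u z * pd2 u z * pd2 (pd1 Φ) z
    + (1 + pd1 u z ^ 2) * pd2 (pd2 Φ) z) / Wg u z
noncomputable def JF (u : ℝ × ℝ → ℝ) (z : ℝ × ℝ) : ℝ :=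
  (pd1 (pd1 u) z * pd2 (pd2 u) z - pd2 (pd1 u) z ^ 2) / Wg u z ^ 3

lemma W_pos (u : ℝ × ℝ → ℝ) (z : ℝ × ℝ) : 0 < Wg u z := Real.sqrt_pos.2 (by positivity)
lemma W_sq (u : ℝ × ℝ → ℝ) (z : ℝ × ℝ) : Wg u z ^ 2 = 1 + pd1 u z ^ 2 + pd2 u z ^ 2 :=
  Real.sq_sqrt (by positivity)

lemma W_cd {u : ℝ × ℝ → ℝ} {z : ℝ × ℝ} (h : ContDiffAt ℝ 2 u z) : ContDiffAt ℝ 1 (Wg u) z := by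
  refine ContDiffAt.sqrt ?_ (by positivity : (1 + pd1 u z ^ 2 + pd2 u z ^ 2) ≠ 0)
  exact (contDiffAt_const.add ((pd1_cd h).pow 2)).add ((pd2_cd h).pow 2)

lemma aF_cd {u : ℝ × ℝ → ℝ} {z : ℝ × ℝ} (h : ContDiffAt ℝ 2 u z) : ContDiffAt ℝ 1 (aF u) z := by
  have := W_pos u z
  exact (pd1_cd h).div ((W_cd h).mul ((W_cd h).add contDiffAt_const)) (by positivity)
lemma bF_cd {u : ℝ × ℝ → ℝ} {z : ℝ × ℝ} (h : ContDiffAt ℝ 2 u z) : ContDiffAt ℝ 1 (bF u) z := by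
  have := W_pos u z
  exact (pd2_cd h).div ((W_cd h).mul ((W_cd h).add contDiffAt_const)) (by positivity)
lemma gF_cd {u : ℝ × ℝ → ℝ} {z : ℝ × ℝ} (h : ContDiffAt ℝ 2 u z) : ContDiffAt ℝ 1 (gF u) z := by
  have := W_pos u z
  exact (contDiffAt_const.add ((W_cd h).inv this.ne')).log
    (by positivity : 1 + (Wg u z)⁻¹ ≠ 0)
lemma v1_cd {u Φ : ℝ × ℝ → ℝ} {z : ℝ × ℝ} (h : ContDiffAt ℝ 2 u z) (hΦ : ContDiffAt ℝ 2 Φ z) :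
    ContDiffAt ℝ 1 (v1 u Φ) z := by
  have := W_pos u z
  exact (((contDiffAt_const.add ((pd2_cd h).pow 2)).mul (pd1_cd hΦ)).sub
    (((pd1_cd h).mul (pd2_cd h)).mul (pd2_cd hΦ))).div (W_cd h) (by positivity)
lemma v2_cd {u Φ : ℝ × ℝ → ℝ} {z : ℝ × ℝ} (h : ContDiffAt ℝ 2 u z) (hΦ : ContDiffAt ℝ 2 Φ z) :
    ContDiffAt ℝ 1 (v2 u Φ) z := by
  have := W_pos u z
  exact ((((pd1_cd h).mul (pd2_cd h)).mul (pd1_cd hΦ)).neg.add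
    ((contDiffAt_const.add ((pd1_cd h).pow 2)).mul (pd2_cd hΦ))).div (W_cd h) (by positivity)

section oned
variable {P Q V X Y : ℝ → ℝ} {p' q' x' y' τ : ℝ}

lemma dW (hP : HasDerivAt P p' τ) (hQ : HasDerivAt Q q' τ)
    (hV : ∀ σ, V σ = Real.sqrt (1 + P σ ^ 2 + Q σ ^ 2)) :
    HasDerivAt V ((P τ * p' + Q τ * q') / V τ) τ := by
  have e : V = fun σ => Real.sqrt (1 + P σ ^ 2 + Q σ ^ 2) := funext hV
  have h := (((hP.pow 2).const_add 1).add (hQ.pow 2)).sqrt (by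
    simp only [Pi.add_apply, Pi.pow_apply]; positivity)
  rw [hV τ, e]
  refine h.congr_deriv ?_
  have : 0 < Real.sqrt (1 + P τ ^ 2 + Q τ ^ 2) := Real.sqrt_pos.2 (by positivity)
  simp only [Pi.add_apply, Pi.pow_apply]
  field_simp
  push_cast
  ring

lemma dA (w' : ℝ) (hP : HasDerivAt P p' τ) (hV : HasDerivAt V w' τ) (h0 : 0 < V τ) :
    HasDerivAt (fun σ => P σ / (V σ * (V σ + 1)))
      (p' / (V τ * (V τ + 1)) - P τ * (w' * (2 * V τ + 1)) / (V τ * (V τ + 1)) ^ 2) τ := by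
  refine (hP.div (hV.mul (hV.add_const 1)) (by simp; constructor <;> positivity)).congr_deriv ?_
  simp only [Pi.mul_apply]
  field_simp
  ring

lemma dG (w' : ℝ) (hV : HasDerivAt V w' τ) (h0 : 0 < V τ) :
    HasDerivAt (fun σ => Real.log (1 + (V σ)⁻¹)) (-w' / (V τ * (V τ + 1))) τ := by
  refine (((hV.inv h0.ne').const_add 1).log (by simp; positivity)).congr_deriv ?_
  simp
  field_simp

lemma dV1 (w' : ℝ) (hP : HasDerivAt P p' τ) (hQ : HasDerivAt Q q' τ) (hX : HasDerivAt X x' τ)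
    (hY : HasDerivAt Y y' τ) (hV : HasDerivAt V w' τ) (h0 : 0 < V τ) :
    HasDerivAt (fun σ => ((1 + Q σ ^ 2) * X σ - P σ * Q σ * Y σ) / V σ)
     ((((2 * Q τ * q') * X τ + (1 + Q τ ^ 2) * x' - ((p' * Q τ + P τ * q') * Y τ + P τ * Q τ * y'))
        * V τ - ((1 + Q τ ^ 2) * X τ - P τ * Q τ * Y τ) * w') / V τ ^ 2) τ := by
  refine (((((hQ.pow 2).const_add 1).mul hX).sub ((hP.mul hQ).mul hY)).div hV h0.ne').congr_deriv ?_
  simp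

lemma dV2 (w' : ℝ) (hP : HasDerivAt P p' τ) (hQ : HasDerivAt Q q' τ) (hX : HasDerivAt X x' τ)
    (hY : HasDerivAt Y y' τ) (hV : HasDerivAt V w' τ) (h0 : 0 < V τ) :
    HasDerivAt (fun σ => (-(P σ * Q σ * X σ) + (1 + P σ ^ 2) * Y σ) / V σ)
     (((-((p' * Q τ + P τ * q') * X τ + P τ * Q τ * x') + ((2 * P τ * p') * Y τ
        + (1 + P τ ^ 2) * y')) * V τ
        - (-(P τ * Q τ * X τ) + (1 + P τ ^ 2) * Y τ) * w') / V τ ^ 2) τ := by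
  refine ((((hP.mul hQ).mul hX).neg.add (((hP.pow 2).const_add 1).mul hY)).div hV
    h0.ne').congr_deriv ?_
  simp
end oned

lemma pd1_mul {f g : ℝ × ℝ → ℝ} {z : ℝ × ℝ} (hf : ContDiffAt ℝ 1 f z) (hg : ContDiffAt ℝ 1 g z) :
    pd1 (fun w => f w * g w) z = pd1 f z * g z + f z * pd1 g z :=
  ((hd1 (hf.differentiableAt (by simp))).mul (hd1 (hg.differentiableAt (by simp)))).deriv
lemma pd2_mul {f g : ℝ × ℝ → ℝ} {z : ℝ × ℝ} (hf : ContDiffAt ℝ 1 f z) (hg : ContDiffAt ℝ 1 g z) :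
    pd2 (fun w => f w * g w) z = pd2 f z * g z + f z * pd2 g z :=
  ((hd2 (hf.differentiableAt (by simp))).mul (hd2 (hg.differentiableAt (by simp)))).deriv

lemma hdd1 {f : ℝ × ℝ → ℝ} {z : ℝ × ℝ} (hf : ContDiffAt ℝ 1 f z) :
    HasDerivAt (fun t => f (t, z.2)) (pd1 f z) z.1 := hd1 (hf.differentiableAt (by simp))
lemma hdd2 {f : ℝ × ℝ → ℝ} {z : ℝ × ℝ} (hf : ContDiffAt ℝ 1 f z) :
    HasDerivAt (fun t => f (z.1, t)) (pd2 f z) z.2 := hd2 (hf.differentiableAt (by simp))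

lemma pointwise {u Φ : ℝ × ℝ → ℝ} {z : ℝ × ℝ} (h : ContDiffAt ℝ 2 u z) (hΦ : ContDiffAt ℝ 2 Φ z)
    (hm : (1 + pd2 u z ^ 2) * pd1 (pd1 u) z - 2 * pd1 u z * pd2 u z * pd2 (pd1 u) z
      + (1 + pd1 u z ^ 2) * pd2 (pd2 u) z = 0) :
    Φ z * JF u z - gF u z * LF u Φ z =
      (pd1 (fun w => Φ w * aF u w) z * pd2 (pd2 u) z - pd2 (fun w => Φ w * aF u w) z * pd1 (pd2 u) z)
      - (pd1 (fun w => Φ w * bF u w) z * pd2 (pd1 u) z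
        - pd2 (fun w => Φ w * bF u w) z * pd1 (pd1 u) z)
      - pd1 (fun w => gF u w * v1 u Φ w) z - pd2 (fun w => gF u w * v2 u Φ w) z := by
  have hΦ1 : ContDiffAt ℝ 1 Φ z := hΦ.of_le (by norm_num)
  rw [pd1_mul hΦ1 (aF_cd h), pd2_mul hΦ1 (aF_cd h), pd1_mul hΦ1 (bF_cd h), pd2_mul hΦ1 (bF_cd h),
    pd1_mul (gF_cd h) (v1_cd h hΦ), pd2_mul (gF_cd h) (v2_cd h hΦ)]
  have hp1 := hdd1 (pd1_cd h)
  have hp2 := hdd2 (pd1_cd h)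
  have hq1 := hdd1 (pd2_cd h)
  have hq2 := hdd2 (pd2_cd h)
  have hx1 := hdd1 (pd1_cd hΦ)
  have hx2 := hdd2 (pd1_cd hΦ)
  have hy1 := hdd1 (pd2_cd hΦ)
  have hy2 := hdd2 (pd2_cd hΦ)
  rw [pd_symm h] at hq1 ⊢
  rw [pd_symm hΦ] at hy1
  have hW := W_pos u z
  have hw1 := dW (V := fun t => Wg u (t, z.2)) hp1 hq1 (fun _ => rfl)
  have hw2 := dW (V := fun t => Wg u (z.1, t)) hp2 hq2 (fun _ => rfl)
  have a1 : pd1 (aF u) z = _ := (dA _ hp1 hw1 hW).deriv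
  have a2 : pd2 (aF u) z = _ := (dA _ hp2 hw2 hW).deriv
  have b1 : pd1 (bF u) z = _ := (dA _ hq1 hw1 hW).deriv
  have b2 : pd2 (bF u) z = _ := (dA _ hq2 hw2 hW).deriv
  have g1 : pd1 (gF u) z = _ := (dG _ hw1 hW).deriv
  have g2 : pd2 (gF u) z = _ := (dG _ hw2 hW).deriv
  have e1 : pd1 (v1 u Φ) z = _ := (dV1 _ hp1 hq1 hx1 hy1 hw1 hW).deriv
  have e2 : pd2 (v2 u Φ) z = _ := (dV2 _ hp2 hq2 hx2 hy2 hw2 hW).deriv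
  rw [a1, a2, b1, b2, g1, g2, e1, e2]
  simp only [Prod.mk.eta]
  have i1 := alg1 (r := pd1 (pd1 u) z) (s := pd2 (pd1 u) z) (t := pd2 (pd2 u) z) hW (W_sq u z)
  have i2 := alg2 (x := pd1 Φ z) (y := pd2 Φ z) hW (W_sq u z) hm
  have i3 := alg3 (x := pd1 Φ z) (y := pd2 Φ z) (xx := pd1 (pd1 Φ) z) (xy := pd2 (pd1 Φ) z)
    (yy := pd2 (pd2 Φ) z) hW (W_sq u z) hm
  simp only [JF, LF, aF, bF, v1, v2]
  linear_combination (-Φ z) * i1 - i2 + gF u z * i3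

lemma JF_int {u Φ : ℝ × ℝ → ℝ} {Ω : Set (ℝ × ℝ)} 
    (hu2 : ∀ z ∈ Ω, ContDiffAt ℝ 2 u z) (hΦ : Continuous Φ) (hc : HasCompactSupport Φ)
    (hs : tsupport Φ ⊆ Ω) : Integrable (fun z => Φ z * JF u z) := by
  refine Continuous.integrable_of_hasCompactSupport ?_ hc.mul_right
  refine ct_of_tsupport fun z hz => ?_
  have h := hu2 z (hs (tsupport_mul_subset_left hz))
  have := W_pos u z
  refine hΦ.continuousAt.mul (ContinuousAt.div ?_ ((W_cd h).continuousAt.pow 3) (by positivity))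
  exact ((pd1_ct (pd1_cd h)).mul (pd2_ct (pd2_cd h))).sub ((pd2_ct (pd1_cd h)).pow 2)

lemma core {u Φ : ℝ × ℝ → ℝ} {Ω : Set (ℝ × ℝ)} (hΩ : IsOpen Ω) (hu : IsMSE u Ω)
    (hΦ : ContDiff ℝ 2 Φ) (hc : HasCompactSupport Φ) (hs : tsupport Φ ⊆ Ω) :
    ∫ z, Φ z * JF u z = ∫ z, gF u z * LF u Φ z := by
  have hu2 : ∀ z ∈ Ω, ContDiffAt ℝ 2 u z := fun z hz => hu.1.contDiffAt (hΩ.mem_nhds hz)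
  have hΦ1 : ContDiff ℝ 1 Φ := hΦ.of_le (by norm_num)
  have sa : tsupport (fun w => Φ w * aF u w) ⊆ tsupport Φ := tsupport_mul_subset_left
  have sb : tsupport (fun w => Φ w * bF u w) ⊆ tsupport Φ := tsupport_mul_subset_left
  have z1 : ∀ z ∉ tsupport Φ, v1 u Φ z = 0 := fun z hz => by simp [v1, pd1_off hz, pd2_off hz]
  have z2 : ∀ z ∉ tsupport Φ, v2 u Φ z = 0 := fun z hz => by simp [v2, pd1_off hz, pd2_off hz]
  have s1 : tsupport (fun w => gF u w * v1 u Φ w) ⊆ tsupport Φ :=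
    closure_minimal (fun z hz => by_contra fun h => hz (by simp [z1 z h])) isClosed_closure
  have s2 : tsupport (fun w => gF u w * v2 u Φ w) ⊆ tsupport Φ :=
    closure_minimal (fun z hz => by_contra fun h => hz (by simp [z2 z h])) isClosed_closure
  obtain ⟨A1, A2⟩ := mixed (f := fun w => Φ w * aF u w) (g := pd2 u) hΩ
    (cd_of_tsupport fun z hz => hΦ1.contDiffAt.mul (aF_cd (hu2 z (hs (sa hz)))))
    (hc.of_isClosed_subset isClosed_closure sa) (sa.trans hs) (fun z hz => pd2_cd (hu2 z hz))
  obtain ⟨B1, B2⟩ := mixed (f := fun w => Φ w * bF u w) (g := pd1 u) hΩ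
    (cd_of_tsupport fun z hz => hΦ1.contDiffAt.mul (bF_cd (hu2 z (hs (sb hz)))))
    (hc.of_isClosed_subset isClosed_closure sb) (sb.trans hs) (fun z hz => pd1_cd (hu2 z hz))
  obtain ⟨C1, C2⟩ := int_pd1 (f := fun w => gF u w * v1 u Φ w)
    (cd_of_tsupport fun z hz => (gF_cd (hu2 z (hs (s1 hz)))).mul
      (v1_cd (hu2 z (hs (s1 hz))) hΦ.contDiffAt)) (hc.of_isClosed_subset isClosed_closure s1)
  obtain ⟨D1, D2⟩ := int_pd2 (f := fun w => gF u w * v2 u Φ w)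
    (cd_of_tsupport fun z hz => (gF_cd (hu2 z (hs (s2 hz)))).mul
      (v2_cd (hu2 z (hs (s2 hz))) hΦ.contDiffAt)) (hc.of_isClosed_subset isClosed_closure s2)
  have key : ∀ z, Φ z * JF u z - gF u z * LF u Φ z =
      (pd1 (fun w => Φ w * aF u w) z * pd2 (pd2 u) z - pd2 (fun w => Φ w * aF u w) z * pd1 (pd2 u) z)
      - (pd1 (fun w => Φ w * bF u w) z * pd2 (pd1 u) z
        - pd2 (fun w => Φ w * bF u w) z * pd1 (pd1 u) z)
      - pd1 (fun w => gF u w * v1 u Φ w) z - pd2 (fun w => gF u w * v2 u Φ w) z := by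
    intro z
    by_cases hz : z ∈ tsupport Φ
    · exact pointwise (hu2 z (hs hz)) hΦ.contDiffAt (hu.2 z (hs hz))
    · have n1 : z ∉ tsupport (pd1 Φ) := fun h => hz (tsupport_pd1 _ h)
      have n2 : z ∉ tsupport (pd2 Φ) := fun h => hz (tsupport_pd2 _ h)
      rw [pd1_off (fun h => hz (sa h)), pd2_off (fun h => hz (sa h)), pd1_off (fun h => hz (sb h)),
        pd2_off (fun h => hz (sb h)), pd1_off (fun h => hz (s1 h)), pd2_off (fun h => hz (s2 h))]
      simp [LF, image_eq_zero_of_notMem_tsupport hz, pd1_off n1, pd2_off n1, pd2_off n2]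
  have iJ : Integrable (fun z => Φ z * JF u z) := JF_int hu2 hΦ1.continuous hc hs
  have iT := ((A1.sub B1).sub C1).sub D1
  have iL : Integrable (fun z => gF u z * LF u Φ z) := by
    refine (iJ.sub iT).congr (Eventually.of_forall fun z => ?_)
    have := key z
    simp only [Pi.sub_apply]
    linarith
  rw [← sub_eq_zero, ← integral_sub iJ iL]
  simp_rw [key]
  have hT := integral_sub' ((A1.sub B1).sub C1) D1
  rw [integral_sub' (A1.sub B1) C1, integral_sub' A1 B1, A2, B2, C2, D2] at hT
  simpa using hT

lemma J_nonpos {u : ℝ × ℝ → ℝ} {z : ℝ × ℝ}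
    (hm : (1 + pd2 u z ^ 2) * pd1 (pd1 u) z - 2 * pd1 u z * pd2 u z * pd2 (pd1 u) z
      + (1 + pd1 u z ^ 2) * pd2 (pd2 u) z = 0) : JF u z ≤ 0 := by
  have hW := W_pos u z
  refine div_nonpos_of_nonpos_of_nonneg ?_ (by positivity)
  set p := pd1 u z
  set q := pd2 u z
  set r := pd1 (pd1 u) z
  set s := pd2 (pd1 u) z
  set t := pd2 (pd2 u) z
  have h1 : (1 + q ^ 2) * (r * t - s ^ 2) = -(t ^ 2 + s ^ 2 + (p * t - q * s) ^ 2) := by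
    linear_combination t * hm
  by_contra hcon
  push Not at hcon
  have : 0 < (1 + q ^ 2) * (r * t - s ^ 2) := by positivity
  nlinarith [sq_nonneg t, sq_nonneg s, sq_nonneg (p * t - q * s)]

lemma gF_bd (u : ℝ × ℝ → ℝ) (z : ℝ × ℝ) : |gF u z| ≤ (Wg u z)⁻¹ := by
  have hW := W_pos u z
  have h0 : 0 < (Wg u z)⁻¹ := by positivity
  unfold gF
  rw [abs_of_nonneg (Real.log_nonneg (by linarith))]
  have := Real.log_le_sub_one_of_pos (x := 1 + (Wg u z)⁻¹) (by positivity)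
  linarith

lemma LF_eq {u Φ : ℝ × ℝ → ℝ} {f g : ℝ → ℝ} {z : ℝ × ℝ} (h : ContDiffAt ℝ 2 u z)
    (hf : ContDiff ℝ 2 f) (hg : ContDiff ℝ 2 g)
    (hΦ : Φ =ᶠ[𝓝 z] fun w => f w.1 * g (u w))
    (hm : (1 + pd2 u z ^ 2) * pd1 (pd1 u) z - 2 * pd1 u z * pd2 u z * pd2 (pd1 u) z
      + (1 + pd1 u z ^ 2) * pd2 (pd2 u) z = 0) :
    LF u Φ z = ((1 + pd2 u z ^ 2) * (deriv (deriv f) z.1 * g (u z))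
      + 2 * (deriv f z.1 * deriv g (u z)) * pd1 u z
      + f z.1 * deriv (deriv g) (u z) * (pd1 u z ^ 2 + pd2 u z ^ 2)) / Wg u z := by
  have hf1 : ∀ x, HasDerivAt f (deriv f x) x := fun x =>
    (hf.differentiable (by simp) x).hasDerivAt
  have hg1 : ∀ x, HasDerivAt g (deriv g x) x := fun x =>
    (hg.differentiable (by simp) x).hasDerivAt
  have hf2 : ∀ x, HasDerivAt (deriv f) (deriv (deriv f) x) x := fun x =>
    ((hf.iterate_deriv' 1 1).differentiable (by simp) x).hasDerivAt
  have hg2 : ∀ x, HasDerivAt (deriv g) (deriv (deriv g) x) x := fun x =>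
    ((hg.iterate_deriv' 1 1).differentiable (by simp) x).hasDerivAt
  have hev : ∀ᶠ w in 𝓝 z, ContDiffAt ℝ 2 u w := h.eventually (by simp)
  have E1 : pd1 Φ =ᶠ[𝓝 z] fun w =>
      deriv f w.1 * g (u w) + f w.1 * (deriv g (u w) * pd1 u w) := by
    filter_upwards [hev, hΦ.eventuallyEq_nhds] with w hw hw2
    rw [pd1_congr hw2]
    have a := hdd1 (hw.of_le (by norm_num))
    exact ((hf1 w.1).mul (HasDerivAt.comp w.1 (h := fun t => u (t, w.2)) (hg1 (u w)) a)).deriv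
  have E2 : pd2 Φ =ᶠ[𝓝 z] fun w => f w.1 * (deriv g (u w) * pd2 u w) := by
    filter_upwards [hev, hΦ.eventuallyEq_nhds] with w hw hw2
    rw [pd2_congr hw2]
    have a := hdd2 (hw.of_le (by norm_num))
    exact ((HasDerivAt.comp w.2 (h := fun t => u (w.1, t)) (hg1 (u w)) a).const_mul (f w.1)).deriv
  have a1 : HasDerivAt (fun t => u (t, z.2)) (pd1 u z) z.1 := hdd1 (h.of_le (by norm_num))
  have a2 : HasDerivAt (fun t => u (z.1, t)) (pd2 u z) z.2 := hdd2 (h.of_le (by norm_num))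
  have c1 : HasDerivAt (fun t => g (u (t, z.2))) (deriv g (u z) * pd1 u z) z.1 :=
    HasDerivAt.comp z.1 (h := fun t => u (t, z.2)) (hg1 (u z)) a1
  have c2 : HasDerivAt (fun t => g (u (z.1, t))) (deriv g (u z) * pd2 u z) z.2 :=
    HasDerivAt.comp z.2 (h := fun t => u (z.1, t)) (hg1 (u z)) a2
  have d1 : HasDerivAt (fun t => deriv g (u (t, z.2))) (deriv (deriv g) (u z) * pd1 u z) z.1 :=
    HasDerivAt.comp z.1 (h := fun t => u (t, z.2)) (hg2 (u z)) a1
  have d2 : HasDerivAt (fun t => deriv g (u (z.1, t))) (deriv (deriv g) (u z) * pd2 u z) z.2 :=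
    HasDerivAt.comp z.2 (h := fun t => u (z.1, t)) (hg2 (u z)) a2
  have F11 : pd1 (pd1 Φ) z = _ := (pd1_congr E1).trans
    (((hf2 z.1).mul c1).add ((hf1 z.1).mul (d1.mul (hdd1 (pd1_cd h))))).deriv
  have F12 : pd2 (pd1 Φ) z = _ := (pd2_congr E1).trans
    ((c2.const_mul (deriv f z.1)).add ((d2.mul (hdd2 (pd1_cd h))).const_mul (f z.1))).deriv
  have F22 : pd2 (pd2 Φ) z = _ := (pd2_congr E2).trans
    ((d2.mul (hdd2 (pd2_cd h))).const_mul (f z.1)).deriv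
  unfold LF
  rw [F11, F12, F22]
  congr 1
  simp only [Prod.mk.eta, Pi.mul_apply]
  linear_combination (f z.1 * deriv g (u z)) * hm

lemma gL_bd {u Φ : ℝ × ℝ → ℝ} {f g : ℝ → ℝ} {z : ℝ × ℝ} (h : ContDiffAt ℝ 2 u z)
    (hf : ContDiff ℝ 2 f) (hg : ContDiff ℝ 2 g)
    (hΦ : Φ =ᶠ[𝓝 z] fun w => f w.1 * g (u w))
    (hm : (1 + pd2 u z ^ 2) * pd1 (pd1 u) z - 2 * pd1 u z * pd2 u z * pd2 (pd1 u) z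
      + (1 + pd1 u z ^ 2) * pd2 (pd2 u) z = 0) {A B D : ℝ}
    (hA : |deriv (deriv f) z.1 * g (u z)| ≤ A) (hB : |deriv f z.1 * deriv g (u z)| ≤ B)
    (hD : |f z.1 * deriv (deriv g) (u z)| ≤ D) :
    |gF u z * LF u Φ z| ≤ A + 2 * B + D := by
  rw [LF_eq h hf hg hΦ hm, abs_mul, abs_div, abs_of_pos (W_pos u z)]
  have hW := W_pos u z
  have h2 := W_sq u z
  set X := deriv (deriv f) z.1 * g (u z)
  set Y := deriv f z.1 * deriv g (u z)
  set Z := f z.1 * deriv (deriv g) (u z)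
  set p := pd1 u z
  set q := pd2 u z
  set W := Wg u z
  have hA0 := (abs_nonneg X).trans hA
  have hB0 := (abs_nonneg Y).trans hB
  have hD0 := (abs_nonneg Z).trans hD
  have hp : |p| ≤ W ^ 2 := by rw [h2, abs_le]; constructor <;> nlinarith
  have hnum : |(1 + q ^ 2) * X + 2 * Y * p + Z * (p ^ 2 + q ^ 2)| ≤ (A + 2 * B + D) * W ^ 2 := by
    have t1 : |(1 + q ^ 2) * X| ≤ W ^ 2 * A := by
      rw [abs_mul, abs_of_nonneg (by positivity : 0 ≤ 1 + q ^ 2)]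
      gcongr; rw [h2]; nlinarith
    have t2 : |2 * Y * p| ≤ 2 * B * W ^ 2 := by
      rw [abs_mul, abs_mul, abs_two]
      gcongr
    have t3 : |Z * (p ^ 2 + q ^ 2)| ≤ D * W ^ 2 := by
      rw [abs_mul, abs_of_nonneg (by positivity : 0 ≤ p ^ 2 + q ^ 2)]
      gcongr; rw [h2]; linarith
    calc _ ≤ |(1 + q ^ 2) * X| + |2 * Y * p| + |Z * (p ^ 2 + q ^ 2)| := abs_add_three _ _ _
      _ ≤ _ := by linarith
  calc _ ≤ W⁻¹ * ((A + 2 * B + D) * W ^ 2 / W) := by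
        gcongr; exact gF_bd u z
    _ = _ := by field_simp

lemma bump_bd {e : ℝ → ℝ} (he : ContDiff ℝ 2 e) (hc : HasCompactSupport e) :
    ∃ C : ℝ, ∀ x, |e x| ≤ C ∧ |deriv e x| ≤ C ∧ |deriv (deriv e) x| ≤ C := by
  obtain ⟨C0, h0⟩ := hc.exists_bound_of_continuous he.continuous
  obtain ⟨C1, h1⟩ := hc.deriv.exists_bound_of_continuous (he.continuous_deriv (by simp))
  obtain ⟨C2, h2⟩ := hc.deriv.deriv.exists_bound_of_continuous
    ((he.iterate_deriv' 1 1).continuous_deriv (by simp))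
  refine ⟨max C0 (max C1 C2), fun x => ⟨(h0 x).trans (by simp), (h1 x).trans (by simp),
    (h2 x).trans (by simp)⟩⟩

lemma scale1 (e : ℝ → ℝ) (c x : ℝ) : deriv (fun x => e (c * x)) x = c * deriv e (c * x) := by
  rw [deriv_comp_mul_left, smul_eq_mul]
lemma scale2 (e : ℝ → ℝ) (c x : ℝ) :
    deriv (deriv (fun x => e (c * x))) x = c * (c * deriv (deriv e) (c * x)) := by
  have : deriv (fun x => e (c * x)) = fun x => c * deriv e (c * x) := funext (scale1 e c)
  rw [this, deriv_const_mul_field']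
  show c * deriv (fun x => deriv e (c * x)) x = _
  rw [scale1]

lemma closedK {a R h : ℝ} {u : ℝ × ℝ → ℝ} (hR : 0 < R)
    (hc : ContinuousOn u (Ioi (0:ℝ) ×ˢ Ioo (0:ℝ) a))
    (h0 : ∀ x > (0:ℝ), Tendsto u (𝓝[Ioi (0:ℝ) ×ˢ Ioo (0:ℝ) a] (x, 0)) atTop)
    (h1 : ∀ x > (0:ℝ), Tendsto u (𝓝[Ioi (0:ℝ) ×ˢ Ioo (0:ℝ) a] (x, a)) atBot) :
    IsClosed {z : ℝ × ℝ | z ∈ Ioi (0:ℝ) ×ˢ Ioo (0:ℝ) a ∧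
      z ∈ Icc (R / 2) (5 * R / 2) ×ˢ Icc (0:ℝ) a ∧ |u z| ≤ h} := by
  refine isClosed_of_closure_subset fun z hz => ?_
  have hzS : z ∈ Icc (R / 2) (5 * R / 2) ×ˢ Icc (0:ℝ) a :=
    closure_minimal (fun w hw => hw.2.1) (isClosed_Icc.prod isClosed_Icc) hz
  rw [mem_closure_iff_frequently] at hz
  have hx : 0 < z.1 := lt_of_lt_of_le (by positivity) hzS.1.1
  have hy0 : z.2 ≠ 0 := by
    intro hy
    have := h0 z.1 hx
    have e : ((z.1, 0) : ℝ × ℝ) = z := by ext <;> simp [hy]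
    rw [e] at this
    have h3 := eventually_nhdsWithin_iff.1 (this.eventually_gt_atTop h)
    obtain ⟨w, hw1, hw2⟩ := (hz.and_eventually h3).exists
    have := hw2 hw1.1
    have := (abs_le.1 hw1.2.2).2
    linarith
  have hya : z.2 ≠ a := by
    intro hy
    have := h1 z.1 hx
    have e : ((z.1, a) : ℝ × ℝ) = z := by ext <;> simp [hy]
    rw [e] at this
    have h3 := eventually_nhdsWithin_iff.1 (this.eventually_lt_atBot (-h))
    obtain ⟨w, hw1, hw2⟩ := (hz.and_eventually h3).exists
    have := hw2 hw1.1
    have := (abs_le.1 hw1.2.2).1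
    linarith
  have hzΩ : z ∈ Ioi (0:ℝ) ×ˢ Ioo (0:ℝ) a :=
    ⟨hx, lt_of_le_of_ne hzS.2.1 (Ne.symm hy0), lt_of_le_of_ne hzS.2.2 hya⟩
  refine ⟨hzΩ, hzS, ?_⟩
  by_contra hcon
  push Not at hcon
  have hca : ContinuousAt u z := hc.continuousAt ((isOpen_Ioi.prod isOpen_Ioo).mem_nhds hzΩ)
  obtain ⟨w, hw1, hw2⟩ := (hz.and_eventually (hca.abs.eventually (lt_mem_nhds hcon))).exists
  exact absurd hw1.2.2 (not_le.2 hw2)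

lemma piece (e k : ℝ → ℝ) (he : ContDiff ℝ 2 e) (hk : ContDiff ℝ 2 k) {C : ℝ} (hC0 : 0 ≤ C)
    (heC : ∀ x, |e x| ≤ C ∧ |deriv e x| ≤ C ∧ |deriv (deriv e) x| ≤ C)
    (hkC : ∀ x, |k x| ≤ C ∧ |deriv k x| ≤ C ∧ |deriv (deriv k) x| ≤ C)
    (he0 : ∀ x, 0 ≤ e x) (hk0 : ∀ x, 0 ≤ k x)
    (he1 : ∀ x ∈ Icc (1:ℝ) 2, e x = 1) (hk1 : ∀ x ∈ Icc (-1:ℝ) 1, k x = 1)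
    (hes : ∀ x, e x ≠ 0 → x ∈ Icc (1/2 : ℝ) (5/2)) (hks : ∀ x, k x ≠ 0 → |x| ≤ 2)
    {a : ℝ} (ha : 0 < a) {u : ℝ × ℝ → ℝ} (hu : IsMSE u (Ioi (0:ℝ) ×ˢ Ioo (0:ℝ) a))
    (h0 : ∀ x > (0:ℝ), Tendsto u (𝓝[Ioi (0:ℝ) ×ˢ Ioo (0:ℝ) a] (x, 0)) atTop)
    (h1 : ∀ x > (0:ℝ), Tendsto u (𝓝[Ioi (0:ℝ) ×ˢ Ioo (0:ℝ) a] (x, a)) atBot)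
    {R h : ℝ} (hR : 0 < R) (hh : R ≤ h) :
    ∫⁻ z in {z : ℝ × ℝ | z ∈ Icc R (2 * R) ×ˢ Ioo (0:ℝ) a ∧ |u z| ≤ h}, ENNReal.ofReal |JF u z| ≤
      ENNReal.ofReal (8 * C ^ 2 * a / R) := by
  set Ω : Set (ℝ × ℝ) := Ioi (0:ℝ) ×ˢ Ioo (0:ℝ) a with hΩd
  have hh0 : 0 < h := hR.trans_le hh
  have hΩ : IsOpen Ω := isOpen_Ioi.prod isOpen_Ioo
  set f : ℝ → ℝ := fun x => e (R⁻¹ * x) with hf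
  set g : ℝ → ℝ := fun x => k (h⁻¹ * x) with hg
  have hfd : ContDiff ℝ 2 f := he.comp (by fun_prop)
  have hgd : ContDiff ℝ 2 g := hk.comp (by fun_prop)
  set Φ : ℝ × ℝ → ℝ := Ω.indicator (fun w => f w.1 * g (u w)) with hΦd
  set S : Set (ℝ × ℝ) := Icc (R / 2) (5 * R / 2) ×ˢ Icc (0:ℝ) a with hS
  have hSc : IsCompact S := isCompact_Icc.prod isCompact_Icc
  have hcl := closedK (h := 2 * h) hR hu.1.continuousOn h0 h1
  have hsup : tsupport Φ ⊆ {z : ℝ × ℝ | z ∈ Ω ∧ z ∈ S ∧ |u z| ≤ 2 * h} := by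
    refine closure_minimal (fun z hz => ?_) hcl
    rw [Function.mem_support] at hz
    have hzΩ : z ∈ Ω := by
      by_contra hn
      exact hz (indicator_of_notMem hn _)
    have hv : Φ z = f z.1 * g (u z) := indicator_of_mem hzΩ _
    rw [hv] at hz
    have hx := hes _ (left_ne_zero_of_mul hz)
    have hy := hks _ (right_ne_zero_of_mul hz)
    refine ⟨hzΩ, ⟨⟨?_, ?_⟩, hzΩ.2.1.le, hzΩ.2.2.le⟩, ?_⟩
    · have := hx.1
      rw [inv_mul_eq_div, le_div_iff₀ hR] at this
      linarith
    · have := hx.2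
      rw [inv_mul_eq_div, div_le_iff₀ hR] at this
      linarith
    · rw [inv_mul_eq_div, abs_div, abs_of_pos hh0, div_le_iff₀ hh0] at hy
      exact hy
  have hsΩ : tsupport Φ ⊆ Ω := fun z hz => (hsup hz).1
  have hsS : tsupport Φ ⊆ S := fun z hz => (hsup hz).2.1
  have hcs : HasCompactSupport Φ := hSc.of_isClosed_subset isClosed_closure hsS
  have hu2 : ∀ z ∈ Ω, ContDiffAt ℝ 2 u z := fun z hz => hu.1.contDiffAt (hΩ.mem_nhds hz)
  have hev : ∀ z ∈ Ω, Φ =ᶠ[𝓝 z] fun w => f w.1 * g (u w) := by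
    intro z hz
    filter_upwards [hΩ.mem_nhds hz] with w hw
    exact indicator_of_mem hw _
  have hΦ : ContDiff ℝ 2 Φ := cd_of_tsupport fun z hz => by
    refine ContDiffAt.congr_of_eventuallyEq ?_ (hev z (hsΩ hz))
    exact (hfd.contDiffAt.comp z contDiffAt_fst).mul (hgd.contDiffAt.comp z (hu2 z (hsΩ hz)))
  have hΦ0 : ∀ z, 0 ≤ Φ z := fun z =>
    indicator_nonneg (fun w _ => mul_nonneg (he0 _) (hk0 _)) z
  have hcore := core hΩ hu hΦ hcs hsΩ
  have hintg := JF_int hu2 hΦ.continuous hcs hsΩ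
  -- bound of the right-hand side
  have hRh : h⁻¹ ≤ R⁻¹ := inv_anti₀ hR hh
  have hRi : 0 < R⁻¹ := by positivity
  have hhi : 0 < h⁻¹ := by positivity
  have hb : ∀ z ∈ S, ‖gF u z * LF u Φ z‖ ≤ 4 * C ^ 2 * R⁻¹ ^ 2 := by
    intro z _
    rw [Real.norm_eq_abs]
    by_cases hz : z ∈ tsupport Φ
    · have hzΩ := hsΩ hz
      have := gL_bd (A := C ^ 2 * R⁻¹ ^ 2) (B := C ^ 2 * R⁻¹ ^ 2) (D := C ^ 2 * R⁻¹ ^ 2)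
        (hu2 z hzΩ) hfd hgd (hev z hzΩ) (hu.2 z hzΩ) (by
          rw [hf, scale2, abs_mul, abs_mul, abs_mul, abs_of_pos hRi]
          calc _ ≤ R⁻¹ * (R⁻¹ * C) * C := by
                gcongr
                · exact (heC _).2.2
                · exact (hkC _).1
            _ = _ := by ring) (by
          rw [hf, hg, scale1, scale1, abs_mul, abs_mul, abs_mul, abs_of_pos hRi, abs_of_pos hhi]
          calc _ ≤ R⁻¹ * C * (R⁻¹ * C) := by
                gcongr
                · exact (heC _).2.1
                · exact (hkC _).2.1
            _ = _ := by ring) (by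
          rw [hg, scale2, abs_mul, abs_mul, abs_mul, abs_of_pos hhi]
          calc _ ≤ C * (R⁻¹ * (R⁻¹ * C)) := by
                gcongr
                · exact (heC _).1
                · exact (hkC _).2.2
            _ = _ := by ring)
      linarith
    · have n1 : z ∉ tsupport (pd1 Φ) := fun h => hz (tsupport_pd1 _ h)
      have n2 : z ∉ tsupport (pd2 Φ) := fun h => hz (tsupport_pd2 _ h)
      simp [LF, pd1_off n1, pd2_off n1, pd2_off n2]
      positivity
  have hvol : volume.real S = 2 * R * a := by
    rw [hS, Measure.real, Measure.volume_eq_prod, Measure.prod_prod, Real.volume_Icc,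
      Real.volume_Icc, ENNReal.toReal_mul, ENNReal.toReal_ofReal (by linarith),
      ENNReal.toReal_ofReal (by linarith)]
    ring
  have hfin := norm_setIntegral_le_of_norm_le_const (μ := volume) hSc.measure_lt_top hb
  rw [setIntegral_eq_integral_of_forall_compl_eq_zero (fun z hz => by
    have hz' : z ∉ tsupport Φ := fun h => hz (hsS h)
    have n1 : z ∉ tsupport (pd1 Φ) := fun h => hz' (tsupport_pd1 _ h)
    have n2 : z ∉ tsupport (pd2 Φ) := fun h => hz' (tsupport_pd2 _ h)
    simp [LF, pd1_off n1, pd2_off n1, pd2_off n2]), hvol, ← hcore, Real.norm_eq_abs] at hfin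
  have hneg : ∀ z, 0 ≤ -(Φ z * JF u z) := by
    intro z
    by_cases hz : z ∈ Ω
    · have := J_nonpos (hu.2 z hz)
      have := hΦ0 z
      nlinarith
    · have : Φ z = 0 := indicator_of_notMem hz _
      simp [this]
  calc _ ≤ ∫⁻ z in {z : ℝ × ℝ | z ∈ Icc R (2 * R) ×ˢ Ioo (0:ℝ) a ∧ |u z| ≤ h},
        ENNReal.ofReal (-(Φ z * JF u z)) := by
        refine setLIntegral_mono' ?_ ?_
        · have hcl1 := closedK (h := h) hR hu.1.continuousOn h0 h1
          have hc2 : IsClosed {z : ℝ × ℝ | z.1 ∈ Icc R (2 * R)} :=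
            isClosed_Icc.preimage continuous_fst
          have hEq : {z : ℝ × ℝ | z ∈ Icc R (2 * R) ×ˢ Ioo (0:ℝ) a ∧ |u z| ≤ h} =
              {z : ℝ × ℝ | z ∈ Ioi (0:ℝ) ×ˢ Ioo (0:ℝ) a ∧
                z ∈ Icc (R / 2) (5 * R / 2) ×ˢ Icc (0:ℝ) a ∧ |u z| ≤ h} ∩
              {z : ℝ × ℝ | z.1 ∈ Icc R (2 * R)} := by
            ext z
            constructor
            · rintro ⟨⟨⟨hx1, hx2⟩, hy⟩, hz⟩
              exact ⟨⟨⟨hR.trans_le hx1, hy⟩,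
                ⟨⟨by linarith, by linarith⟩, hy.1.le, hy.2.le⟩, hz⟩, hx1, hx2⟩
            · rintro ⟨⟨hΩz, -, hz⟩, hx⟩
              exact ⟨⟨hx, hΩz.2⟩, hz⟩
          rw [hEq]
          exact (hcl1.inter hc2).measurableSet
        · rintro z ⟨⟨⟨hx1, hx2⟩, hy⟩, hz⟩
          have hzΩ : z ∈ Ω := ⟨hR.trans_le hx1, hy⟩
          have e1 : f z.1 = 1 := he1 _ ⟨by
            rw [inv_mul_eq_div, le_div_iff₀ hR]; linarith, by
            rw [inv_mul_eq_div, div_le_iff₀ hR]; linarith⟩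
          have e2 : g (u z) = 1 := hk1 _ (abs_le.1 (by
            rw [inv_mul_eq_div, abs_div, abs_of_pos hh0, div_le_iff₀ hh0]; linarith))
          have e3 : Φ z = 1 := by
            have : Φ z = f z.1 * g (u z) := indicator_of_mem hzΩ _
            rw [this, e1, e2, one_mul]
          rw [e3, one_mul, abs_of_nonpos (J_nonpos (hu.2 z hzΩ))]
    _ ≤ ∫⁻ z, ENNReal.ofReal (-(Φ z * JF u z)) := setLIntegral_le_lintegral _ _
    _ = ENNReal.ofReal (∫ z, -(Φ z * JF u z)) :=
        (ofReal_integral_eq_lintegral_ofReal hintg.neg (Eventually.of_forall hneg)).symm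
    _ ≤ _ := by
        apply ENNReal.ofReal_le_ofReal
        rw [integral_neg]
        refine (neg_le_abs _).trans (hfin.trans (le_of_eq ?_))
        field_simp
        ring

end HS

/-- Finite total curvature in a half-strip: there is a universal constant `c > 0` such
that if `u` solves the minimal surfaces equation on `S = (0,∞) × (0,a)` with boundary
values `+∞` on `(0,∞) × {0}` and `−∞` on `(0,∞) × {a}`, then for every `x₀ > 0` the
total Gauss curvature of the graph of `u` over `S′ = S ∩ {x ≥ x₀}`, namely
`∫∫_{S′} |rt − s²|/W³ dx dy`, is at most `c·a/x₀` (in particular finite). -/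
theorem halfstrip_finite_total_curvature :
    ∃ c > (0:ℝ), ∀ a > (0:ℝ), ∀ u : ℝ × ℝ → ℝ,
      IsMSE u (Ioi (0:ℝ) ×ˢ Ioo (0:ℝ) a) →
      (∀ x > (0:ℝ), Tendsto u (𝓝[Ioi (0:ℝ) ×ˢ Ioo (0:ℝ) a] (x, 0)) atTop) →
      (∀ x > (0:ℝ), Tendsto u (𝓝[Ioi (0:ℝ) ×ˢ Ioo (0:ℝ) a] (x, a)) atBot) →
      ∀ x₀ > (0:ℝ),
        (∫⁻ z in {z : ℝ × ℝ | z ∈ Ioi (0:ℝ) ×ˢ Ioo (0:ℝ) a ∧ x₀ ≤ z.1},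
            ENNReal.ofReal
              (|pd1 (pd1 u) z * pd2 (pd2 u) z - pd2 (pd1 u) z ^ 2| / Wg u z ^ 3)) ≤
          ENNReal.ofReal (c * a / x₀) := by
  let eb : ContDiffBump (3 / 2 : ℝ) := ⟨1 / 2, 1, by norm_num, by norm_num⟩
  let kb : ContDiffBump (0 : ℝ) := ⟨1, 2, by norm_num, by norm_num⟩
  have he : ContDiff ℝ 2 (eb : ℝ → ℝ) := eb.contDiff
  have hk : ContDiff ℝ 2 (kb : ℝ → ℝ) := kb.contDiff
  obtain ⟨C1, hC1⟩ := HS.bump_bd he eb.hasCompactSupport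
  obtain ⟨C2, hC2⟩ := HS.bump_bd hk kb.hasCompactSupport
  set C : ℝ := max 1 (max C1 C2) with hC
  have hC0 : 0 < C := lt_of_lt_of_le one_pos (le_max_left _ _)
  have h1C : C1 ≤ C := by simp [hC]
  have h2C : C2 ≤ C := by simp [hC]
  refine ⟨16 * C ^ 2, by positivity, ?_⟩
  intro a ha u hu h0 h1 x₀ hx₀
  have step : ∀ R > (0:ℝ), ∫⁻ z in Icc R (2 * R) ×ˢ Ioo (0:ℝ) a, ENNReal.ofReal |HS.JF u z| ≤
      ENNReal.ofReal (8 * C ^ 2 * a / R) := by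
    intro R hR
    have hun : Icc R (2 * R) ×ˢ Ioo (0:ℝ) a =
        ⋃ n : ℕ, {z : ℝ × ℝ | z ∈ Icc R (2 * R) ×ˢ Ioo (0:ℝ) a ∧ |u z| ≤ R + n} := by
      ext z
      simp only [mem_iUnion, mem_setOf_eq, exists_and_left]
      refine ⟨fun hz => ⟨hz, ?_⟩, fun hz => hz.1⟩
      obtain ⟨n, hn⟩ := exists_nat_ge |u z|
      exact ⟨n, by linarith⟩
    rw [hun, setLIntegral_iUnion_of_directed]
    · refine iSup_le fun n => ?_
      refine HS.piece eb kb he hk hC0.le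
        (fun x => ⟨(hC1 x).1.trans h1C, (hC1 x).2.1.trans h1C, (hC1 x).2.2.trans h1C⟩)
        (fun x => ⟨(hC2 x).1.trans h2C, (hC2 x).2.1.trans h2C, (hC2 x).2.2.trans h2C⟩)
        (fun x => eb.nonneg) (fun x => kb.nonneg) ?_ ?_ ?_ ?_ ha hu h0 h1 hR (by simp)
      · intro x hx
        refine eb.one_of_mem_closedBall ?_
        rw [Real.closedBall_eq_Icc]
        constructor <;> simp only [eb] <;> linarith [hx.1, hx.2]
      · intro x hx
        refine kb.one_of_mem_closedBall ?_
        rw [Real.closedBall_eq_Icc]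
        constructor <;> simp only [kb] <;> linarith [hx.1, hx.2]
      · intro x hx
        have : x ∈ Function.support eb := hx
        rw [eb.support_eq, Real.ball_eq_Ioo] at this
        simp only [eb] at this
        constructor <;> linarith [this.1, this.2]
      · intro x hx
        have : x ∈ Function.support kb := hx
        rw [kb.support_eq, Real.ball_eq_Ioo] at this
        simp only [kb] at this
        rw [abs_le]
        constructor <;> linarith [this.1, this.2]
    · refine directed_of_isDirected_le ?_
      rintro m n hmn z ⟨hz1, hz2⟩
      have : (m : ℝ) ≤ n := by exact_mod_cast hmn
      exact ⟨hz1, by linarith⟩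
  have hcov : {z : ℝ × ℝ | z ∈ Ioi (0:ℝ) ×ˢ Ioo (0:ℝ) a ∧ x₀ ≤ z.1} ⊆
      ⋃ n : ℕ, Icc (x₀ * 2 ^ n) (2 * (x₀ * 2 ^ n)) ×ˢ Ioo (0:ℝ) a := by
    rintro z ⟨hz, hx⟩
    obtain ⟨n, hn1, hn2⟩ := exists_nat_pow_near (x := z.1 / x₀) (y := 2)
      (by rw [le_div_iff₀ hx₀]; linarith) (by norm_num)
    rw [le_div_iff₀ hx₀] at hn1
    rw [div_lt_iff₀ hx₀, pow_succ] at hn2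
    refine mem_iUnion.2 ⟨n, ⟨by linarith, by linarith⟩, hz.2⟩
  have hJ : ∀ z, |pd1 (pd1 u) z * pd2 (pd2 u) z - pd2 (pd1 u) z ^ 2| / Wg u z ^ 3 = |HS.JF u z| := by
    intro z
    have := HS.W_pos u z
    rw [HS.JF, abs_div, abs_of_pos (by positivity : 0 < Wg u z ^ 3)]
  simp_rw [hJ]
  have hsum : HasSum (fun n : ℕ => 8 * C ^ 2 * a / (x₀ * 2 ^ n)) (16 * C ^ 2 * a / x₀) := by
    have e1 : (fun n : ℕ => 8 * C ^ 2 * a / (x₀ * 2 ^ n)) =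
        fun n : ℕ => 8 * C ^ 2 * a / x₀ * (1 / 2) ^ n := by
      ext n
      rw [one_div, inv_pow]
      field_simp
    have e2 : 16 * C ^ 2 * a / x₀ = 8 * C ^ 2 * a / x₀ * 2 := by ring
    rw [e1, e2]
    exact hasSum_geometric_two.mul_left _
  calc _ ≤ ∫⁻ z in ⋃ n : ℕ, Icc (x₀ * 2 ^ n) (2 * (x₀ * 2 ^ n)) ×ˢ Ioo (0:ℝ) a,
        ENNReal.ofReal |HS.JF u z| := lintegral_mono_set hcov
    _ ≤ ∑' n : ℕ, ∫⁻ z in Icc (x₀ * 2 ^ n) (2 * (x₀ * 2 ^ n)) ×ˢ Ioo (0:ℝ) a,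
        ENNReal.ofReal |HS.JF u z| := lintegral_iUnion_le _ _
    _ ≤ ∑' n : ℕ, ENNReal.ofReal (8 * C ^ 2 * a / (x₀ * 2 ^ n)) :=
        ENNReal.tsum_le_tsum fun n => step _ (by positivity)
    _ = ENNReal.ofReal (16 * C ^ 2 * a / x₀) := by
        rw [← ENNReal.ofReal_tsum_of_nonneg (fun n => by positivity) hsum.summable, hsum.tsum_eq]
end

section
/- Let U ⊂ ℂ be a simply connected open set and f : U → D = {z ∈ ℂ : |z| < 1} a biholomorphic map. Say a point P ∈ ∂U has the property of Schönflies if for every R > 0 there exists r > 0 such that any two points of U ∩ D(P,r) can be joined by a path contained in U ∩ D(P,R). Let V be a subset of ∂U, open in ∂U, every point of which has the property of Schönflies. Then f extends to a homeomorphism from U ∪ V onto D ∪ C, where C is a subset of the boundary circle ∂D. -/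
open Metric Set

/-- The point `P` of the boundary of `U` has the property of Schönflies: for every
`R > 0` there is `r > 0` such that any two points of `U ∩ D(P,r)` can be joined by a
path in `U ∩ D(P,R)`. -/
def SchoenfliesAt (U : Set ℂ) (P : ℂ) : Prop :=
  ∀ R > (0:ℝ), ∃ r > (0:ℝ), ∀ x ∈ U ∩ ball P r, ∀ y ∈ U ∩ ball P r,
    JoinedIn (U ∩ ball P R) x y

open MeasureTheory Filter Topology in
lemma area_eq (Ω : Set ℂ) (hΩ : IsOpen Ω) (φ : ℂ → ℂ) (hφ : DifferentiableOn ℂ φ Ω)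
    (hinj : InjOn φ Ω) :
    ∫⁻ z in Ω, ENNReal.ofReal (‖deriv φ z‖ ^ 2) = volume (φ '' Ω) := by
  rw [← lintegral_abs_det_fderiv_eq_addHaar_image volume hΩ.measurableSet
    (f' := fun z => deriv φ z • (1 : ℂ →L[ℝ] ℂ)) ?_ hinj]
  · congr 1
    ext z
    congr 1
    have : (deriv φ z • (1 : ℂ →L[ℝ] ℂ)).det = ‖deriv φ z‖ ^ 2 := by
      rw [ContinuousLinearMap.det, ← LinearMap.det_toMatrix Complex.basisOneI,
        Matrix.det_fin_two]
      simp [LinearMap.toMatrix_apply, Complex.coe_basisOneI_repr, Complex.sq_norm, Complex.normSq_apply]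
    rw [this, abs_of_nonneg (by positivity)]
  · intro z hz
    exact ((hφ.differentiableAt (hΩ.mem_nhds hz)).hasDerivAt.complexToReal_fderiv).hasFDerivWithinAt

open MeasureTheory Filter Topology in
lemma lintegral_inv_top (R δ : ℝ) (hR : 0 < R) (hδ : 0 < δ) :
    ∫⁻ ρ in Ioo 0 R, ENNReal.ofReal (δ / ρ) = ⊤ := by
  by_contra h
  have hi : IntegrableOn (fun ρ : ℝ => δ / ρ) (Ioo 0 R) := by
    refine ⟨by fun_prop, ?_⟩
    rw [hasFiniteIntegral_iff_ofReal]
    · exact lt_top_iff_ne_top.2 h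
    · filter_upwards [ae_restrict_mem measurableSet_Ioo] with x hx
      exact (div_pos hδ hx.1).le
  have h2 : IntervalIntegrable (fun x : ℝ => x⁻¹) volume 0 R := by
    rw [intervalIntegrable_iff_integrableOn_Ioo_of_le hR.le]
    refine (hi.const_mul δ⁻¹).congr (Filter.Eventually.of_forall fun x => ?_)
    simp only
    field_simp
  rw [intervalIntegrable_inv_iff] at h2
  rcases h2 with h2 | h2
  · exact hR.ne h2
  · exact h2 left_mem_uIcc

open MeasureTheory Filter Topology in
lemma exists_radius (Ω : Set ℂ) (hΩ : IsOpen Ω) (φ : ℂ → ℂ) (hφ : DifferentiableOn ℂ φ Ω)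
    (hinj : InjOn φ Ω) (hvol : volume (φ '' Ω) ≠ ⊤) (P : ℂ) (R δ : ℝ) (hR : 0 < R) (hδ : 0 < δ) :
    ∃ ρ ∈ Ioo 0 R, ENNReal.ofReal (ρ ^ 2) * (∫⁻ θ in Ioo (-Real.pi) Real.pi,
      Ω.indicator (fun z => ENNReal.ofReal (‖deriv φ z‖ ^ 2)) (circleMap P ρ θ)) ≤
        ENNReal.ofReal δ := by
  by_contra! hcon
  apply hvol
  set I : ℂ → ENNReal := Ω.indicator (fun z => ENNReal.ofReal (‖deriv φ z‖ ^ 2)) with hI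
  have hIm : Measurable I :=
    Measurable.indicator (((measurable_deriv φ).norm.pow_const 2).ennreal_ofReal) hΩ.measurableSet
  have h1 : volume (φ '' Ω) = ∫⁻ z, I (P + z) := by
    rw [lintegral_add_left_eq_self I P, hI, lintegral_indicator hΩ.measurableSet,
      area_eq Ω hΩ φ hφ hinj]
  rw [h1, ← Complex.lintegral_comp_polarCoord_symm]
  have htar : polarCoord.target = Ioi (0:ℝ) ×ˢ Ioo (-Real.pi) Real.pi := rfl
  have hcm : ∀ p : ℝ × ℝ, P + Complex.polarCoord.symm p = circleMap P p.1 p.2 := by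
    intro p
    rw [Complex.polarCoord_symm_apply, circleMap, Complex.exp_mul_I]
    simp
  simp_rw [hcm]
  have hmeas : Measurable (fun p : ℝ × ℝ => ENNReal.ofReal p.1 • I (circleMap P p.1 p.2)) := by
    have : Measurable (fun p : ℝ × ℝ => circleMap P p.1 p.2) := by
      unfold circleMap; fun_prop
    exact (measurable_fst.ennreal_ofReal).mul (hIm.comp this)
  rw [htar, Measure.volume_eq_prod, setLIntegral_prod _ hmeas.aemeasurable, eq_top_iff,
    ← lintegral_inv_top R δ hR hδ]
  refine (setLIntegral_mono' measurableSet_Ioo ?_).trans (lintegral_mono_set Ioo_subset_Ioi_self)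
  intro ρ hρ
  have h2 := (hcon ρ hρ).le
  simp only [smul_eq_mul]
  rw [lintegral_const_mul' _ _ ENNReal.ofReal_ne_top]
  rw [ENNReal.ofReal_div_of_pos hρ.1]
  refine ENNReal.div_le_of_le_mul' ?_
  rwa [← mul_assoc, ← ENNReal.ofReal_mul hρ.1.le, ← sq]
  
open MeasureTheory Filter Topology in
lemma length_area (Ω : Set ℂ) (hΩ : IsOpen Ω) (φ : ℂ → ℂ) (hφ : DifferentiableOn ℂ φ Ω)
    (hinj : InjOn φ Ω) (hvol : volume (φ '' Ω) ≠ ⊤) (P : ℂ) (R η : ℝ) (hR : 0 < R) (hη : 0 < η) :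
    ∃ ρ ∈ Ioo 0 R, ∀ (h : ℂ → ℝ) (A : Set ℂ) (K : NNReal), IsOpen A → φ '' (Ω ∩ sphere P ρ) ⊆ A →
      DifferentiableOn ℝ h A → LipschitzOnWith K h A →
      volume (h '' (φ '' (Ω ∩ sphere P ρ))) ≤ K * ENNReal.ofReal η := by
  set η' := η / 8 with hη'
  have hη'p : 0 < η' := by positivity
  obtain ⟨ρ, hρ, hG⟩ := exists_radius Ω hΩ φ hφ hinj hvol P R (η' ^ 2) hR (by positivity)
  refine ⟨ρ, hρ, fun h A K hA hsub hd hL => ?_⟩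
  set T : Set ℝ := Ioc (-Real.pi) Real.pi ∩ (circleMap P ρ) ⁻¹' Ω with hT
  have hTm : MeasurableSet T :=
    measurableSet_Ioc.inter ((continuous_circleMap P ρ).measurable hΩ.measurableSet)
  have him : h '' (φ '' (Ω ∩ sphere P ρ)) = (fun θ => h (φ (circleMap P ρ θ))) '' T := by
    have : Ω ∩ sphere P ρ = circleMap P ρ '' T := by
      rw [hT, image_inter_preimage, inter_comm]
      congr 1
      have h1 := (periodic_circleMap P ρ).image_Ioc Real.two_pi_pos (-Real.pi)
      rw [range_circleMap, abs_of_pos hρ.1] at h1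
      rw [← h1]
      congr 2
      ring
    rw [this, image_image, image_image]
  rw [him]
  set D : ℝ → ℝ := fun θ => fderiv ℝ h (φ (circleMap P ρ θ))
    (deriv φ (circleMap P ρ θ) * (circleMap 0 ρ θ * Complex.I)) with hD
  have hder : ∀ θ ∈ T, HasDerivAt (fun θ => h (φ (circleMap P ρ θ))) (D θ) θ := by
    intro θ hθ
    have hz : circleMap P ρ θ ∈ Ω := hθ.2
    have hzA : φ (circleMap P ρ θ) ∈ A :=
      hsub (mem_image_of_mem _ ⟨hz, circleMap_mem_sphere _ hρ.1.le _⟩)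
    have h1 := (hφ.differentiableAt (hΩ.mem_nhds hz)).hasDerivAt
    have h2 := (hd.differentiableAt (hA.mem_nhds hzA)).hasFDerivAt
    have h3 := h1.comp θ (hasDerivAt_circleMap P ρ θ)
    exact h2.comp_hasDerivAt θ h3
  have hbd : ∀ θ ∈ T, |D θ| ≤ K * (ρ * ‖deriv φ (circleMap P ρ θ)‖) := by
    intro θ hθ
    have hz : circleMap P ρ θ ∈ Ω := hθ.2
    have hzA : φ (circleMap P ρ θ) ∈ A :=
      hsub (mem_image_of_mem _ ⟨hz, circleMap_mem_sphere _ hρ.1.le _⟩)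
    have h1 := norm_fderiv_le_of_lipschitzOn ℝ (hA.mem_nhds hzA) hL
    have h2 := ContinuousLinearMap.le_of_opNorm_le _ h1
      (deriv φ (circleMap P ρ θ) * (circleMap 0 ρ θ * Complex.I))
    simp only [norm_mul, norm_circleMap_zero, Complex.norm_I, abs_of_pos hρ.1, mul_one] at h2
    rw [mul_comm ρ]
    exact h2
  have h1 := addHaar_image_le_lintegral_abs_det_fderiv volume hTm
    (fun θ hθ => (hder θ hθ).hasFDerivAt.hasFDerivWithinAt)
  refine h1.trans ?_
  simp only [ContinuousLinearMap.det_toSpanSingleton]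
  set J : ℝ → ENNReal := fun θ => 
    Ω.indicator (fun z => ENNReal.ofReal (‖deriv φ z‖ ^ 2)) (circleMap P ρ θ) with hJ
  have hptw : ∀ θ ∈ T, ENNReal.ofReal |D θ| ≤
      K * (ENNReal.ofReal η' + ENNReal.ofReal (η'⁻¹) * (ENNReal.ofReal (ρ ^ 2) * J θ)) := by
    intro θ hθ
    have hz : circleMap P ρ θ ∈ Ω := hθ.2
    rw [hJ]
    simp only [indicator_of_mem hz]
    rw [← ENNReal.ofReal_mul (by positivity), ← ENNReal.ofReal_mul (by positivity),
      ← ENNReal.ofReal_add (by positivity) (by positivity), ← ENNReal.ofReal_coe_nnreal,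
      ← ENNReal.ofReal_mul (by positivity)]
    apply ENNReal.ofReal_le_ofReal
    refine (hbd θ hθ).trans ?_
    gcongr
    set x := ‖deriv φ (circleMap P ρ θ)‖
    rw [← sub_nonneg]
    have : η' + η'⁻¹ * (ρ ^ 2 * x ^ 2) - ρ * x = η'⁻¹ * ((η' - ρ * x / 2) ^ 2 + 3 / 4 * (ρ * x) ^ 2) := by
      field_simp
      ring
    rw [this]
    positivity
  calc ∫⁻ θ in T, ENNReal.ofReal |D θ| 
      ≤ ∫⁻ θ in T, K * (ENNReal.ofReal η' + ENNReal.ofReal (η'⁻¹) * (ENNReal.ofReal (ρ ^ 2) * J θ)) :=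
        setLIntegral_mono' hTm hptw
    _ ≤ ∫⁻ θ in Ioc (-Real.pi) Real.pi,
          K * (ENNReal.ofReal η' + ENNReal.ofReal (η'⁻¹) * (ENNReal.ofReal (ρ ^ 2) * J θ)) :=
        lintegral_mono_set inter_subset_left
    _ = ∫⁻ θ in Ioo (-Real.pi) Real.pi,
          K * (ENNReal.ofReal η' + ENNReal.ofReal (η'⁻¹) * (ENNReal.ofReal (ρ ^ 2) * J θ)) := by
        rw [restrict_Ioo_eq_restrict_Ioc]
    _ = K * (ENNReal.ofReal η' * ENNReal.ofReal (2 * Real.pi) + ENNReal.ofReal (η'⁻¹) *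
          (ENNReal.ofReal (ρ ^ 2) * ∫⁻ θ in Ioo (-Real.pi) Real.pi, J θ)) := by
        rw [lintegral_const_mul' _ _ ENNReal.coe_ne_top, lintegral_add_left measurable_const,
          lintegral_const_mul' _ _ ENNReal.ofReal_ne_top,
          lintegral_const_mul' _ _ ENNReal.ofReal_ne_top, setLIntegral_const, Real.volume_Ioo]
        congr 5
        ring
    _ ≤ K * (ENNReal.ofReal η' * ENNReal.ofReal (2 * Real.pi) + ENNReal.ofReal (η'⁻¹) *
          ENNReal.ofReal (η' ^ 2)) := by gcongr
    _ ≤ K * ENNReal.ofReal η := by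
        gcongr
        rw [← ENNReal.ofReal_mul (by positivity), ← ENNReal.ofReal_mul (by positivity),
          ← ENNReal.ofReal_add (by positivity) (by positivity)]
        apply ENNReal.ofReal_le_ofReal
        have : η'⁻¹ * η' ^ 2 = η' := by field_simp
        rw [this]
        have := Real.pi_lt_d2
        have : η = 8 * η' := by rw [hη']; ring
        rw [this]
        nlinarith

/-- A biholomorphic map `f` of `U` onto the unit disk with inverse `g`. -/
structure BiD (U : Set ℂ) (f g : ℂ → ℂ) : Prop where
  ho : IsOpen U
  df : DifferentiableOn ℂ f U
  dg : DifferentiableOn ℂ g (ball 0 1)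
  mf : MapsTo f U (ball 0 1)
  mg : MapsTo g (ball 0 1) U
  gf : ∀ z ∈ U, g (f z) = z
  fg : ∀ w ∈ ball (0:ℂ) 1, f (g w) = w

open Filter Topology in
lemma exists_biD (U : Set ℂ) (hUo : IsOpen U) (f : ℂ → ℂ) (hf : DifferentiableOn ℂ f U)
    (hbij : BijOn f U (ball (0:ℂ) 1)) : ∃ g, BiD U f g := by
  set g := Function.invFunOn f U with hg
  have hgf : ∀ z ∈ U, g (f z) = z := fun z hz => hbij.injOn.leftInvOn_invFunOn hz
  have hmg : MapsTo g (ball 0 1) U := hbij.surjOn.mapsTo_invFunOn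
  have hfg : ∀ w ∈ ball (0:ℂ) 1, f (g w) = w := fun w hw => hbij.surjOn.rightInvOn_invFunOn hw
  have han : ∀ z ∈ U, AnalyticAt ℂ f z := fun z hz => hf.analyticAt (hUo.mem_nhds hz)
  have hnc : ∀ z ∈ U, ¬ ∀ᶠ y in 𝓝 z, f y = f z := by
    intro z hz h
    have h2 : ∀ᶠ y in 𝓝 z, y = z := by
      filter_upwards [h, hUo.mem_nhds hz] with y hy hyU
      exact hbij.injOn hyU hz hy
    have h3 : ∀ᶠ y in 𝓝[≠] z, y = z := h2.filter_mono nhdsWithin_le_nhds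
    have h4 : ∀ᶠ y in 𝓝[≠] z, y ≠ z := self_mem_nhdsWithin
    obtain ⟨y, hy, hy'⟩ := (h3.and h4).exists
    exact hy' hy
  have hcont : ∀ w ∈ ball (0:ℂ) 1, ContinuousAt g w := by
    intro w hw
    have hz := hmg hw
    rcases (han _ hz).eventually_constant_or_nhds_le_map_nhds with h | h
    · exact absurd h (hnc _ hz)
    · rw [hfg w hw] at h
      have h2 : Tendsto g (map f (𝓝 (g w))) (𝓝 (g w)) := by
        rw [tendsto_map'_iff]
        refine tendsto_id.congr' ?_
        filter_upwards [hUo.mem_nhds hz] with y hy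
        exact (hgf y hy).symm
      exact h2.mono_left h
  refine ⟨g, hUo, hf, ?_, hbij.mapsTo, hmg, hgf, hfg⟩
  intro w hw
  refine (Complex.analyticAt_of_differentiable_on_punctured_nhds_of_continuousAt ?_
    (hcont w hw)).differentiableAt.differentiableWithinAt
  have hz := hmg hw
  have hda : AnalyticAt ℂ (deriv f) (g w) := (han _ hz).deriv
  have hne : ∀ᶠ z in 𝓝[≠] (g w), deriv f z ≠ 0 := by
    rcases hda.eventually_eq_zero_or_eventually_ne_zero with h | h
    · exfalso
      obtain ⟨r, hr, hb⟩ := Metric.mem_nhds_iff.1 (h.and (hUo.mem_nhds hz))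
      apply hnc _ hz
      filter_upwards [ball_mem_nhds (g w) hr] with y hy
      exact isOpen_ball.is_const_of_deriv_eq_zero (convex_ball (g w) r).isPreconnected
        (hf.mono fun x hx => (hb hx).2) (fun x hx => (hb hx).1) hy (mem_ball_self hr)
    · exact h
  have htend : Tendsto g (𝓝[≠] w) (𝓝[≠] (g w)) := by
    refine tendsto_nhdsWithin_iff.2 ⟨(hcont w hw).mono_left nhdsWithin_le_nhds, ?_⟩
    filter_upwards [self_mem_nhdsWithin,
      mem_nhdsWithin_of_mem_nhds (isOpen_ball.mem_nhds hw)] with y hy hyD h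
    apply hy
    have := congrArg f h
    rwa [hfg y hyD, hfg w hw] at this
  filter_upwards [htend.eventually hne,
    mem_nhdsWithin_of_mem_nhds (isOpen_ball.mem_nhds hw)] with y hy hyD
  refine (HasDerivAt.of_local_left_inverse (hcont y hyD)
    (han _ (hmg hyD)).differentiableAt.hasDerivAt hy ?_).differentiableAt
  filter_upwards [isOpen_ball.mem_nhds hyD] with x hx using hfg x hx

open MeasureTheory in
lemma core (W S : Set ℂ) (hWD : W ⊆ ball 0 1) (hfr : frontier W ∩ ball 0 1 ⊆ S)
    (hS : S ⊆ {w | 1/2 < ‖w‖}) (h0 : (0:ℂ) ∉ W) (η : ℝ) (hη : 0 < η) (hη2 : η < 1/2)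
    (hvol : ∀ (h : ℂ → ℝ) (A : Set ℂ) (K : NNReal), IsOpen A → S ⊆ A →
      DifferentiableOn ℝ h A → LipschitzOnWith K h A → volume (h '' S) ≤ K * ENNReal.ofReal η)
    (K : Set ℂ) (hK : IsPreconnected K) (hKW : K ⊆ W) (a b : ℂ) (ha : a ∈ K) (hb : b ∈ K) :
    ‖a - b‖ ^ 2 ≤ η ^ 2 + 8 * η := by
  set A : Set ℂ := {w | 1/2 < ‖w‖} with hA
  have hAo : IsOpen A := isOpen_lt continuous_const continuous_norm
  have hA0 : ∀ w ∈ A, w ≠ 0 := by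
    rintro w hw rfl
    simp [hA] at hw
    linarith
  have hW0 : ∀ w ∈ W, w ≠ 0 := by
    rintro w hw rfl
    exact h0 hw
  have hcross : ∀ T : Set ℂ, IsPreconnected T → T ⊆ ball 0 1 → (T ∩ W).Nonempty →
      (T ∩ Wᶜ).Nonempty → (T ∩ S).Nonempty := by
    intro T hT hTD h1 h2
    by_contra hne
    have hnf : ∀ x ∈ T, x ∉ frontier W := fun x hx hxf => hne ⟨x, hx, hfr ⟨hxf, hTD hx⟩⟩
    have hin : ∀ x ∈ T, x ∈ W → x ∈ interior W := fun x hx hxW => by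
      by_contra h
      exact hnf x hx ⟨subset_closure hxW, h⟩
    have hout : ∀ x ∈ T, x ∉ W → x ∈ (closure W)ᶜ := fun x hx hxW h =>
      hnf x hx ⟨h, fun h' => hxW (interior_subset h')⟩
    obtain ⟨x, hx, hx'⟩ := h1
    obtain ⟨y, hy, hy'⟩ := h2
    obtain ⟨z, -, hz, hz'⟩ := hT (interior W) (closure W)ᶜ isOpen_interior
      isClosed_closure.isOpen_compl
      (fun x hx => (em (x ∈ W)).imp (hin x hx) (hout x hx))
      ⟨x, hx, hin x hx hx'⟩ ⟨y, hy, hout y hy hy'⟩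
    exact hz' (subset_closure (interior_subset hz))
  have ha0 : a ≠ 0 := hW0 a (hKW ha)
  have hb0 : b ≠ 0 := hW0 b (hKW hb)
  have han : 0 < ‖a‖ := norm_pos_iff.2 ha0
  have hbn : 0 < ‖b‖ := norm_pos_iff.2 hb0
  -- angular function
  set h1 : ℂ → ℝ := fun w => inner ℝ a w / (‖a‖ * ‖w‖) with hh1
  have hscale : ∀ (t : ℝ) (w : ℂ), 0 < t → h1 (t • w) = h1 w := by
    intro t w ht
    simp only [hh1, inner_smul_right, norm_smul, Real.norm_eq_abs, abs_of_pos ht]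
    rw [show ‖a‖ * (t * ‖w‖) = t * (‖a‖ * ‖w‖) by ring, mul_div_mul_left _ _ ht.ne']
  have hh1W : h1 '' W ⊆ h1 '' S := by
    rintro _ ⟨k, hk, rfl⟩
    obtain ⟨x, hx, hxS⟩ := hcross (segment ℝ 0 k) (convex_segment _ _).isPreconnected
      ((convex_ball (0:ℂ) 1).segment_subset (mem_ball_self one_pos) (hWD hk))
      ⟨k, right_mem_segment _ _ _, hk⟩ ⟨0, left_mem_segment _ _ _, h0⟩
    rw [segment_eq_image'] at hx
    obtain ⟨t, ht, rfl⟩ := hx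
    simp only [sub_zero, zero_add] at hxS
    have ht0 : 0 < t := by
      rcases ht.1.lt_or_eq with h | h
      · exact h
      · rw [← h, zero_smul] at hxS
        exact absurd rfl (hA0 _ (hS hxS))
    exact ⟨_, hxS, hscale t k ht0⟩
  have hd1 : DifferentiableOn ℝ h1 A := by
    intro w hw
    have hw0 := hA0 w hw
    have : DifferentiableAt ℝ (fun w : ℂ => ‖w‖) w := differentiableAt_id.norm ℝ hw0
    have h2 : DifferentiableAt ℝ (fun w : ℂ => inner ℝ a w) w :=
      (innerSL ℝ a).differentiableAt
    have h3 : DifferentiableAt ℝ (fun w : ℂ => ‖a‖ * ‖w‖) w := this.const_mul ‖a‖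
    have h4 : ‖a‖ * ‖w‖ ≠ 0 := by
      have := norm_pos_iff.2 hw0
      positivity
    have h5 : DifferentiableAt ℝ h1 w := by
      simp only [hh1, div_eq_mul_inv]
      exact h2.mul (h3.inv h4)
    exact h5.differentiableWithinAt
  have hL1 : LipschitzOnWith 4 h1 A := by
    refine LipschitzOnWith.of_dist_le_mul fun x hx y hy => ?_
    have hx0 := norm_pos_iff.2 (hA0 x hx)
    have hy0 := norm_pos_iff.2 (hA0 y hy)
    have hxh : 1/2 < ‖x‖ := hx
    have e1 : h1 x - h1 y = inner ℝ a (‖x‖⁻¹ • x - ‖y‖⁻¹ • y) / ‖a‖ := by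
      simp only [hh1, inner_sub_right, inner_smul_right]
      field_simp
    rw [Real.dist_eq, e1, abs_div, abs_of_pos han, div_le_iff₀ han]
    have e2 := abs_real_inner_le_norm a (‖x‖⁻¹ • x - ‖y‖⁻¹ • y)
    have e3 : ‖‖x‖⁻¹ • x - ‖y‖⁻¹ • y‖ ≤ 4 * ‖x - y‖ := by
      have : ‖x‖⁻¹ • x - ‖y‖⁻¹ • y = ‖x‖⁻¹ • ((x - y) + ((‖y‖ - ‖x‖) * ‖y‖⁻¹) • y) := by
        rw [smul_add, smul_sub, smul_smul, sub_mul, mul_inv_cancel₀ hy0.ne', mul_sub, sub_smul,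
          mul_one, ← mul_assoc, inv_mul_cancel₀ hx0.ne', one_mul]
        abel
      rw [this, norm_smul, norm_inv, norm_norm, inv_mul_le_iff₀ hx0]
      have e4 : ‖((‖y‖ - ‖x‖) * ‖y‖⁻¹) • y‖ ≤ ‖x - y‖ := by
        rw [norm_smul, norm_mul, norm_inv, norm_norm, mul_assoc, inv_mul_cancel₀ hy0.ne', mul_one,
          Real.norm_eq_abs, norm_sub_rev]
        exact abs_norm_sub_norm_le y x
      have e5 := norm_add_le (x - y) (((‖y‖ - ‖x‖) * ‖y‖⁻¹) • y)
      nlinarith [norm_nonneg (x - y)]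
    rw [dist_eq_norm]
    have : ((4 : NNReal) : ℝ) = 4 := by norm_num
    rw [this]
    nlinarith
  have hv1 : volume (h1 '' S) ≤ ENNReal.ofReal (4 * η) := by
    refine (hvol h1 A 4 hAo hS hd1 hL1).trans (le_of_eq ?_)
    rw [ENNReal.ofReal_mul (by norm_num)]
    norm_num
  have hv2 : volume ((fun w : ℂ => ‖w‖) '' S) ≤ ENNReal.ofReal η := by
    refine (hvol (fun w : ℂ => ‖w‖) A 1 hAo hS ?_ (lipschitzWith_one_norm.lipschitzOnWith)).trans
      (le_of_eq (by simp))
    exact fun w hw => (differentiableAt_id.norm ℝ (hA0 w hw)).differentiableWithinAt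
  have hc1 : ContinuousOn h1 K := by
    intro w hw
    have hw0 := norm_pos_iff.2 (hW0 w (hKW hw))
    refine ContinuousAt.continuousWithinAt (ContinuousAt.div ?_ ?_ (by positivity))
    · fun_prop
    · fun_prop
  have h1a : h1 a = 1 := by
    simp only [hh1, real_inner_self_eq_norm_mul_norm]
    field_simp
  have hb1 : 1 - h1 b ≤ 4 * η := by
    have hsub : Icc (h1 b) 1 ⊆ h1 '' S := by
      rw [← h1a]
      exact ((hK.image h1 hc1).ordConnected.out (mem_image_of_mem _ hb)
        (mem_image_of_mem _ ha)).trans ((image_mono hKW).trans hh1W)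
    have := (measure_mono hsub).trans hv1
    rw [Real.volume_Icc] at this
    exact (ENNReal.ofReal_le_ofReal_iff (by positivity)).1 this
  -- a missing direction
  obtain ⟨u, hu, huW⟩ : ∃ u : ℂ, ‖u‖ = 1 ∧ ∀ s : ℝ, 0 < s → s • u ∉ W := by
    have : ¬ Icc (-1:ℝ) 1 ⊆ h1 '' S := by
      intro hsub
      have := (measure_mono hsub).trans hv1
      rw [Real.volume_Icc] at this
      have := (ENNReal.ofReal_le_ofReal_iff (by positivity)).1 this
      linarith
    obtain ⟨c, hc, hcS⟩ := not_subset.1 this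
    set θ := Real.arccos c
    refine ⟨(‖a‖⁻¹ : ℝ) • (a * Complex.exp (θ * Complex.I)), ?_, ?_⟩
    · rw [norm_smul, norm_mul, Complex.norm_exp_ofReal_mul_I, norm_inv, norm_norm]
      field_simp
    · intro s hs hsW
      apply hcS
      have := hh1W (mem_image_of_mem h1 hsW)
      rw [hscale _ _ hs, hscale _ _ (inv_pos.2 han)] at this
      convert this
      simp only [hh1, norm_mul, Complex.norm_exp_ofReal_mul_I, mul_one]
      have e : inner ℝ a (a * Complex.exp (θ * Complex.I)) = ‖a‖ * ‖a‖ * c := by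
        have hcc : Real.cos θ = c := Real.cos_arccos hc.1 hc.2
        rw [← hcc, ← sq, Complex.sq_norm, Complex.normSq_apply,
          Complex.inner, Complex.exp_mul_I, ← Complex.ofReal_cos, ← Complex.ofReal_sin]
        simp [-Complex.ofReal_cos, -Complex.ofReal_sin]
        ring
      rw [e]
      field_simp
  have hnK : (fun w : ℂ => ‖w‖) '' K ⊆ (fun w : ℂ => ‖w‖) '' S := by
    rintro _ ⟨k, hk, rfl⟩
    have hkW := hKW hk
    have hk0 := norm_pos_iff.2 (hW0 k hkW)
    obtain ⟨x, hx, hxS⟩ := hcross (sphere 0 ‖k‖)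
      (isPreconnected_sphere (by simp [Complex.rank_real_complex]) 0 ‖k‖)
      (fun x hx => by
        have := hWD hkW
        simp at this hx ⊢
        rwa [hx]) ⟨k, by simp, hkW⟩
      ⟨‖k‖ • u, by simp [hu], huW _ hk0⟩
    exact ⟨x, hxS, by simpa using hx⟩
  have hoc : OrdConnected ((fun w : ℂ => ‖w‖) '' K) :=
    (hK.image _ continuous_norm.continuousOn).ordConnected
  have hn : ∀ x ∈ K, ∀ y ∈ K, ‖x‖ - ‖y‖ ≤ η := by
    intro x hx y hy
    have hsub : Icc ‖y‖ ‖x‖ ⊆ (fun w : ℂ => ‖w‖) '' S :=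
      (hoc.out (mem_image_of_mem _ hy) (mem_image_of_mem _ hx)).trans hnK
    have := (measure_mono hsub).trans hv2
    rw [Real.volume_Icc] at this
    exact (ENNReal.ofReal_le_ofReal_iff (by positivity)).1 this
  have hn1 := hn a ha b hb
  have hn2 := hn b hb a ha
  have ea : ‖a‖ < 1 := by simpa using hWD (hKW ha)
  have eb : ‖b‖ < 1 := by simpa using hWD (hKW hb)
  have ein : inner ℝ a b = ‖a‖ * ‖b‖ * h1 b := by
    simp only [hh1]
    field_simp
  rw [norm_sub_sq_real, ein]
  have hab : ‖a‖ * ‖b‖ ≤ 1 := by nlinarith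
  have hab0 : 0 < ‖a‖ * ‖b‖ := by positivity
  have : (‖a‖ * ‖b‖) * (1 - h1 b) ≤ 4 * η := by nlinarith
  nlinarith

open Filter Topology MeasureTheory in
lemma BiD.exists_lim {U : Set ℂ} {f g : ℂ → ℂ} (B : BiD U f g) {P : ℂ} (hP : P ∈ frontier U)
    (hS : SchoenfliesAt U P) : ∃ y, Tendsto f (𝓝[U] P) (𝓝 y) := by
  have hPU : P ∉ U := by
    have := hP.2
    rwa [B.ho.interior_eq] at this
  have : (𝓝[U] P).NeBot := mem_closure_iff_nhdsWithin_neBot.1 hP.1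
  have hinj : InjOn f U := fun x hx y hy h => by rw [← B.gf x hx, ← B.gf y hy, h]
  rw [← cauchy_map_iff_exists_tendsto, Metric.cauchy_iff]
  refine ⟨inferInstance, fun ε hε => ?_⟩
  -- choose the small length
  obtain ⟨η, hη, hη2, hηε⟩ : ∃ η : ℝ, 0 < η ∧ η < 1/2 ∧ η ^ 2 + 8 * η < ε ^ 2 := by
    refine ⟨min (1/4) (ε ^ 2 / 10), by positivity, ?_, ?_⟩
    · exact (min_le_left _ _).trans_lt (by norm_num)
    · have h1 := min_le_left (1/4 : ℝ) (ε ^ 2 / 10)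
      have h2 := min_le_right (1/4 : ℝ) (ε ^ 2 / 10)
      have h3 : 0 < min (1/4 : ℝ) (ε ^ 2 / 10) := by positivity
      nlinarith
  obtain ⟨R, hR, hRd⟩ : ∃ R > 0, ∀ z ∈ U ∩ ball P R, 1/2 < ‖f z‖ := by
    have hc : IsCompact (g '' closedBall 0 (1/2)) :=
      (isCompact_closedBall 0 (1/2)).image_of_continuousOn
        (B.dg.continuousOn.mono (closedBall_subset_ball (by norm_num)))
    have hPn : P ∉ g '' closedBall 0 (1/2) := by
      rintro ⟨w, hw, rfl⟩
      exact hPU (B.mg (closedBall_subset_ball (by norm_num) hw))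
    obtain ⟨R, hR, hb⟩ := Metric.mem_nhds_iff.1 (hc.isClosed.isOpen_compl.mem_nhds hPn)
    refine ⟨R, hR, fun z hz => ?_⟩
    by_contra! h
    exact hb hz.2 ⟨f z, by simpa using h, B.gf z hz.1⟩
  have hfU : f '' U ⊆ ball 0 1 := B.mf.image_subset
  obtain ⟨ρ, hρ, hvol⟩ := length_area U B.ho f B.df hinj
    ((measure_mono hfU).trans_lt measure_ball_lt_top).ne P R η hR hη
  obtain ⟨r, hr, hj⟩ := hS ρ hρ.1
  set W := f '' (U ∩ ball P ρ) with hW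
  have hWeq : W = ball 0 1 ∩ g ⁻¹' (ball P ρ) := by
    ext w
    constructor
    · rintro ⟨z, hz, rfl⟩
      refine ⟨B.mf hz.1, ?_⟩
      rw [mem_preimage, B.gf z hz.1]
      exact hz.2
    · rintro ⟨hw, hw2⟩
      exact ⟨g w, ⟨B.mg hw, hw2⟩, B.fg w hw⟩
  have hWo : IsOpen W := by
    rw [hWeq]
    exact B.dg.continuousOn.isOpen_inter_preimage isOpen_ball isOpen_ball
  have hsmall : U ∩ ball P ρ ⊆ U ∩ ball P R := inter_subset_inter_right _ (ball_subset_ball hρ.2.le)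
  have hcore := core W (f '' (U ∩ sphere P ρ)) (by rw [hWeq]; exact inter_subset_left) ?_ ?_ ?_
    η hη hη2 hvol
  · refine ⟨f '' (U ∩ ball P r), ?_, ?_⟩
    · refine image_mem_map ?_
      exact inter_mem_nhdsWithin U (ball_mem_nhds P hr)
    · rintro _ ⟨x, hx, rfl⟩ _ ⟨y, hy, rfl⟩
      obtain ⟨γ, hγ⟩ := hj x hx y hy
      have hrange : range γ ⊆ U ∩ ball P ρ := by
        rintro _ ⟨t, rfl⟩
        exact hγ t
      have h := hcore (f '' range γ) ((isPreconnected_range γ.continuous).image f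
        (B.df.continuousOn.mono (hrange.trans inter_subset_left))) (image_mono hrange)
        (f x) (f y) ⟨x, ⟨0, γ.source⟩, rfl⟩ ⟨y, ⟨1, γ.target⟩, rfl⟩
      rw [dist_eq_norm]
      exact lt_of_pow_lt_pow_left₀ 2 hε.le (h.trans_lt hηε)
  · rintro w ⟨hwf, hw⟩
    refine ⟨g w, ⟨B.mg hw, ?_⟩, B.fg w hw⟩
    rw [hWo.frontier_eq] at hwf
    have h1 : g w ∈ closure (ball P ρ) := by
      have hcw : ContinuousWithinAt g W w :=
        ((B.dg.continuousOn w hw).continuousAt (isOpen_ball.mem_nhds hw)).continuousWithinAt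
      exact hcw.mem_closure hwf.1 (fun y hy => by rw [hWeq] at hy; exact hy.2)
    have h2 : g w ∉ ball P ρ := fun h => hwf.2 (by rw [hWeq]; exact ⟨hw, h⟩)
    have h1' := closure_ball_subset_closedBall h1
    simp only [mem_ball, mem_closedBall, mem_sphere, not_lt] at *
    exact le_antisymm h1' h2
  · rintro _ ⟨z, hz, rfl⟩
    exact hRd z ⟨hz.1, by
      have := hz.2
      simp only [mem_sphere, mem_ball] at *
      rw [this]
      exact hρ.2⟩
  · rintro ⟨z, hz, h0⟩
    have := hRd z (hsmall hz)
    rw [h0, norm_zero] at this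
    linarith

open Filter Topology in
lemma BiD.lim_mem_sphere {U : Set ℂ} {f g : ℂ → ℂ} (B : BiD U f g) {P ζ : ℂ}
    (hP : P ∈ frontier U) (hl : Tendsto f (𝓝[U] P) (𝓝 ζ)) : ζ ∈ sphere (0:ℂ) 1 := by
  have hPU : P ∉ U := by
    have := hP.2
    rwa [B.ho.interior_eq] at this
  have : (𝓝[U] P).NeBot := mem_closure_iff_nhdsWithin_neBot.1 hP.1
  have h1 : ζ ∈ closedBall (0:ℂ) 1 := by
    refine isClosed_closedBall.mem_of_tendsto hl ?_
    filter_upwards [self_mem_nhdsWithin] with z hz using ball_subset_closedBall (B.mf hz)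
  have h2 : ζ ∉ ball (0:ℂ) 1 := by
    intro h
    have hc := (B.dg.continuousOn ζ h).continuousAt (isOpen_ball.mem_nhds h)
    have h3 : Tendsto (fun z => g (f z)) (𝓝[U] P) (𝓝 (g ζ)) := hc.tendsto.comp hl
    have h4 : Tendsto (fun z => g (f z)) (𝓝[U] P) (𝓝 P) := by
      refine (tendsto_id.mono_left nhdsWithin_le_nhds).congr' ?_
      filter_upwards [self_mem_nhdsWithin] with z hz using (B.gf z hz).symm
    rw [tendsto_nhds_unique h4 h3] at hPU
    exact hPU (B.mg h)
  simp only [mem_ball, mem_closedBall, mem_sphere, not_lt] at *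
  exact le_antisymm h1 h2

lemma arc_isPreconnected (ζ : ℂ) (hζ : ζ ∈ sphere (0:ℂ) 1) (s : ℝ) (hs : 0 < s) :
    IsPreconnected (ball (0:ℂ) 1 ∩ sphere ζ s) := by
  have hζ1 : ‖ζ‖ = 1 := by simpa using hζ
  set c : ℝ → ℂ := fun θ => ζ * (1 - s * Complex.exp (θ * Complex.I)) with hc
  have hcc : Continuous c := by fun_prop
  set T : Set ℝ := {θ | θ ∈ Icc (-Real.pi) Real.pi ∧ s / 2 < Real.cos θ} with hT
  have hoc : T.OrdConnected := by
    refine ⟨fun x hx y hy z hz => ⟨⟨hx.1.1.trans hz.1, hz.2.trans hy.1.2⟩, ?_⟩⟩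
    rcases le_total 0 z with h | h
    · exact hy.2.trans_le (Real.cos_le_cos_of_nonneg_of_le_pi h hy.1.2 hz.2)
    · rw [← Real.cos_neg]
      have h2 := hx.2
      rw [← Real.cos_neg] at h2
      exact h2.trans_le (Real.cos_le_cos_of_nonneg_of_le_pi (by linarith) (by linarith [hx.1.1])
        (by linarith [hz.1]))
  have hnorm : ∀ θ : ℝ, ‖c θ‖ ^ 2 = 1 - 2 * s * Real.cos θ + s ^ 2 := by
    intro θ
    rw [hc]
    simp only [norm_mul, hζ1, one_mul]
    rw [Complex.sq_norm, Complex.normSq_apply, Complex.exp_mul_I, ← Complex.ofReal_cos,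
      ← Complex.ofReal_sin]
    simp [-Complex.ofReal_cos, -Complex.ofReal_sin]
    nlinarith [Real.sin_sq_add_cos_sq θ]
  have hball : ∀ θ : ℝ, c θ ∈ ball (0:ℂ) 1 ↔ s / 2 < Real.cos θ := by
    intro θ
    rw [mem_ball_zero_iff, ← sq_lt_one_iff₀ (norm_nonneg _), hnorm]
    constructor
    · intro h
      have : s * (s - 2 * Real.cos θ) < s * 0 := by nlinarith
      have := lt_of_mul_lt_mul_left this hs.le
      linarith
    · intro h
      nlinarith
  have heq : ball (0:ℂ) 1 ∩ sphere ζ s = c '' T := by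
    ext w
    constructor
    · rintro ⟨hw, hws⟩
      have hζ0 : ζ ≠ 0 := by
        rintro rfl
        simp at hζ1
      set v := (1 - w / ζ) with hv
      have hvn : ‖v‖ = s := by
        have : v = (ζ - w) / ζ := by rw [hv]; field_simp
        rw [this, norm_div, hζ1, div_one, ← dist_eq_norm, dist_comm]
        exact hws
      have hcw : c v.arg = w := by
        have := Complex.norm_mul_exp_arg_mul_I v
        rw [hvn] at this
        simp only [hc]
        rw [this, hv]
        field_simp
        ring
      refine ⟨v.arg, ⟨⟨(Complex.neg_pi_lt_arg v).le, Complex.arg_le_pi v⟩, ?_⟩, hcw⟩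
      rw [← hball, hcw]
      exact hw
    · rintro ⟨θ, hθ, rfl⟩
      refine ⟨(hball θ).2 hθ.2, ?_⟩
      rw [mem_sphere, dist_eq_norm]
      have : c θ - ζ = - (ζ * (s * Complex.exp (θ * Complex.I))) := by
        simp only [hc]; ring
      rw [this, norm_neg, norm_mul, norm_mul, Complex.norm_exp_ofReal_mul_I, hζ1]
      simp [abs_of_pos hs]
  rw [heq]
  exact hoc.isPreconnected.image c hcc.continuousOn

open Filter Topology in
lemma BiD.cross {U : Set ℂ} {f g : ℂ → ℂ} (B : BiD U f g) {P ζ : ℂ}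
    (hP : P ∈ frontier U) (hS : SchoenfliesAt U P) (hl : Tendsto f (𝓝[U] P) (𝓝 ζ)) (d : ℝ)
    (hd : 0 < d) :
    ∃ s₀ > 0, ∀ s ∈ Ioo 0 s₀, ∃ w ∈ ball (0:ℂ) 1 ∩ sphere ζ s, g w ∈ ball P d := by
  obtain ⟨r, hr, hj⟩ := hS d hd
  have : (𝓝[U] P).NeBot := mem_closure_iff_nhdsWithin_neBot.1 hP.1
  have hev : ∀ᶠ z in 𝓝[U] P, z ∈ U ∩ ball P r := by
    exact inter_mem_nhdsWithin U (ball_mem_nhds P hr)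
  obtain ⟨x, hx⟩ := hev.exists
  have hζ := B.lim_mem_sphere hP hl
  have hne : f x ≠ ζ := by
    intro h
    have h1 := B.mf hx.1
    rw [h] at h1
    simp at h1 hζ
    linarith
  refine ⟨dist (f x) ζ, dist_pos.2 hne, fun s hs => ?_⟩
  obtain ⟨y, hy, hys⟩ := (hev.and (hl.eventually (ball_mem_nhds ζ hs.1))).exists
  obtain ⟨γ, hγ⟩ := hj x hx y hy
  have hcont : Continuous (fun t => dist (f (γ t)) ζ) := by
    have : Continuous (fun t => f (γ t)) :=
      B.df.continuousOn.comp_continuous γ.continuous (fun t => (hγ t).1)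
    exact this.dist continuous_const
  obtain ⟨t, ht⟩ := mem_range_of_exists_le_of_exists_ge hcont (c := s)
    ⟨1, by simpa using hys.le⟩ ⟨0, by simpa using hs.2.le⟩
  refine ⟨f (γ t), ⟨B.mf (hγ t).1, ht⟩, ?_⟩
  rw [B.gf _ (hγ t).1]
  exact (hγ t).2

open Filter Topology MeasureTheory in
lemma BiD.lim_inj {U : Set ℂ} {f g : ℂ → ℂ} (B : BiD U f g) {P Q ζ : ℂ}
    (hP : P ∈ frontier U) (hSP : SchoenfliesAt U P) (hlP : Tendsto f (𝓝[U] P) (𝓝 ζ))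
    (hQ : Q ∈ frontier U) (hSQ : SchoenfliesAt U Q) (hlQ : Tendsto f (𝓝[U] Q) (𝓝 ζ)) :
    P = Q := by
  by_contra hne
  have hPU : P ∉ U := by
    have := hP.2
    rwa [B.ho.interior_eq] at this
  have hζ := B.lim_mem_sphere hP hlP
  set d := dist P Q / 3 with hd
  have hdp : 0 < d := div_pos (dist_pos.2 hne) (by norm_num)
  obtain ⟨s₁, hs₁, hw₁⟩ := B.cross hP hSP hlP d hdp
  obtain ⟨s₂, hs₂, hw₂⟩ := B.cross hQ hSQ hlQ d hdp
  set Ω := ball (0:ℂ) 1 ∩ g ⁻¹' (ball P (2 * d)) with hΩ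
  have hΩo : IsOpen Ω := B.dg.continuousOn.isOpen_inter_preimage isOpen_ball isOpen_ball
  have hgi : InjOn g Ω := fun x hx y hy h => by rw [← B.fg x hx.1, ← B.fg y hy.1, h]
  have hsub : g '' Ω ⊆ ball P (2 * d) := by
    rintro _ ⟨w, hw, rfl⟩
    exact hw.2
  obtain ⟨ρ, hρ, hvol⟩ := length_area Ω hΩo g (B.dg.mono inter_subset_left) hgi
    ((measure_mono hsub).trans_lt measure_ball_lt_top).ne ζ (min s₁ s₂) (d / 2)
    (lt_min hs₁ hs₂) (by positivity)
  have hv := hvol (fun z => ‖z - P‖) {P}ᶜ 1 isOpen_compl_singleton ?_ ?_ ?_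
  · obtain ⟨a, ha, haP⟩ := hw₁ ρ ⟨hρ.1, hρ.2.trans_le (min_le_left _ _)⟩
    obtain ⟨b, hb, hbQ⟩ := hw₂ ρ ⟨hρ.1, hρ.2.trans_le (min_le_right _ _)⟩
    have hpre := arc_isPreconnected ζ hζ ρ hρ.1
    have hoc : OrdConnected ((fun w => ‖g w - P‖) '' (ball (0:ℂ) 1 ∩ sphere ζ ρ)) := by
      refine (hpre.image _ ?_).ordConnected
      have := B.dg.continuousOn.mono (inter_subset_left (s := ball (0:ℂ) 1) (t := sphere ζ ρ))
      fun_prop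
    have haP' : ‖g a - P‖ < d := by rw [← dist_eq_norm]; exact haP
    have hbQ' : 2 * d < ‖g b - P‖ := by
      rw [← dist_eq_norm]
      have h1 : dist (g b) Q < d := hbQ
      have h2 := dist_triangle P (g b) Q
      rw [dist_comm P (g b)] at h2
      have h3 : dist P Q = 3 * d := by rw [hd]; ring
      linarith
    have hIoo : Ioo d (2 * d) ⊆ (fun z => ‖z - P‖) '' (g '' (Ω ∩ sphere ζ ρ)) := by
      intro t ht
      obtain ⟨w, hw, hwt⟩ := hoc.out (mem_image_of_mem _ ha) (mem_image_of_mem _ hb)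
        ⟨haP'.le.trans ht.1.le, ht.2.le.trans hbQ'.le⟩
      refine ⟨g w, ⟨w, ⟨⟨hw.1, ?_⟩, hw.2⟩, rfl⟩, hwt⟩
      simp only [mem_preimage, mem_ball, dist_eq_norm]
      simp only at hwt
      rw [hwt]
      exact ht.2
    have := (measure_mono hIoo).trans hv
    rw [Real.volume_Ioo, ENNReal.coe_one, one_mul] at this
    have := (ENNReal.ofReal_le_ofReal_iff (by positivity)).1 this
    linarith
  · rintro _ ⟨w, hw, rfl⟩ h
    exact hPU (h ▸ B.mg hw.1.1)
  · intro z hz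
    have : DifferentiableAt ℝ (fun z : ℂ => z - P) z := by fun_prop
    exact (this.norm ℝ (sub_ne_zero.2 hz)).differentiableWithinAt
  · refine LipschitzOnWith.of_dist_le_mul fun x _ y _ => ?_
    rw [Real.dist_eq, dist_eq_norm, NNReal.coe_one, one_mul]
    simpa using abs_norm_sub_norm_le (x - P) (y - P)

open Filter Topology in
lemma BiD.inv_lim {U : Set ℂ} {f g : ℂ → ℂ} (B : BiD U f g) (V O : Set ℂ) (hO : IsOpen O)
    (hV : V = O ∩ frontier U) (hSch : ∀ P ∈ V, SchoenfliesAt U P) {P ζ : ℂ}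
    (hPV : P ∈ V) (hl : Tendsto f (𝓝[U] P) (𝓝 ζ)) :
    Tendsto g (𝓝[ball (0:ℂ) 1] ζ) (𝓝 P) := by
  have hPV' := hPV
  rw [hV] at hPV'
  have hP := hPV'.2
  have : (𝓝[U] P).NeBot := mem_closure_iff_nhdsWithin_neBot.1 hP.1
  have hζ := B.lim_mem_sphere hP hl
  have hζ1 : ‖ζ‖ = 1 := by simpa using hζ
  by_contra hcon
  rw [Metric.tendsto_nhds] at hcon
  push Not at hcon
  obtain ⟨ε, hε, hfreq⟩ := hcon
  obtain ⟨d₀, hd₀, hd₀O⟩ := Metric.isOpen_iff.1 hO P hPV'.1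
  set d := min ε (d₀ / 2) with hd
  have hdp : 0 < d := by positivity
  have hdO : sphere P d ⊆ O := by
    intro z hz
    apply hd₀O
    rw [mem_sphere] at hz
    rw [mem_ball, hz]
    exact (min_le_right _ _).trans_lt (by linarith)
  have key : ∀ δ > 0, ∃ y ∈ ball (0:ℂ) 1 ∩ ball ζ δ, g y ∈ sphere P d := by
    intro δ hδ
    obtain ⟨w, hw, hwD, hwδ⟩ := (hfreq.and_eventually
      (inter_mem_nhdsWithin (ball (0:ℂ) 1) (ball_mem_nhds ζ hδ))).exists
    have hev : ∀ᶠ z in 𝓝[U] P, z ∈ U ∩ ball P d := by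
      exact inter_mem_nhdsWithin U (ball_mem_nhds P hdp)
    obtain ⟨x, hx, hxδ⟩ := (hev.and (hl.eventually (ball_mem_nhds ζ hδ))).exists
    have hconv : Convex ℝ (ball (0:ℂ) 1 ∩ ball ζ δ) := (convex_ball _ _).inter (convex_ball _ _)
    have hcont : ContinuousOn (fun w => dist (g w) P) (ball (0:ℂ) 1 ∩ ball ζ δ) := by
      have := B.dg.continuousOn.mono (inter_subset_left (s := ball (0:ℂ) 1) (t := ball ζ δ))
      fun_prop
    obtain ⟨y, hy, hyd⟩ := (hconv.isPreconnected.image _ hcont).ordConnected.out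
      (mem_image_of_mem _ ⟨B.mf hx.1, hxδ⟩) (mem_image_of_mem _ ⟨hwD, hwδ⟩)
      (show d ∈ Icc _ _ from ⟨by
        simp only [B.gf x hx.1]
        exact hx.2.le, (min_le_left _ _).trans hw⟩)
    exact ⟨y, hy, hyd⟩
  choose y hy hyd using fun n : ℕ => key (1 / ((n:ℝ) + 1)) Nat.one_div_pos_of_nat
  obtain ⟨Q, hQ, φ, hφ, hlim⟩ := (isCompact_sphere P d).tendsto_subseq hyd
  have hyζ : Tendsto y atTop (𝓝 ζ) := by
    rw [tendsto_iff_dist_tendsto_zero]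
    exact squeeze_zero (fun _ => dist_nonneg) (fun n => (hy n).2.le)
      tendsto_one_div_add_atTop_nhds_zero_nat
  have hyφ := hyζ.comp hφ.tendsto_atTop
  have hfl : ∀ c, Tendsto f (𝓝[U] Q) (𝓝 c) → c = ζ := by
    intro c hc
    have h1 : Tendsto ((g ∘ y) ∘ φ) atTop (𝓝[U] Q) :=
      tendsto_nhdsWithin_iff.2 ⟨hlim, Eventually.of_forall fun n => B.mg (hy (φ n)).1⟩
    refine tendsto_nhds_unique ((hc.comp h1).congr fun n => ?_) hyφ
    exact B.fg _ (hy (φ n)).1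
  have hQcl : Q ∈ closure U :=
    mem_closure_of_tendsto hlim (Eventually.of_forall fun n => B.mg (hy (φ n)).1)
  have hQU : Q ∉ U := by
    intro h
    have h1 := hfl (f Q) (B.df.continuousOn Q h)
    have h2 := B.mf h
    rw [h1] at h2
    simp [hζ1] at h2
  have hQf : Q ∈ frontier U := by
    rw [B.ho.frontier_eq]
    exact ⟨hQcl, hQU⟩
  have hQV : Q ∈ V := by
    rw [hV]
    exact ⟨hdO hQ, hQf⟩
  obtain ⟨c, hc⟩ := B.exists_lim hQf (hSch Q hQV)
  have hcζ := hfl c hc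
  subst hcζ
  have hPQ := B.lim_inj hP (hSch P hPV) hl hQf (hSch Q hQV) hc
  rw [← hPQ] at hQ
  simp at hQ
  linarith

/-- Carathéodory's boundary extension theorem: let `U ⊂ ℂ` be a simply connected open
set, `f : U → D` a biholomorphic map onto the unit disk, and `V` an open subset of the
boundary of `U` every point of which has the property of Schönflies. Then `f` extends
to a homeomorphism from `U ∪ V` onto `D ∪ C` for some subset `C` of the unit circle. -/
theorem caratheodory_extension
    (U : Set ℂ) (hUo : IsOpen U) (hUne : U.Nonempty)
    (hUsc : SimplyConnectedSpace ↥U)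
    (f : ℂ → ℂ) (hf : DifferentiableOn ℂ f U)
    (hbij : BijOn f U (ball (0:ℂ) 1))
    (V : Set ℂ) (hVsub : V ⊆ frontier U)
    (hVopen : ∃ O : Set ℂ, IsOpen O ∧ V = O ∩ frontier U)
    (hSch : ∀ P ∈ V, SchoenfliesAt U P) :
    ∃ C ⊆ sphere (0:ℂ) 1, ∃ F : ↥(U ∪ V) ≃ₜ ↥(ball (0:ℂ) 1 ∪ C),
      ∀ z : ↥(U ∪ V), (z : ℂ) ∈ U → (F z : ℂ) = f z := by
  obtain ⟨g, B⟩ := exists_biD U hUo f hf hbij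
  obtain ⟨O, hO, hV⟩ := hVopen
  set Φ := extendFrom U f with hΦ
  set Γ := extendFrom (ball (0:ℂ) 1) g with hΓ
  have hΦU : ∀ z ∈ U, Φ z = f z := extendFrom_extends B.df.continuousOn
  have hΓD : ∀ w ∈ ball (0:ℂ) 1, Γ w = g w := extendFrom_extends B.dg.continuousOn
  have hΦV : ∀ P ∈ V, Filter.Tendsto f (nhdsWithin P U) (nhds (Φ P)) := fun P hP =>
    tendsto_extendFrom (B.exists_lim (hVsub hP) (hSch P hP))
  have hsph : ∀ P ∈ V, Φ P ∈ sphere (0:ℂ) 1 := fun P hP =>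
    B.lim_mem_sphere (hVsub hP) (hΦV P hP)
  have hΓlim : ∀ P ∈ V, Filter.Tendsto g (nhdsWithin (Φ P) (ball (0:ℂ) 1)) (nhds P) :=
    fun P hP => B.inv_lim V O hO hV hSch hP (hΦV P hP)
  have hcl : closure (ball (0:ℂ) 1) = closedBall 0 1 := closure_ball 0 one_ne_zero
  have hΓV : ∀ P ∈ V, Γ (Φ P) = P := fun P hP =>
    extendFrom_eq (by rw [hcl]; exact sphere_subset_closedBall (hsph P hP)) (hΓlim P hP)
  have hC : Φ '' V ⊆ sphere (0:ℂ) 1 := by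
    rintro _ ⟨P, hP, rfl⟩
    exact hsph P hP
  have hΦc : ContinuousOn Φ (U ∪ V) := by
    refine continuousOn_extendFrom
      (union_subset subset_closure (hVsub.trans frontier_subset_closure)) ?_
    rintro x (hx | hx)
    · exact ⟨f x, B.df.continuousOn x hx⟩
    · exact ⟨_, hΦV x hx⟩
  have hΓc : ContinuousOn Γ (ball (0:ℂ) 1 ∪ Φ '' V) := by
    refine continuousOn_extendFrom
      (union_subset subset_closure (by rw [hcl]; exact hC.trans sphere_subset_closedBall)) ?_
    rintro x (hx | ⟨P, hP, rfl⟩)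
    · exact ⟨g x, B.dg.continuousOn x hx⟩
    · exact ⟨_, hΓlim P hP⟩
  have hΦm : MapsTo Φ (U ∪ V) (ball (0:ℂ) 1 ∪ Φ '' V) := by
    rintro x (hx | hx)
    · rw [hΦU x hx]
      exact Or.inl (B.mf hx)
    · exact Or.inr (mem_image_of_mem _ hx)
  have hΓm : MapsTo Γ (ball (0:ℂ) 1 ∪ Φ '' V) (U ∪ V) := by
    rintro x (hx | ⟨P, hP, rfl⟩)
    · rw [hΓD x hx]
      exact Or.inl (B.mg hx)
    · rw [hΓV P hP]
      exact Or.inr hP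
  have hΓΦ : ∀ x ∈ U ∪ V, Γ (Φ x) = x := by
    rintro x (hx | hx)
    · rw [hΦU x hx, hΓD _ (B.mf hx), B.gf x hx]
    · exact hΓV x hx
  have hΦΓ : ∀ x ∈ ball (0:ℂ) 1 ∪ Φ '' V, Φ (Γ x) = x := by
    rintro x (hx | ⟨P, hP, rfl⟩)
    · rw [hΓD x hx, hΦU _ (B.mg hx), B.fg x hx]
    · rw [hΓV P hP]
  refine ⟨Φ '' V, hC,
    { toFun := hΦm.restrict
      invFun := hΓm.restrict
      left_inv := fun x => Subtype.ext (hΓΦ x x.2)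
      right_inv := fun x => Subtype.ext (hΦΓ x x.2)
      continuous_toFun := hΦc.mapsToRestrict hΦm
      continuous_invFun := hΓc.mapsToRestrict hΓm }, ?_⟩
  intro z hz
  exact hΦU z hz
end
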